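/- Let N ≥ 3 and p > 2 be fixed, and take a ≡ 1. There exists R_* > 0, depending on p and N, such that for every R > R_*, with A = A_R = {x ∈ ℝ^N : R < |x| < R+1}, every minimizer u ∈ N_K of I restricted to N_K is nonradial, i.e. there exist x, y ∈ A_R with |x| = |y| and u(x) ≠ u(y). In particular, for every R > R_*, the problem −Δu + u = |u|^{p−2}u in A_R, u > 0 in A_R, u = 0 on ∂A_R, admits a nonradial, axially symmetric weak solution. -/

import Mathlib

open MeasureTheory Real Set

noncomputable section

/-- The open annulus `{x : R₀ < |x| < R₁}` in `ℝ^N`. -/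
def annulus (N : ℕ) (R₀ R₁ : ℝ) : Set (EuclideanSpace ℝ (Fin N)) :=
  {x | R₀ < ‖x‖ ∧ ‖x‖ < R₁}

/-- The last coordinate `x_N` of a point of `ℝ^N`. -/
def lastCoord {N : ℕ} (x : EuclideanSpace ℝ (Fin N)) : ℝ :=
  if h : 0 < N then x ⟨N - 1, by omega⟩ else 0

/-- The polar angle `θ = arcsin (x_N / |x|)`. -/
def angleOf {N : ℕ} (x : EuclideanSpace ℝ (Fin N)) : ℝ :=
  Real.arcsin (lastCoord x / ‖x‖)

/-- `u` is axially symmetric on the closed annulus with representative `𝔲 = 𝔲(r,θ)`. -/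
def IsAxiallySymmRep (N : ℕ) (R₀ R₁ : ℝ) (u : EuclideanSpace ℝ (Fin N) → ℝ)
    (𝔲 : ℝ → ℝ → ℝ) : Prop :=
  ∀ x ∈ closure (annulus N R₀ R₁), u x = 𝔲 ‖x‖ (angleOf x)

/-- Membership in the cone `K̂`: `C¹` on the closed annulus, nonnegative, axially symmetric,
even in `θ` and nonincreasing in `θ` on `[0, π/2]`. -/
def memKhat (N : ℕ) (R₀ R₁ : ℝ) (u : EuclideanSpace ℝ (Fin N) → ℝ) : Prop :=
  ContDiffOn ℝ 1 u (closure (annulus N R₀ R₁)) ∧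
  (∀ x ∈ closure (annulus N R₀ R₁), 0 ≤ u x) ∧
  ∃ 𝔲 : ℝ → ℝ → ℝ,
    IsAxiallySymmRep N R₀ R₁ u 𝔲 ∧
    (∀ r ∈ Icc R₀ R₁, ∀ θ ∈ Icc (-(π / 2)) (π / 2), 𝔲 r (-θ) = 𝔲 r θ) ∧
    (∀ r ∈ Icc R₀ R₁, AntitoneOn (𝔲 r) (Icc 0 (π / 2)))

/-- `C¹₀(A)` : `C¹` on the closed annulus, vanishing on the boundary. -/
def memC10 (N : ℕ) (R₀ R₁ : ℝ) (u : EuclideanSpace ℝ (Fin N) → ℝ) : Prop :=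
  ContDiffOn ℝ 1 u (closure (annulus N R₀ R₁)) ∧
  ∀ x : EuclideanSpace ℝ (Fin N), (‖x‖ = R₀ ∨ ‖x‖ = R₁) → u x = 0

/-- The cone `K = K̂ ∩ C¹₀(A)`. -/
def memK (N : ℕ) (R₀ R₁ : ℝ) (u : EuclideanSpace ℝ (Fin N) → ℝ) : Prop :=
  memKhat N R₀ R₁ u ∧ ∀ x : EuclideanSpace ℝ (Fin N), (‖x‖ = R₀ ∨ ‖x‖ = R₁) → u x = 0

/-- The squared `H¹(A)`-norm `∫_A (|∇u|² + u²) dx`. -/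
def H1sq (N : ℕ) (R₀ R₁ : ℝ) (u : EuclideanSpace ℝ (Fin N) → ℝ) : ℝ :=
  ∫ x in annulus N R₀ R₁,
    (‖fderivWithin ℝ u (closure (annulus N R₀ R₁)) x‖ ^ 2 + (u x) ^ 2)

/-- The energy functional `I(u) = ½‖u‖²_{H¹} − (1/p) ∫_A a |u|^p`. -/
def funcI (N : ℕ) (R₀ R₁ : ℝ) (a : EuclideanSpace ℝ (Fin N) → ℝ) (p : ℝ)
    (u : EuclideanSpace ℝ (Fin N) → ℝ) : ℝ :=
  (1 / 2) * H1sq N R₀ R₁ u - (1 / p) * ∫ x in annulus N R₀ R₁, a x * |u x| ^ p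

/-- The Nehari set `N_K`. -/
def memNehari (N : ℕ) (R₀ R₁ : ℝ) (a : EuclideanSpace ℝ (Fin N) → ℝ) (p : ℝ)
    (u : EuclideanSpace ℝ (Fin N) → ℝ) : Prop :=
  memK N R₀ R₁ u ∧ (∃ x ∈ annulus N R₀ R₁, u x ≠ 0) ∧
  H1sq N R₀ R₁ u = ∫ x in annulus N R₀ R₁, a x * |u x| ^ p

/-- The Nehari level `c_I = inf_{N_K} I`. -/
def cI (N : ℕ) (R₀ R₁ : ℝ) (a : EuclideanSpace ℝ (Fin N) → ℝ) (p : ℝ) : ℝ :=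
  sInf {c | ∃ u, memNehari N R₀ R₁ a p u ∧ c = funcI N R₀ R₁ a p u}

/-- Test functions `C_c^∞(A)`. -/
def IsTestFun (N : ℕ) (R₀ R₁ : ℝ) (φ : EuclideanSpace ℝ (Fin N) → ℝ) : Prop :=
  ContDiff ℝ (⊤ : ℕ∞) φ ∧ HasCompactSupport φ ∧ tsupport φ ⊆ annulus N R₀ R₁

/-- Weak solution of `−Δu + u = a(x)|u|^{p−2}u` in `A`, `u = 0` on `∂A`. -/
def IsWeakSolution (N : ℕ) (R₀ R₁ : ℝ) (a : EuclideanSpace ℝ (Fin N) → ℝ) (p : ℝ)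
    (u : EuclideanSpace ℝ (Fin N) → ℝ) : Prop :=
  memC10 N R₀ R₁ u ∧
  ∀ φ : EuclideanSpace ℝ (Fin N) → ℝ, IsTestFun N R₀ R₁ φ →
    (∫ x in annulus N R₀ R₁,
      (fderivWithin ℝ u (closure (annulus N R₀ R₁)) x (gradient φ x) + u x * φ x))
    = ∫ x in annulus N R₀ R₁, a x * |u x| ^ (p - 2) * u x * φ x

/-- The (classical) Laplacian, as the sum of second partial derivatives. -/
def lapl {N : ℕ} (u : EuclideanSpace ℝ (Fin N) → ℝ) (x : EuclideanSpace ℝ (Fin N)) : ℝ :=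
  ∑ i : Fin N,
    fderiv ℝ (fun y => fderiv ℝ u y (EuclideanSpace.single i 1)) x (EuclideanSpace.single i 1)

/-- The inclusion `ℝ^{N-1} → ℝ^N`, `x' ↦ (x',0)`. -/
def embedHyper (N : ℕ) (x' : EuclideanSpace ℝ (Fin (N - 1))) : EuclideanSpace ℝ (Fin N) :=
  (WithLp.equiv 2 (Fin N → ℝ)).symm
    (fun j => if h : (j : ℕ) < N - 1 then x' ⟨j, h⟩ else 0)

/-- A `C¹` distance on the closed annulus. -/
def C1dist (N : ℕ) (R₀ R₁ : ℝ) (u v : EuclideanSpace ℝ (Fin N) → ℝ) : ℝ :=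
  (⨆ x : closure (annulus N R₀ R₁), |u x - v x|) +
  (⨆ x : closure (annulus N R₀ R₁),
    ‖fderivWithin ℝ u (closure (annulus N R₀ R₁)) x
      - fderivWithin ℝ v (closure (annulus N R₀ R₁)) x‖)

end

section
open MeasureTheory Real Set
open scoped ENNReal NNReal Topology
noncomputable section
namespace Ann

/-- Euclidean space. -/
abbrev E (N : ℕ) := EuclideanSpace ℝ (Fin N)

/-- unit sphere. -/
abbrev S (N : ℕ) := Metric.sphere (0 : E N) 1

/-- surface measure. -/
abbrev sig (N : ℕ) : Measure (S N) := (volume : Measure (E N)).toSphere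

lemma nontriv {N : ℕ} (hN : 3 ≤ N) : Nontrivial (E N) := by
  have : Nonempty (Fin N) := ⟨⟨0, by omega⟩⟩
  infer_instance

lemma polar_lintegral {N : ℕ} (f : E N → ℝ≥0∞) (hf : Measurable f) (hN : 3 ≤ N) :
    ∫⁻ x, f x = ∫⁻ ω : S N, (∫⁻ r in Ioi (0:ℝ), ENNReal.ofReal (r ^ (N - 1)) * f (r • (ω : E N)))
      ∂(sig N) := by
  have := nontriv hN
  have hmp := (volume : Measure (E N)).measurePreserving_homeomorphUnitSphereProd
  have h1 : ∫⁻ x, f x = ∫⁻ x : ({(0 : E N)}ᶜ : Set (E N)), f x ∂(Measure.comap Subtype.val volume) := by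
    rw [lintegral_subtype_comap (measurableSet_singleton _).compl f, restrict_compl_singleton]
  have h2 : ∫⁻ x : ({(0 : E N)}ᶜ : Set (E N)), f x ∂(Measure.comap Subtype.val volume)
      = ∫⁻ z, f ((homeomorphUnitSphereProd (E N)).symm z : E N)
        ∂((sig N).prod (Measure.volumeIoiPow (Module.finrank ℝ (E N) - 1))) := by
    rw [← hmp.lintegral_comp_emb (Homeomorph.measurableEmbedding _)]
    simp
  rw [h1, h2, lintegral_prod]
  · congr 1
    ext ω
    rw [Measure.volumeIoiPow, lintegral_withDensity_eq_lintegral_mul]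
    · simp only [finrank_euclideanSpace, Fintype.card_fin, Pi.mul_apply,
        homeomorphUnitSphereProd_symm_apply_coe]
      exact lintegral_subtype_comap measurableSet_Ioi
        (fun r => ENNReal.ofReal (r ^ (N - 1)) * f (r • (ω : E N)))
    · fun_prop
    · simp only [homeomorphUnitSphereProd_symm_apply_coe]
      fun_prop
  · simp only [homeomorphUnitSphereProd_symm_apply_coe]
    fun_prop

lemma polar_integral {N : ℕ} (f : E N → ℝ) (hf : Integrable f) (hN : 3 ≤ N) :
    ∫ x, f x = ∫ ω : S N, (∫ r in Ioi (0:ℝ), r ^ (N - 1) * f (r • (ω : E N))) ∂(sig N) := by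
  have := nontriv hN
  have hmp := (volume : Measure (E N)).measurePreserving_homeomorphUnitSphereProd
  have h1 : ∫ x, f x = ∫ x : ({(0 : E N)}ᶜ : Set (E N)), f x ∂(Measure.comap Subtype.val volume) := by
    rw [integral_subtype_comap (measurableSet_singleton _).compl f, restrict_compl_singleton]
  have h2 : ∫ x : ({(0 : E N)}ᶜ : Set (E N)), f x ∂(Measure.comap Subtype.val volume)
      = ∫ z, f ((homeomorphUnitSphereProd (E N)).symm z : E N)
        ∂((sig N).prod (Measure.volumeIoiPow (Module.finrank ℝ (E N) - 1))) := by
    rw [← hmp.integral_comp (Homeomorph.measurableEmbedding _)]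
    simp
  have h3 : Integrable (fun z => f ((homeomorphUnitSphereProd (E N)).symm z : E N))
      ((sig N).prod (Measure.volumeIoiPow (Module.finrank ℝ (E N) - 1))) := by
    rw [← hmp.integrable_comp_emb (Homeomorph.measurableEmbedding _)]
    have : Integrable (fun x : ({(0 : E N)}ᶜ : Set (E N)) => f x) (Measure.comap Subtype.val volume) := by
      have := (integrableOn_iff_comap_subtypeVal (μ := volume) (f := f)
        (measurableSet_singleton (0 : E N)).compl).1 hf.integrableOn
      exact this
    refine this.congr (Filter.Eventually.of_forall fun x => ?_)
    simp only [Function.comp_apply, Homeomorph.symm_apply_apply]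
  rw [h1, h2, integral_prod _ h3]
  congr 1
  ext ω
  simp only [Measure.volumeIoiPow, ENNReal.ofReal]
  rw [integral_withDensity_eq_integral_smul]
  · simp only [finrank_euclideanSpace, Fintype.card_fin,
        homeomorphUnitSphereProd_symm_apply_coe]
    rw [integral_subtype_comap measurableSet_Ioi
        (fun r => Real.toNNReal (r ^ (N - 1)) • f (r • (ω : E N)))]
    refine setIntegral_congr_fun measurableSet_Ioi fun r hr => ?_
    simp only [NNReal.smul_def, smul_eq_mul]
    rw [Real.coe_toNNReal _ (pow_nonneg (le_of_lt hr) _)]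
  · fun_prop

/-- total surface area -/
def sg (N : ℕ) : ℝ := (sig N).real univ

lemma sg_pos {N : ℕ} (hN : 3 ≤ N) : 0 < sg N := by
  have := nontriv hN
  unfold sg
  rw [Measure.toSphere_real_apply_univ]
  have h : 0 < volume.real (Metric.ball (0 : E N) 1) :=
    ENNReal.toReal_pos (Metric.measure_ball_pos _ _ one_pos).ne' measure_ball_lt_top.ne
  have : 0 < Module.finrank ℝ (E N) := Module.finrank_pos
  positivity

lemma integrable_radial {N : ℕ} (hN : 3 ≤ N) {f : ℝ → ℝ} :
    Integrable (fun x : E N => f ‖x‖) ↔ IntegrableOn (fun y : ℝ ↦ y ^ (N - 1) * f y) (Ioi 0) := by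
  have := nontriv hN
  have h := integrable_fun_norm_addHaar (volume : Measure (E N)) (f := f)
  simpa using h

lemma integral_radial {N : ℕ} (hN : 3 ≤ N) (f : ℝ → ℝ) :
    ∫ x : E N, f ‖x‖ = sg N * ∫ y in Ioi (0:ℝ), y ^ (N - 1) * f y := by
  have := nontriv hN
  have h := integral_fun_norm_addHaar (volume : Measure (E N)) (f := f)
  rw [h, sg, Measure.toSphere_real_apply_univ]
  simp [mul_assoc]

end Ann
end
end

section
open MeasureTheory Real Set
open scoped ENNReal NNReal Topology
noncomputable section
namespace Ann

/-- weight exponent -/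
def mm (N : ℕ) : ℝ := ((N : ℝ) + 2) / 2

/-- (regularised) Newton kernel -/
def K {N : ℕ} (ε : ℝ) (z : E N) : ℝ := (‖z‖ ^ 2 + ε) ^ (-((N : ℝ) - 2) / 2)

/-- its differential -/
def DK {N : ℕ} (ε : ℝ) (z : E N) : E N →L[ℝ] ℝ :=
  (-((N : ℝ) - 2) * (‖z‖ ^ 2 + ε) ^ (-(N : ℝ) / 2)) • innerSL ℝ z

/-- decay class -/
structure Dec {N : ℕ} (F : E N → ℝ) (M : ℝ) : Prop where
  meas : AEStronglyMeasurable F volume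
  nn : 0 ≤ M
  bd : ∀ y, y ≠ 0 → |F y| ≤ M * ‖y‖ ^ (-mm N)

lemma K_hasFDerivAt {N : ℕ} {ε : ℝ} (hε : 0 < ε) (z : E N) : HasFDerivAt (K ε) (DK ε z) z := by
  have h1 : HasFDerivAt (fun x : E N => ‖x‖ ^ 2 + ε) (2 • innerSL ℝ z) z :=
    (hasStrictFDerivAt_norm_sq z).hasFDerivAt.add_const ε
  have h2 := h1.rpow_const (p := -((N : ℝ) - 2) / 2) (Or.inl (by positivity))
  refine h2.congr_fderiv ?_
  unfold DK
  rw [show -((N : ℝ) - 2) / 2 - 1 = -(N : ℝ) / 2 by ring]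
  ext v
  simp
  ring

lemma cast3 {N : ℕ} (hN : 3 ≤ N) : (3 : ℝ) ≤ N := by exact_mod_cast hN

lemma rpow_sq_half {s : ℝ} (hs : 0 ≤ s) (a : ℝ) : (s ^ 2) ^ (a / 2) = s ^ a := by
  rw [← Real.rpow_natCast, ← Real.rpow_mul hs]
  congr 1
  push_cast
  ring

lemma K_nonneg {N : ℕ} {ε : ℝ} (hε : 0 ≤ ε) (z : E N) : 0 ≤ K ε z := by
  unfold K; positivity

lemma K_zero {N : ℕ} (z : E N) : K 0 z = ‖z‖ ^ (-((N : ℝ) - 2)) := by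
  unfold K; rw [add_zero, rpow_sq_half (norm_nonneg _)]

lemma K_le {N : ℕ} (hN : 3 ≤ N) {ε : ℝ} (hε : 0 ≤ ε) {z : E N} (hz : z ≠ 0) :
    K ε z ≤ ‖z‖ ^ (-((N : ℝ) - 2)) := by
  have := cast3 hN
  have hz' := norm_pos_iff.2 hz
  rw [← K_zero]
  unfold K
  apply Real.rpow_le_rpow_of_nonpos <;> first | positivity | linarith

lemma DK_norm {N : ℕ} (hN : 3 ≤ N) {ε : ℝ} (hε : 0 ≤ ε) (z : E N) :
    ‖DK ε z‖ = ((N : ℝ) - 2) * (‖z‖ ^ 2 + ε) ^ (-(N : ℝ) / 2) * ‖z‖ := by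
  have := cast3 hN
  unfold DK
  rw [norm_smul, innerSL_apply_norm, Real.norm_eq_abs, abs_mul, abs_neg,
    abs_of_nonneg (by linarith : (0:ℝ) ≤ (N:ℝ) - 2), abs_of_nonneg (by positivity)]

lemma DK_zero_norm {N : ℕ} (hN : 3 ≤ N) (z : E N) (hz : z ≠ 0) :
    ‖DK 0 z‖ = ((N : ℝ) - 2) * ‖z‖ ^ (-((N : ℝ) - 1)) := by
  have hz' := norm_pos_iff.2 hz
  rw [DK_norm hN le_rfl, add_zero, rpow_sq_half (norm_nonneg _), mul_assoc]
  congr 1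
  rw [← Real.rpow_add_one hz'.ne']
  congr 1; ring

lemma DK_sub_norm {N : ℕ} (hN : 3 ≤ N) {ε : ℝ} (hε : 0 < ε) (z : E N) (hz : z ≠ 0) :
    ‖DK ε z - DK 0 z‖ ≤ ε ^ (1 / 4 : ℝ) * (((N : ℝ) - 2) * (N / 2)) * ‖z‖ ^ (-((N : ℝ) - 1 / 2)) := by
  have h3 := cast3 hN
  have hz' := norm_pos_iff.2 hz
  set s := ‖z‖ ^ 2 with hs
  have hs' : 0 < s := by positivity
  have e1 : ‖DK ε z - DK 0 z‖
      = ((N : ℝ) - 2) * (s ^ (-(N : ℝ) / 2) - (s + ε) ^ (-(N : ℝ) / 2)) * ‖z‖ := by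
    have e0 : DK ε z - DK 0 z = ((-((N : ℝ) - 2) * (‖z‖ ^ 2 + ε) ^ (-(N : ℝ) / 2)) -
        (-((N : ℝ) - 2) * (‖z‖ ^ 2 + 0) ^ (-(N : ℝ) / 2))) • innerSL ℝ z := by
      ext v
      simp [DK]
      ring
    rw [e0, norm_smul, innerSL_apply_norm, Real.norm_eq_abs, add_zero]
    congr 1
    have hle : (s + ε) ^ (-(N : ℝ) / 2) ≤ s ^ (-(N : ℝ) / 2) := by
      apply Real.rpow_le_rpow_of_nonpos <;> first | positivity | linarith
    rw [← mul_sub, abs_mul, abs_neg, abs_of_nonneg (by linarith : (0:ℝ) ≤ (N:ℝ) - 2), abs_sub_comm,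
      abs_of_nonneg (by linarith)]
  set t := s / (s + ε) with ht
  have ht0 : 0 < t := by positivity
  have ht1 : t ≤ 1 := by rw [ht, div_le_one (by positivity)]; linarith
  have e2 : (s + ε) ^ (-(N : ℝ) / 2) = s ^ (-(N : ℝ) / 2) * t ^ ((N : ℝ) / 2) := by
    rw [ht, Real.div_rpow hs'.le (by positivity), neg_div, Real.rpow_neg hs'.le,
      Real.rpow_neg (by positivity)]
    field_simp
  have e3 : 1 - t ^ ((N : ℝ) / 2) ≤ (N / 2) * (1 - t) := by
    have := one_add_mul_self_le_rpow_one_add (s := t - 1) (by linarith) (p := (N : ℝ) / 2)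
      (by linarith)
    rw [show 1 + (t - 1) = t by ring] at this
    linarith
  have e4 : 1 - t ≤ (ε / s) ^ (1 / 4 : ℝ) := by
    have h1 : 1 - t = ε / (s + ε) := by rw [ht]; field_simp; ring
    rw [h1]
    have h2 : ε / (s + ε) ≤ 1 := by rw [div_le_one (by positivity)]; linarith
    calc ε / (s + ε) = (ε / (s + ε)) ^ (1 : ℝ) := (Real.rpow_one _).symm
      _ ≤ (ε / (s + ε)) ^ (1 / 4 : ℝ) :=
          Real.rpow_le_rpow_of_exponent_ge (by positivity) h2 (by norm_num)
      _ ≤ _ := by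
          apply Real.rpow_le_rpow (by positivity) _ (by norm_num)
          apply div_le_div_of_nonneg_left hε.le hs' (by linarith)
  have e5 : (ε / s) ^ (1 / 4 : ℝ) = ε ^ (1 / 4 : ℝ) * ‖z‖ ^ (-(1 / 2) : ℝ) := by
    rw [Real.div_rpow hε.le hs'.le, div_eq_mul_inv, ← Real.rpow_neg hs'.le, hs,
      show (-(1 / 4) : ℝ) = (-(1 / 2)) / 2 by norm_num, rpow_sq_half (norm_nonneg _)]
  have e6 : s ^ (-(N : ℝ) / 2) = ‖z‖ ^ (-(N : ℝ)) := by rw [hs, rpow_sq_half (norm_nonneg _)]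
  have e7 : ‖z‖ ^ (-((N : ℝ) - 1 / 2)) = ‖z‖ ^ (-(N : ℝ)) * ‖z‖ ^ (-(1 / 2) : ℝ) * ‖z‖ := by
    rw [← Real.rpow_add hz', ← Real.rpow_add_one hz'.ne']
    congr 1; ring
  have e8 : s ^ (-(N : ℝ) / 2) - (s + ε) ^ (-(N : ℝ) / 2)
      ≤ ‖z‖ ^ (-(N : ℝ)) * ((N / 2) * (ε ^ (1 / 4 : ℝ) * ‖z‖ ^ (-(1 / 2) : ℝ))) := by
    rw [e2, e6, ← e5, ← mul_one_sub]
    refine mul_le_mul_of_nonneg_left ?_ (by positivity)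
    exact e3.trans (mul_le_mul_of_nonneg_left e4 (by positivity))
  rw [e1, e7]
  have h4 : (0:ℝ) ≤ (N:ℝ) - 2 := by linarith
  calc _ ≤ ((N : ℝ) - 2) * (‖z‖ ^ (-(N : ℝ)) * ((N / 2) * (ε ^ (1 / 4 : ℝ) * ‖z‖ ^ (-(1 / 2) : ℝ)))) * ‖z‖ := by
        gcongr
    _ = _ := by ring

/-- far field weight -/
def far {N : ℕ} (j : ℝ) (y : E N) : ℝ := (1 + ‖y‖) ^ (-j) * ‖y‖ ^ (-mm N)

lemma far_integrable {N : ℕ} (hN : 3 ≤ N) {j : ℝ} (hj : (N : ℝ) - 2 ≤ j) :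
    Integrable (far j : E N → ℝ) := by
  have h3 := cast3 hN
  have : (far j : E N → ℝ) = fun y => (fun r : ℝ => (1 + r) ^ (-j) * r ^ (-mm N)) ‖y‖ := rfl
  refine (integrable_radial hN (f := fun r : ℝ => (1 + r) ^ (-j) * r ^ (-mm N))).2 ?_
  have hcont : ContinuousOn (fun y : ℝ => y ^ (N - 1) * ((1 + y) ^ (-j) * y ^ (-mm N))) (Ioi 0) := by
    intro y hy
    have hy' : 0 < y := hy
    apply ContinuousAt.continuousWithinAt
    apply ContinuousAt.mul (by fun_prop)
    apply ContinuousAt.mul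
    · exact ContinuousAt.rpow_const (by fun_prop) (Or.inl (by positivity))
    · exact ContinuousAt.rpow_const (by fun_prop) (Or.inl (by positivity))
  have hpow : ∀ y : ℝ, 0 < y → y ^ (N - 1) = y ^ ((N : ℝ) - 1) := by
    intro y hy
    rw [← Real.rpow_natCast, Nat.cast_sub (by omega)]; simp
  rw [← Ioc_union_Ioi_eq_Ioi zero_le_one, integrableOn_union]
  constructor
  · have h1 : IntegrableOn (fun y : ℝ => y ^ ((N : ℝ) - 1 - mm N)) (Ioc 0 1) := by
      rw [← intervalIntegrable_iff_integrableOn_Ioc_of_le zero_le_one]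
      apply intervalIntegral.intervalIntegrable_rpow'
      unfold mm; linarith
    refine h1.mono' ((hcont.mono Ioc_subset_Ioi_self).aestronglyMeasurable measurableSet_Ioc) ?_
    filter_upwards [ae_restrict_mem measurableSet_Ioc] with y hy
    have hy0 := hy.1
    rw [Real.norm_eq_abs, abs_of_nonneg (by positivity), hpow y hy0, sub_eq_add_neg _ (mm N),
      Real.rpow_add hy0]
    have : (1 + y) ^ (-j) ≤ 1 := Real.rpow_le_one_of_one_le_of_nonpos (by linarith) (by linarith)
    calc _ ≤ y ^ ((N : ℝ) - 1) * (1 * y ^ (-mm N)) := by gcongr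
      _ = _ := by ring
  · have h1 : IntegrableOn (fun y : ℝ => y ^ ((N : ℝ) - 1 - j - mm N)) (Ioi 1) := by
      apply integrableOn_Ioi_rpow_of_lt _ one_pos
      unfold mm; linarith
    refine h1.mono' ((hcont.mono (Ioi_subset_Ioi zero_le_one)).aestronglyMeasurable measurableSet_Ioi) ?_
    filter_upwards [ae_restrict_mem measurableSet_Ioi] with y hy
    have hy0 : 0 < y := one_pos.trans hy
    rw [Real.norm_eq_abs, abs_of_nonneg (by positivity), hpow y hy0, sub_eq_add_neg _ (mm N),
      Real.rpow_add hy0, sub_eq_add_neg _ j, Real.rpow_add hy0]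
    have : (1 + y) ^ (-j) ≤ y ^ (-j) := Real.rpow_le_rpow_of_nonpos hy0 (by linarith) (by linarith)
    calc _ ≤ y ^ ((N : ℝ) - 1) * (y ^ (-j) * y ^ (-mm N)) := by gcongr
      _ = _ := by ring

/-- near field kernel -/
def near {N : ℕ} (δ j : ℝ) (z : E N) : ℝ := if ‖z‖ < δ then ‖z‖ ^ (-j) else 0

lemma near_integrable {N : ℕ} (hN : 3 ≤ N) (δ : ℝ) {j : ℝ} (hj : j < N) :
    Integrable (near δ j : E N → ℝ) := by
  have : (near δ j : E N → ℝ) = fun y => (fun r : ℝ => if r < δ then r ^ (-j) else 0) ‖y‖ := rfl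
  refine (integrable_radial hN (f := fun r : ℝ => if r < δ then r ^ (-j) else 0)).2 ?_
  have hpow : ∀ y : ℝ, 0 < y → y ^ (N - 1) = y ^ ((N : ℝ) - 1) := by
    intro y hy
    rw [← Real.rpow_natCast, Nat.cast_sub (by omega)]; simp
  have h1 : IntegrableOn (fun y : ℝ => y ^ ((N : ℝ) - 1 - j)) (Ioc 0 (max δ 0)) := by
    rw [← intervalIntegrable_iff_integrableOn_Ioc_of_le (le_max_right _ _)]
    apply intervalIntegral.intervalIntegrable_rpow'
    linarith
  have h2 : IntegrableOn ((Ioo 0 (max δ 0)).indicator (fun y : ℝ => y ^ ((N : ℝ) - 1 - j))) (Ioi 0) := by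
    apply IntegrableOn.integrable_indicator _ measurableSet_Ioo |>.integrableOn
    exact h1.mono_set Ioo_subset_Ioc_self
  refine h2.congr_fun ?_ measurableSet_Ioi
  intro y hy
  have hy0 : 0 < y := hy
  simp only [indicator, mem_Ioo, lt_max_iff, hy0, true_and]
  by_cases h : y < δ
  · simp only [h, true_or, if_true]
    rw [hpow y hy0, ← Real.rpow_add hy0, sub_eq_add_neg]
  · simp [h, not_lt.2 hy0.le]

lemma near_nonneg {N : ℕ} (δ j : ℝ) (z : E N) : 0 ≤ near δ j z := by
  unfold near; split_ifs <;> positivity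

lemma far_nonneg {N : ℕ} (j : ℝ) (z : E N) : 0 ≤ far j z := by
  unfold far; positivity

lemma dom {N : ℕ} {δ B : ℝ} (hδ : 0 < δ) (hB : 0 ≤ B) {j : ℝ} (hj : 0 ≤ j) {F : E N → ℝ} {M : ℝ}
    (hF : Dec F M) {x : E N} (hx : 2 * δ ≤ ‖x‖) (hxB : ‖x‖ ≤ B) {y : E N} (hy : y ≠ 0) :
    ‖x - y‖ ^ (-j) * |F y| ≤
      M * (δ ^ (-mm N) * near δ j (x - y) + ((1 + B) / δ + 1) ^ j * far j y) := by
  have hy' := norm_pos_iff.2 hy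
  have hm : 0 ≤ mm N := by unfold mm; positivity
  have hM := hF.nn
  refine (mul_le_mul_of_nonneg_left (hF.bd y hy) (by positivity)).trans ?_
  have hn := near_nonneg δ j (x - y)
  have hf := far_nonneg j y
  by_cases h : ‖x - y‖ < δ
  · have h1 : δ ≤ ‖y‖ := by
      have := norm_sub_norm_le x y
      linarith
    have h2 : ‖y‖ ^ (-mm N) ≤ δ ^ (-mm N) := Real.rpow_le_rpow_of_nonpos hδ h1 (by linarith)
    have h3 : near δ j (x - y) = ‖x - y‖ ^ (-j) := by unfold near; rw [if_pos h]
    rw [h3]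
    calc _ = M * (‖x - y‖ ^ (-j) * ‖y‖ ^ (-mm N)) := by ring
      _ ≤ M * (δ ^ (-mm N) * ‖x - y‖ ^ (-j)) := by
          rw [mul_comm (δ ^ _)]; gcongr
      _ ≤ _ := by
          gcongr; apply le_add_of_nonneg_right; positivity
  · push Not at h
    have hpos : 0 < ‖x - y‖ := hδ.trans_le h
    have h1 : 1 + ‖y‖ ≤ ((1 + B) / δ + 1) * ‖x - y‖ := by
      have h2 : ‖y‖ ≤ ‖x‖ + ‖x - y‖ := by
        have := norm_sub_norm_le y x
        rw [norm_sub_rev] at this; linarith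
      have h3 : 1 + B ≤ (1 + B) / δ * ‖x - y‖ := by
        rw [div_mul_eq_mul_div, le_div_iff₀ hδ]
        gcongr
      linarith
    have h4 : ‖x - y‖ ^ (-j) ≤ ((1 + B) / δ + 1) ^ j * (1 + ‖y‖) ^ (-j) := by
      have : 0 < (1 + B) / δ + 1 := by positivity
      rw [Real.rpow_neg (by positivity), Real.rpow_neg (by positivity), ← div_eq_mul_inv,
        le_div_iff₀ (by positivity), ← div_eq_inv_mul, div_le_iff₀ (by positivity),
        ← Real.mul_rpow (by positivity) (by positivity)]
      exact Real.rpow_le_rpow (by positivity) h1 hj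
    calc _ = M * (‖x - y‖ ^ (-j) * ‖y‖ ^ (-mm N)) := by ring
      _ ≤ M * (((1 + B) / δ + 1) ^ j * (1 + ‖y‖) ^ (-j) * ‖y‖ ^ (-mm N)) := by gcongr
      _ = M * (((1 + B) / δ + 1) ^ j * far j y) := by unfold far; ring
      _ ≤ _ := by
          gcongr; apply le_add_of_nonneg_left; positivity

lemma ae_ne {N : ℕ} (hN : 3 ≤ N) (x : E N) : ∀ᵐ y : E N, y ≠ x := by
  have := nontriv hN
  exact Measure.ae_ne volume x

lemma dom_int {N : ℕ} (hN : 3 ≤ N) {δ B : ℝ} (hδ : 0 < δ) (hB : 0 ≤ B) {j : ℝ}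
    (hj : (N : ℝ) - 2 ≤ j) (hj2 : j < N) :
    ∃ C, 0 ≤ C ∧ ∀ (F : E N → ℝ) (M : ℝ), Dec F M → ∀ x : E N, 2 * δ ≤ ‖x‖ → ‖x‖ ≤ B →
      Integrable (fun y => ‖x - y‖ ^ (-j) * |F y|) ∧ ∫ y, ‖x - y‖ ^ (-j) * |F y| ≤ C * M := by
  have h3 := cast3 hN
  set C := δ ^ (-mm N) * (∫ z : E N, near δ j z) + ((1 + B) / δ + 1) ^ j * ∫ y : E N, far j y with hC
  refine ⟨C, ?_, ?_⟩
  · have h1 : 0 ≤ ∫ z : E N, near δ j z := integral_nonneg (near_nonneg δ j)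
    have h2 : 0 ≤ ∫ z : E N, far j z := integral_nonneg (far_nonneg j)
    positivity
  intro F M hF x hx hxB
  have hIntg : Integrable (fun y => M * (δ ^ (-mm N) * near δ j (x - y) + ((1 + B) / δ + 1) ^ j * far j y)) := by
    apply Integrable.const_mul
    apply Integrable.add
    · exact ((near_integrable hN δ hj2).comp_sub_left x).const_mul _
    · exact (far_integrable hN hj).const_mul _
  have hae : ∀ᵐ y : E N, ‖‖x - y‖ ^ (-j) * |F y|‖ ≤
      M * (δ ^ (-mm N) * near δ j (x - y) + ((1 + B) / δ + 1) ^ j * far j y) := by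
    filter_upwards [ae_ne hN (0 : E N)] with y hy
    rw [Real.norm_eq_abs, abs_of_nonneg (by positivity)]
    exact dom hδ hB (by linarith) hF hx hxB hy
  have hI : Integrable (fun y => ‖x - y‖ ^ (-j) * |F y|) := by
    refine hIntg.mono' ?_ hae
    apply AEStronglyMeasurable.mul
    · apply Measurable.aestronglyMeasurable
      fun_prop
    · exact hF.meas.norm
  refine ⟨hI, ?_⟩
  calc ∫ y, ‖x - y‖ ^ (-j) * |F y| ≤ ∫ y, M * (δ ^ (-mm N) * near δ j (x - y) + ((1 + B) / δ + 1) ^ j * far j y) := by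
        apply integral_mono_ae hI hIntg
        filter_upwards [hae] with y hy
        exact (le_abs_self _).trans hy
    _ = C * M := by
        rw [integral_const_mul, integral_add, integral_const_mul, integral_const_mul,
          integral_sub_left_eq_self (fun z => near δ j z) volume x]
        · rw [hC]; ring
        · exact ((near_integrable hN δ hj2).comp_sub_left x).const_mul _
        · exact (far_integrable hN hj).const_mul _

end Ann
end
end

section
open MeasureTheory Real Set
open scoped ENNReal NNReal Topology
noncomputable section
namespace Ann

lemma reg_bound {N : ℕ} {ε B j : ℝ} (hε : 0 < ε) (hB : 0 ≤ B) (hj : 0 ≤ j) {x : E N}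
    (hx : ‖x‖ ≤ B) (y : E N) :
    (‖x - y‖ ^ 2 + ε) ^ (-j / 2) ≤ ((1 + B) ^ 2 * (1 + 1 / ε)) ^ (j / 2) * (1 + ‖y‖) ^ (-j) := by
  have h0 : 1 + ‖y‖ ≤ (1 + B) * (1 + ‖x - y‖) := by
    have h2 : ‖y‖ ≤ ‖x‖ + ‖x - y‖ := by
      have := norm_sub_norm_le y x
      rw [norm_sub_rev] at this; linarith
    nlinarith [norm_nonneg (x - y)]
  have h1 : (1 + ‖x - y‖) ^ 2 ≤ (1 + 1 / ε) * (‖x - y‖ ^ 2 + ε) := by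
    have : (1 + 1 / ε) * (‖x - y‖ ^ 2 + ε) - (1 + ‖x - y‖) ^ 2 = (‖x - y‖ - ε) ^ 2 / ε := by
      field_simp; ring
    have : 0 ≤ (‖x - y‖ - ε) ^ 2 / ε := by positivity
    linarith
  have h2 : (1 + ‖y‖) ^ 2 ≤ ((1 + B) ^ 2 * (1 + 1 / ε)) * (‖x - y‖ ^ 2 + ε) := by
    calc (1 + ‖y‖) ^ 2 ≤ ((1 + B) * (1 + ‖x - y‖)) ^ 2 := by gcongr
      _ = (1 + B) ^ 2 * (1 + ‖x - y‖) ^ 2 := by ring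
      _ ≤ (1 + B) ^ 2 * ((1 + 1 / ε) * (‖x - y‖ ^ 2 + ε)) := by gcongr
      _ = _ := by ring
  rw [show (1 + ‖y‖) ^ (-j) = ((1 + ‖y‖) ^ 2) ^ (-j / 2) from (rpow_sq_half (by positivity) _).symm]
  rw [neg_div, Real.rpow_neg (by positivity), Real.rpow_neg (by positivity), ← div_eq_mul_inv,
    le_div_iff₀ (by positivity), ← div_eq_inv_mul, div_le_iff₀ (by positivity),
    ← Real.mul_rpow (by positivity) (by positivity)]
  exact Real.rpow_le_rpow (by positivity) h2 (by positivity)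

lemma K_meas {N : ℕ} (ε : ℝ) : Measurable (K ε : E N → ℝ) := by
  unfold K; fun_prop

lemma DK_meas {N : ℕ} (ε : ℝ) : Measurable (DK ε : E N → _) := by
  unfold DK
  refine Measurable.fun_smul ?_ ?_
  · fun_prop
  · exact (innerSL ℝ).continuous.measurable

lemma DK_cont {N : ℕ} {ε : ℝ} (hε : 0 < ε) : Continuous (DK ε : E N → _) := by
  unfold DK
  refine Continuous.fun_smul ?_ ?_
  · apply continuous_const.mul
    apply Continuous.rpow_const (by fun_prop)
    intro z; left; positivity
  · exact (innerSL ℝ).continuous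

lemma DK_norm_le {N : ℕ} (hN : 3 ≤ N) {ε : ℝ} (hε : 0 < ε) (z : E N) :
    ‖DK ε z‖ ≤ ((N : ℝ) - 2) * (‖z‖ ^ 2 + ε) ^ (-((N : ℝ) - 1) / 2) := by
  have h3 := cast3 hN
  rw [DK_norm hN hε.le, mul_assoc]
  apply mul_le_mul_of_nonneg_left _ (by linarith)
  have h1 : ‖z‖ ≤ (‖z‖ ^ 2 + ε) ^ ((1 : ℝ) / 2) := by
    conv_lhs => rw [← Real.rpow_one ‖z‖, ← rpow_sq_half (norm_nonneg _)]
    apply Real.rpow_le_rpow (by positivity) (by linarith) (by norm_num)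
  calc _ ≤ (‖z‖ ^ 2 + ε) ^ (-(N : ℝ) / 2) * (‖z‖ ^ 2 + ε) ^ ((1 : ℝ) / 2) := by gcongr
    _ = _ := by
      rw [← Real.rpow_add (by positivity)]; congr 1; ring

lemma reg_bound2 {N : ℕ} (hN : 3 ≤ N) {ε B : ℝ} (hε : 0 < ε) (hB : 0 ≤ B) {F : E N → ℝ} {M : ℝ}
    (hF : Dec F M) {x : E N} (hx : ‖x‖ ≤ B) {y : E N} (hy : y ≠ 0) :
    ‖F y • DK ε (x - y)‖ ≤
     (M * ((N : ℝ) - 2) * ((1 + B) ^ 2 * (1 + 1 / ε)) ^ (((N : ℝ) - 1) / 2)) * far ((N : ℝ) - 1) y := by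
  have h3 := cast3 hN
  have hM := hF.nn
  have h4 : (0:ℝ) ≤ (N:ℝ) - 2 := by linarith
  rw [norm_smul, Real.norm_eq_abs]
  calc _ ≤ (M * ‖y‖ ^ (-mm N)) * (((N : ℝ) - 2) * (((1 + B) ^ 2 * (1 + 1 / ε)) ^ (((N : ℝ) - 1) / 2)
          * (1 + ‖y‖) ^ (-((N : ℝ) - 1)))) := by
        apply mul_le_mul (hF.bd y hy) _ (norm_nonneg _) (by positivity)
        refine (DK_norm_le hN hε _).trans ?_
        apply mul_le_mul_of_nonneg_left _ h4
        exact reg_bound hε hB (by linarith) hx y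
    _ = _ := by unfold far; ring

lemma reg_bound1 {N : ℕ} (hN : 3 ≤ N) {ε B : ℝ} (hε : 0 < ε) (hB : 0 ≤ B) {F : E N → ℝ} {M : ℝ}
    (hF : Dec F M) {x : E N} (hx : ‖x‖ ≤ B) {y : E N} (hy : y ≠ 0) :
    ‖K ε (x - y) * F y‖ ≤
     (M * ((1 + B) ^ 2 * (1 + 1 / ε)) ^ (((N : ℝ) - 2) / 2)) * far ((N : ℝ) - 2) y := by
  have h3 := cast3 hN
  have hM := hF.nn
  rw [norm_mul, Real.norm_eq_abs, Real.norm_eq_abs, abs_of_nonneg (K_nonneg hε.le _)]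
  calc _ ≤ ((((1 + B) ^ 2 * (1 + 1 / ε)) ^ (((N : ℝ) - 2) / 2)
          * (1 + ‖y‖) ^ (-((N : ℝ) - 2)))) * (M * ‖y‖ ^ (-mm N)) := by
        apply mul_le_mul _ (hF.bd y hy) (abs_nonneg _) (by positivity)
        exact reg_bound hε hB (by linarith) hx y
    _ = _ := by unfold far; ring

lemma reg_meas1 {N : ℕ} (ε : ℝ) {F : E N → ℝ} {M : ℝ} (hF : Dec F M) (x : E N) :
    AEStronglyMeasurable (fun y => K ε (x - y) * F y) volume := by
  apply AEStronglyMeasurable.mul _ hF.meas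
  exact ((K_meas ε).comp (measurable_const.sub measurable_id)).aestronglyMeasurable

lemma reg_meas2 {N : ℕ} (ε : ℝ) {F : E N → ℝ} {M : ℝ} (hF : Dec F M) (x : E N) :
    AEStronglyMeasurable (fun y => F y • DK ε (x - y)) volume := by
  apply AEStronglyMeasurable.smul hF.meas
  exact ((DK_meas ε).comp (measurable_const.sub measurable_id)).aestronglyMeasurable

lemma reg_hasFDerivAt {N : ℕ} (hN : 3 ≤ N) {ε : ℝ} (hε : 0 < ε) {F : E N → ℝ} {M : ℝ}
    (hF : Dec F M) (x : E N) :
    HasFDerivAt (fun x => ∫ y, K ε (x - y) * F y) (∫ y, F y • DK ε (x - y)) x := by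
  have h3 := cast3 hN
  have hB : 0 ≤ ‖x‖ + 1 := by positivity
  refine hasFDerivAt_integral_of_dominated_of_fderiv_le (𝕜 := ℝ)
    (F := fun x y => K ε (x - y) * F y) (F' := fun x y => F y • DK ε (x - y))
    (bound := fun y => (M * ((N : ℝ) - 2) * ((1 + (‖x‖ + 1)) ^ 2 * (1 + 1 / ε)) ^ (((N : ℝ) - 1) / 2)) * far ((N : ℝ) - 1) y)
    (Metric.ball_mem_nhds x one_pos) ?_ ?_ ?_ ?_ ?_ ?_
  · exact Filter.Eventually.of_forall fun x => reg_meas1 ε hF x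
  · refine Integrable.mono' ((far_integrable hN (j := (N:ℝ) - 2) le_rfl).const_mul (M * ((1 + ‖x‖) ^ 2 * (1 + 1 / ε)) ^ (((N : ℝ) - 2) / 2)))
      (reg_meas1 ε hF x) ?_
    filter_upwards [ae_ne hN (0 : E N)] with y hy
    exact reg_bound1 hN hε (norm_nonneg _) hF le_rfl hy
  · exact reg_meas2 ε hF x
  · filter_upwards [ae_ne hN (0 : E N)] with y hy x' hx'
    refine reg_bound2 hN hε hB hF ?_ hy
    have := norm_sub_norm_le x' x
    rw [mem_ball_iff_norm] at hx'
    linarith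
  · exact (far_integrable hN (by linarith)).const_mul _
  · refine Filter.Eventually.of_forall fun y x' _ => ?_
    have h1 : HasFDerivAt (fun x => K ε (x - y)) (DK ε (x' - y)) x' := by
      have := (K_hasFDerivAt hε (x' - y)).comp x' ((hasFDerivAt_id x').sub_const y)
      exact this
    exact h1.mul_const (F y)

lemma reg_cont {N : ℕ} (hN : 3 ≤ N) {ε : ℝ} (hε : 0 < ε) {F : E N → ℝ} {M : ℝ}
    (hF : Dec F M) : Continuous (fun x => ∫ y, F y • DK ε (x - y)) := by
  have h3 := cast3 hN
  rw [continuous_iff_continuousAt]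
  intro x
  have hB : 0 ≤ ‖x‖ + 1 := by positivity
  refine continuousAt_of_dominated (bound := fun y => (M * ((N : ℝ) - 2) * ((1 + (‖x‖ + 1)) ^ 2 * (1 + 1 / ε)) ^ (((N : ℝ) - 1) / 2)) * far ((N : ℝ) - 1) y) ?_ ?_ ?_ ?_
  · exact Filter.Eventually.of_forall fun x => reg_meas2 ε hF x
  · filter_upwards [Metric.ball_mem_nhds x one_pos] with x' hx'
    filter_upwards [ae_ne hN (0 : E N)] with y hy
    refine reg_bound2 hN hε hB hF ?_ hy
    have := norm_sub_norm_le x' x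
    rw [mem_ball_iff_norm] at hx'
    linarith
  · exact (far_integrable hN (by linarith)).const_mul _
  · refine Filter.Eventually.of_forall fun y => ?_
    have := DK_cont (N := N) hε
    fun_prop

/-- unnormalised potential and its gradient -/
def pot {N : ℕ} (F : E N → ℝ) (x : E N) : ℝ := ∫ y, K 0 (x - y) * F y
def vot {N : ℕ} (F : E N → ℝ) (x : E N) : E N →L[ℝ] ℝ := ∫ y, F y • DK 0 (x - y)

lemma pot_integrable {N : ℕ} (hN : 3 ≤ N) {F : E N → ℝ} {M : ℝ} (hF : Dec F M) {x : E N} (hx : x ≠ 0) :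
    Integrable (fun y => K 0 (x - y) * F y) := by
  have hx' := norm_pos_iff.2 hx
  obtain ⟨C, hC, h⟩ := dom_int hN (half_pos hx') (norm_nonneg x) (j := (N : ℝ) - 2) le_rfl (by linarith)
  refine (h F M hF x (by linarith) le_rfl).1.mono' (reg_meas1 0 hF x) ?_
  refine Filter.Eventually.of_forall fun y => ?_
  rw [norm_mul, Real.norm_eq_abs, Real.norm_eq_abs, abs_of_nonneg (K_nonneg le_rfl _), K_zero]

lemma vot_integrable {N : ℕ} (hN : 3 ≤ N) {F : E N → ℝ} {M : ℝ} (hF : Dec F M) {x : E N} (hx : x ≠ 0) :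
    Integrable (fun y => F y • DK 0 (x - y)) := by
  have hx' := norm_pos_iff.2 hx
  obtain ⟨C, hC, h⟩ := dom_int hN (half_pos hx') (norm_nonneg x) (j := (N : ℝ) - 1) (by linarith) (by linarith)
  refine ((h F M hF x (by linarith) le_rfl).1.const_mul ((N:ℝ) - 2)).mono' (reg_meas2 0 hF x) ?_
  filter_upwards [ae_ne hN x] with y hy
  rw [norm_smul, DK_zero_norm hN _ (sub_ne_zero.2 hy.symm), Real.norm_eq_abs]
  exact le_of_eq (by ring)

lemma pot_bound {N : ℕ} (hN : 3 ≤ N) {δ B : ℝ} (hδ : 0 < δ) (hB : 0 ≤ B) :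
    ∃ C, 0 ≤ C ∧ ∀ (F : E N → ℝ) (M : ℝ), Dec F M → ∀ x : E N, 2 * δ ≤ ‖x‖ → ‖x‖ ≤ B →
      |pot F x| ≤ C * M ∧ ‖vot F x‖ ≤ C * M := by
  have h3 := cast3 hN
  obtain ⟨C, hC, h⟩ := dom_int hN hδ hB (j := (N : ℝ) - 2) le_rfl (by linarith)
  obtain ⟨C', hC', h'⟩ := dom_int hN hδ hB (j := (N : ℝ) - 1) (by linarith) (by linarith)
  have h4 : (0:ℝ) ≤ (N:ℝ) - 2 := by linarith
  refine ⟨C + ((N : ℝ) - 2) * C', by positivity, fun F M hF x hx hxB => ⟨?_, ?_⟩⟩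
  · have := hF.nn
    calc |pot F x| ≤ ∫ y, ‖x - y‖ ^ (-((N:ℝ) - 2)) * |F y| := by
          unfold pot
          rw [← Real.norm_eq_abs]
          apply norm_integral_le_of_norm_le (h F M hF x hx hxB).1
          refine Filter.Eventually.of_forall fun y => ?_
          rw [norm_mul, Real.norm_eq_abs, Real.norm_eq_abs, abs_of_nonneg (K_nonneg le_rfl _), K_zero]
      _ ≤ C * M := (h F M hF x hx hxB).2
      _ ≤ _ := by gcongr; nlinarith
  · have := hF.nn
    calc ‖vot F x‖ ≤ ∫ y, ((N : ℝ) - 2) * (‖x - y‖ ^ (-((N:ℝ) - 1)) * |F y|) := by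
          unfold vot
          apply norm_integral_le_of_norm_le ((h' F M hF x hx hxB).1.const_mul _)
          filter_upwards [ae_ne hN x] with y hy
          rw [norm_smul, DK_zero_norm hN _ (sub_ne_zero.2 hy.symm), Real.norm_eq_abs]
          exact le_of_eq (by ring)
      _ ≤ ((N : ℝ) - 2) * (C' * M) := by
          rw [integral_const_mul]; gcongr; exact (h' F M hF x hx hxB).2
      _ ≤ _ := by nlinarith

lemma reg_unif {N : ℕ} (hN : 3 ≤ N) {F : E N → ℝ} {M : ℝ} (hF : Dec F M) {δ B : ℝ} (hδ : 0 < δ)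
    (hB : 0 ≤ B) : ∃ C, 0 ≤ C ∧ ∀ ε, 0 < ε → ∀ x : E N, 2 * δ ≤ ‖x‖ → ‖x‖ ≤ B →
      ‖(∫ y, F y • DK ε (x - y)) - vot F x‖ ≤ C * ε ^ (1 / 4 : ℝ) := by
  have h3 := cast3 hN
  have h4 : (0:ℝ) ≤ (N:ℝ) - 2 := by linarith
  obtain ⟨C, hC, h⟩ := dom_int hN hδ hB (j := (N : ℝ) - 1 / 2) (by linarith) (by linarith)
  have hM := hF.nn
  refine ⟨((N : ℝ) - 2) * (N / 2) * (C * M), by positivity, fun ε hε x hx hxB => ?_⟩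
  have hx0 : x ≠ 0 := norm_pos_iff.1 (by linarith)
  have hi : Integrable (fun y => F y • DK ε (x - y)) := by
    refine Integrable.mono' ((far_integrable hN (j := (N:ℝ) - 1) (by linarith)).const_mul
      (M * ((N : ℝ) - 2) * ((1 + B) ^ 2 * (1 + 1 / ε)) ^ (((N : ℝ) - 1) / 2))) (reg_meas2 ε hF x) ?_
    filter_upwards [ae_ne hN (0 : E N)] with y hy
    exact reg_bound2 hN hε hB hF hxB hy
  unfold vot
  rw [← integral_sub hi (vot_integrable hN hF hx0)]
  calc _ ≤ ∫ y, (ε ^ (1 / 4 : ℝ) * (((N : ℝ) - 2) * (N / 2))) * (‖x - y‖ ^ (-((N:ℝ) - 1 / 2)) * |F y|) := by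
        apply norm_integral_le_of_norm_le ((h F M hF x hx hxB).1.const_mul _)
        filter_upwards [ae_ne hN x] with y hy
        have e0 : F y • DK ε (x - y) - F y • DK 0 (x - y) = F y • (DK ε (x - y) - DK 0 (x - y)) := by
          ext v; simp; ring
        rw [e0, norm_smul, Real.norm_eq_abs]
        calc _ ≤ |F y| * _ := mul_le_mul_of_nonneg_left (DK_sub_norm hN hε _ (sub_ne_zero.2 hy.symm)) (abs_nonneg _)
          _ = _ := by ring
    _ ≤ (ε ^ (1 / 4 : ℝ) * (((N : ℝ) - 2) * (N / 2))) * (C * M) := by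
        rw [integral_const_mul]; gcongr; exact (h F M hF x hx hxB).2
    _ = _ := by ring

def eps (n : ℕ) : ℝ := 1 / ((n : ℝ) + 1)
lemma eps_pos (n : ℕ) : 0 < eps n := by unfold eps; positivity
lemma eps_tendsto : Filter.Tendsto eps Filter.atTop (𝓝 0) := tendsto_one_div_add_atTop_nhds_zero_nat

lemma reg_tlu {N : ℕ} (hN : 3 ≤ N) {F : E N → ℝ} {M : ℝ} (hF : Dec F M) :
    TendstoLocallyUniformlyOn (fun n x => ∫ y, F y • DK (eps n) (x - y)) (vot F) Filter.atTop {x : E N | x ≠ 0} := by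
  rw [Metric.tendstoLocallyUniformlyOn_iff]
  intro e he x hx
  have hx' := norm_pos_iff.2 hx
  obtain ⟨C, hC, h⟩ := reg_unif hN hF (δ := ‖x‖ / 4) (B := 2 * ‖x‖) (by positivity) (by positivity)
  refine ⟨Metric.ball x (‖x‖ / 2), mem_nhdsWithin_of_mem_nhds (Metric.ball_mem_nhds x (by positivity)), ?_⟩
  have ht : Filter.Tendsto (fun n => C * eps n ^ (1 / 4 : ℝ)) Filter.atTop (𝓝 0) := by
    have := (eps_tendsto.rpow_const (p := (1/4 : ℝ)) (Or.inr (by norm_num))).const_mul C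
    simpa using this
  filter_upwards [ht.eventually (gt_mem_nhds he)] with n hn y hy
  rw [mem_ball_iff_norm] at hy
  rw [dist_comm, dist_eq_norm]
  refine lt_of_le_of_lt (h _ (eps_pos n) y ?_ ?_) hn
  · have := norm_sub_norm_le x y
    rw [norm_sub_rev] at this
    linarith
  · have := norm_sub_norm_le y x
    linarith

lemma reg_lim {N : ℕ} (hN : 3 ≤ N) {F : E N → ℝ} {M : ℝ} (hF : Dec F M) {x : E N} (hx : x ≠ 0) :
    Filter.Tendsto (fun n => ∫ y, K (eps n) (x - y) * F y) Filter.atTop (𝓝 (pot F x)) := by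
  have h3 := cast3 hN
  have hx' := norm_pos_iff.2 hx
  obtain ⟨C, hC, h⟩ := dom_int hN (half_pos hx') (norm_nonneg x) (j := (N : ℝ) - 2) le_rfl (by linarith)
  refine tendsto_integral_of_dominated_convergence _ (fun n => reg_meas1 _ hF x)
    (h F M hF x (by linarith) le_rfl).1 ?_ ?_
  · intro n
    filter_upwards [ae_ne hN x] with y hy
    rw [norm_mul, Real.norm_eq_abs, Real.norm_eq_abs, abs_of_nonneg (K_nonneg (eps_pos n).le _)]
    gcongr
    exact K_le hN (eps_pos n).le (sub_ne_zero.2 hy.symm)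
  · filter_upwards [ae_ne hN x] with y hy
    apply Filter.Tendsto.mul_const
    unfold K
    have hz := norm_pos_iff.2 (sub_ne_zero.2 hy.symm)
    apply Filter.Tendsto.rpow_const
    · exact tendsto_const_nhds.add eps_tendsto
    · left; positivity

lemma pot_hasFDerivAt {N : ℕ} (hN : 3 ≤ N) {F : E N → ℝ} {M : ℝ} (hF : Dec F M) {x : E N} (hx : x ≠ 0) :
    HasFDerivAt (pot F) (vot F x) x := by
  refine hasFDerivAt_of_tendstoLocallyUniformlyOn (𝕜 := ℝ) (s := {x : E N | x ≠ 0})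
    (f := fun n x => ∫ y, K (eps n) (x - y) * F y)
    isOpen_ne (reg_tlu hN hF) ?_ ?_ hx
  · intro n x _
    exact reg_hasFDerivAt hN (eps_pos n) hF x
  · intro x hx
    exact reg_lim hN hF hx

lemma vot_cont {N : ℕ} (hN : 3 ≤ N) {F : E N → ℝ} {M : ℝ} (hF : Dec F M) :
    ContinuousOn (vot F) {x : E N | x ≠ 0} :=
  (reg_tlu hN hF).continuousOn
    (Filter.Frequently.of_forall fun n => (reg_cont hN (eps_pos n) hF).continuousOn)

lemma pot_contDiffOn {N : ℕ} (hN : 3 ≤ N) {F : E N → ℝ} {M : ℝ} (hF : Dec F M) :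
    ContDiffOn ℝ 1 (pot F) {x : E N | x ≠ 0} := by
  rw [show (1 : WithTop ℕ∞) = 0 + 1 by norm_num, contDiffOn_succ_iff_fderiv_of_isOpen isOpen_ne]
  refine ⟨fun x hx => (pot_hasFDerivAt hN hF hx).differentiableAt.differentiableWithinAt, by simp, ?_⟩
  rw [contDiffOn_zero]
  exact (vot_cont hN hF).congr fun x hx => (pot_hasFDerivAt hN hF hx).fderiv

end Ann
end
end

section
open MeasureTheory Real Set
open scoped ENNReal NNReal Topology
noncomputable section
namespace Ann

lemma fderiv_eq_inner {N : ℕ} (u : E N → ℝ) (x v : E N) :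
    fderiv ℝ u x v = inner ℝ (gradient u x) v := by
  rw [gradient, InnerProductSpace.toDual_symm_apply]

lemma grad_cont {N : ℕ} {φ : E N → ℝ} (hφ : ContDiff ℝ 1 φ) : Continuous (gradient φ) := by
  unfold gradient
  exact (InnerProductSpace.toDual ℝ (E N)).symm.continuous.comp (hφ.continuous_fderiv one_ne_zero)

lemma grad_zero_of_not_mem {N : ℕ} {φ : E N → ℝ} {x : E N} (hx : x ∉ tsupport φ) : gradient φ x = 0 := by
  unfold gradient
  have : fderiv ℝ φ x = 0 := by
    by_contra h
    exact hx (support_fderiv_subset ℝ (f := φ) h)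
  rw [this, map_zero]

lemma DK_apply {N : ℕ} (z v : E N) :
    DK 0 z v = -((N : ℝ) - 2) * (‖z‖ ^ (-(N : ℝ)) * inner ℝ z v) := by
  unfold DK
  simp only [add_zero, smul_apply, innerSL_apply_apply, smul_eq_mul,
    rpow_sq_half (norm_nonneg _)]
  ring

lemma delta_rep {N : ℕ} (hN : 3 ≤ N) {φ : E N → ℝ} (hφ : ContDiff ℝ 1 φ) (hc : HasCompactSupport φ)
    (y : E N) : ∫ x, DK 0 (x - y) (gradient φ x) = ((N : ℝ) - 2) * sg N * φ y := by
  have h3 := cast3 hN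
  have hgc := grad_cont hφ
  have hgs : HasCompactSupport (gradient φ) := by
    refine hc.mono' fun x hx => ?_
    by_contra h
    exact hx (grad_zero_of_not_mem h)
  obtain ⟨C, hC⟩ := hgs.exists_bound_of_continuous hgc
  obtain ⟨B, hB⟩ := hc.isCompact.isBounded.exists_norm_le
  set f : E N → ℝ := fun z => ‖z‖ ^ (-(N : ℝ)) * inner ℝ z (gradient φ (y + z)) with hf
  have hfi : Integrable f := by
    refine ((near_integrable hN (B + ‖y‖ + 1) (j := (N : ℝ) - 1) (by linarith)).const_mul C).mono' ?_ ?_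
    · apply AEStronglyMeasurable.mul
      · exact (measurable_norm.pow_const _).aestronglyMeasurable
      · apply Continuous.aestronglyMeasurable
        exact continuous_id.inner (hgc.comp (continuous_const.add continuous_id))
    · filter_upwards [ae_ne hN (0 : E N)] with z hz
      have hz' := norm_pos_iff.2 hz
      by_cases h : y + z ∈ tsupport φ
      · have h1 := hB _ h
        have h2 : ‖z‖ < B + ‖y‖ + 1 := by
          have := norm_sub_le (y + z) y
          rw [add_sub_cancel_left] at this; linarith
        unfold near
        rw [if_pos h2, hf]
        simp only [norm_mul, Real.norm_eq_abs]
        rw [abs_of_nonneg (by positivity)]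
        have h4 := abs_real_inner_le_norm z (gradient φ (y + z))
        have h5 := hC (y + z)
        calc _ ≤ ‖z‖ ^ (-(N : ℝ)) * (‖z‖ * C) := by gcongr; exact h4.trans (by gcongr)
          _ = C * (‖z‖ ^ (-(N : ℝ)) * ‖z‖) := by ring
          _ = _ := by rw [← Real.rpow_add_one hz'.ne']; congr 2; ring
      · rw [hf]; simp only [grad_zero_of_not_mem h, inner_zero_right, mul_zero, norm_zero]
        have := near_nonneg (B + ‖y‖ + 1) ((N : ℝ) - 1) z
        have h5 := (norm_nonneg _).trans (hC 0)
        positivity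
  have h1 : ∫ x, DK 0 (x - y) (gradient φ x) = -((N : ℝ) - 2) * ∫ z, f z := by
    rw [← integral_const_mul, ← integral_sub_right_eq_self (fun z => -((N : ℝ) - 2) * f z) y]
    congr 1; ext x
    rw [DK_apply, hf]
    simp only [add_sub_cancel]
  rw [h1, polar_integral f hfi hN]
  have h2 : ∀ ω : S N, ∫ r in Ioi (0:ℝ), r ^ (N - 1) * f (r • (ω : E N)) = - φ y := by
    intro ω
    have hω : ‖(ω : E N)‖ = 1 := by simpa using ω.2
    set g : ℝ → ℝ := fun r => φ (y + r • (ω : E N)) with hg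
    have hgd : ContDiff ℝ 1 g := hφ.comp (by fun_prop)
    have hgsup : HasCompactSupport g := by
      apply HasCompactSupport.of_support_subset_isCompact (isCompact_Icc (a := -(B + ‖y‖)) (b := B + ‖y‖))
      intro r hr
      have := hB _ (subset_tsupport φ hr)
      have h4 := norm_sub_le (y + r • (ω : E N)) y
      rw [add_sub_cancel_left, norm_smul, hω, mul_one, Real.norm_eq_abs] at h4
      exact abs_le.1 (by linarith)
    have h5 := hgsup.integral_Ioi_deriv_eq hgd 0
    have h6 : g 0 = φ y := by simp [hg]
    rw [← h6, ← h5]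
    refine setIntegral_congr_fun measurableSet_Ioi fun r hr => ?_
    have hr0 : 0 < r := hr
    have hd : HasDerivAt g (fderiv ℝ φ (y + r • (ω : E N)) (ω : E N)) r := by
      have hl : HasDerivAt (fun r : ℝ => y + r • (ω : E N)) (ω : E N) r := by
        simpa using ((hasDerivAt_id r).smul_const (ω : E N)).const_add y
      exact ((hφ.differentiable one_ne_zero _).hasFDerivAt).comp_hasDerivAt r hl
    rw [hd.deriv, fderiv_eq_inner, hf]
    simp only [norm_smul, hω, mul_one, Real.norm_eq_abs, abs_of_pos hr0]
    rw [real_inner_smul_left, real_inner_comm, ← Real.rpow_natCast, Nat.cast_sub (by omega),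
      ← mul_assoc, ← mul_assoc, ← Real.rpow_add hr0, ← Real.rpow_add_one hr0.ne']
    have : (N : ℝ) - ((1 : ℕ) : ℝ) + -(N : ℝ) + 1 = 0 := by push_cast; ring
    rw [this, Real.rpow_zero, one_mul]
  simp_rw [h2]
  rw [integral_const, smul_eq_mul]
  unfold sg
  ring

lemma pot_weak {N : ℕ} (hN : 3 ≤ N) {F : E N → ℝ} {M : ℝ} (hF : Dec F M) {δ B : ℝ} (hδ : 0 < δ)
    (hB : 0 ≤ B) {φ : E N → ℝ} (hφ : ContDiff ℝ 1 φ) (hc : HasCompactSupport φ)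
    (hs : ∀ x ∈ tsupport φ, 2 * δ ≤ ‖x‖ ∧ ‖x‖ ≤ B) :
    ∫ x, vot F x (gradient φ x) = ((N : ℝ) - 2) * sg N * ∫ y, F y * φ y := by
  have h3 := cast3 hN
  have hM := hF.nn
  have hgc := grad_cont hφ
  have hgs : HasCompactSupport (gradient φ) := by
    refine hc.mono' fun x hx => ?_
    by_contra h
    exact hx (grad_zero_of_not_mem h)
  have h4 : (0:ℝ) ≤ (N:ℝ) - 2 := by linarith
  obtain ⟨C, hC, hd⟩ := dom_int hN hδ hB (j := (N : ℝ) - 1) (by linarith) (by linarith)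
  have hnorm : ∀ x, ∀ᵐ y : E N, ‖F y * DK 0 (x - y) (gradient φ x)‖ ≤
      (((N : ℝ) - 2) * (‖x - y‖ ^ (-((N:ℝ) - 1)) * |F y|)) * ‖gradient φ x‖ := by
    intro x
    filter_upwards [ae_ne hN x] with y hy
    rw [norm_mul, Real.norm_eq_abs]
    calc _ ≤ |F y| * (‖DK 0 (x - y)‖ * ‖gradient φ x‖) := by
          gcongr; exact ContinuousLinearMap.le_opNorm _ _
      _ = _ := by rw [DK_zero_norm hN _ (sub_ne_zero.2 hy.symm)]; ring
  have hm : AEStronglyMeasurable (fun z : E N × E N => F z.2 * DK 0 (z.1 - z.2) (gradient φ z.1))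
      ((volume : Measure (E N)).prod volume) := by
    apply AEStronglyMeasurable.mul
    · exact hF.meas.comp_snd
    · apply Measurable.aestronglyMeasurable
      have : (fun z : E N × E N => DK 0 (z.1 - z.2) (gradient φ z.1)) =
        fun z => -((N : ℝ) - 2) * (‖z.1 - z.2‖ ^ (-(N : ℝ)) * inner ℝ (z.1 - z.2) (gradient φ z.1)) := by
        ext z; rw [DK_apply]
      rw [this]
      apply Measurable.const_mul
      apply Measurable.mul
      · fun_prop
      · apply Continuous.measurable
        exact (continuous_fst.sub continuous_snd).inner (hgc.comp continuous_fst)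
  have hslice : ∀ x, Integrable (fun y => F y * DK 0 (x - y) (gradient φ x)) ∧
      ∫ y, ‖F y * DK 0 (x - y) (gradient φ x)‖ ≤ ((N : ℝ) - 2) * (C * M) * ‖gradient φ x‖ := by
    intro x
    by_cases hx : x ∈ tsupport φ
    · obtain ⟨hi, hb⟩ := hd F M hF x (hs x hx).1 (hs x hx).2
      have hi2 := (hi.const_mul ((N : ℝ) - 2)).mul_const ‖gradient φ x‖
      have hi3 : Integrable (fun y => F y * DK 0 (x - y) (gradient φ x)) := by
        refine hi2.mono' ?_ (hnorm x)
        apply AEStronglyMeasurable.mul hF.meas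
        have : (fun y : E N => DK 0 (x - y) (gradient φ x)) =
          fun y => -((N : ℝ) - 2) * (‖x - y‖ ^ (-(N : ℝ)) * inner ℝ (x - y) (gradient φ x)) := by
          ext z; rw [DK_apply]
        rw [this]
        apply Measurable.aestronglyMeasurable
        fun_prop
      refine ⟨hi3, ?_⟩
      calc _ ≤ ∫ y, (((N : ℝ) - 2) * (‖x - y‖ ^ (-((N:ℝ) - 1)) * |F y|)) * ‖gradient φ x‖ :=
            integral_mono_ae hi3.norm hi2 (hnorm x)
        _ = ((N : ℝ) - 2) * (∫ y, ‖x - y‖ ^ (-((N:ℝ) - 1)) * |F y|) * ‖gradient φ x‖ := by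
            rw [integral_mul_const, integral_const_mul]
        _ ≤ _ := by gcongr
    · simp [grad_zero_of_not_mem hx]
  have hprod : Integrable (fun z : E N × E N => F z.2 * DK 0 (z.1 - z.2) (gradient φ z.1))
      ((volume : Measure (E N)).prod volume) := by
    rw [integrable_prod_iff hm]
    refine ⟨Filter.Eventually.of_forall fun x => (hslice x).1, ?_⟩
    refine Integrable.mono' (g := fun x => ((N : ℝ) - 2) * (C * M) * ‖gradient φ x‖) ?_ ?_ ?_
    · exact ((hgc.norm).integrable_of_hasCompactSupport hgs.norm).const_mul _
    · exact hm.norm.integral_prod_right'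
    · refine Filter.Eventually.of_forall fun x => ?_
      rw [Real.norm_eq_abs, abs_of_nonneg (integral_nonneg fun y => norm_nonneg _)]
      exact (hslice x).2
  have e1 : ∀ x, vot F x (gradient φ x) = ∫ y, F y * DK 0 (x - y) (gradient φ x) := by
    intro x
    by_cases hx : x ∈ tsupport φ
    · have hx0 : x ≠ 0 := norm_pos_iff.1 (by linarith [(hs x hx).1])
      unfold vot
      rw [ContinuousLinearMap.integral_apply (vot_integrable hN hF hx0)]
      rfl
    · simp [grad_zero_of_not_mem hx]
  simp_rw [e1]
  rw [integral_integral_swap (f := fun x y => F y * DK 0 (x - y) (gradient φ x)) hprod]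
  rw [← integral_const_mul]
  congr 1; ext y
  rw [integral_const_mul, delta_rep hN hφ hc]
  ring

lemma norm_inversion {N : ℕ} {x ω : E N} {ρ s : ℝ} (hx : ‖x‖ = ρ) (hω : ‖ω‖ = 1) (hs : 0 < s) (hρ : 0 < ρ) :
    ‖x - (ρ ^ 2 * s⁻¹) • ω‖ = ρ * s⁻¹ * ‖x - s • ω‖ := by
  have h : ‖x - (ρ ^ 2 * s⁻¹) • ω‖ ^ 2 = (ρ * s⁻¹ * ‖x - s • ω‖) ^ 2 := by
    rw [mul_pow, norm_sub_sq_real, norm_sub_sq_real, norm_smul, norm_smul, hω, hx, real_inner_smul_right,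
      real_inner_smul_right, Real.norm_eq_abs, Real.norm_eq_abs, mul_one, mul_one, sq_abs, sq_abs]
    field_simp
    ring
  exact (sq_eq_sq₀ (norm_nonneg _) (by positivity)).1 h

lemma pot_vanish {N : ℕ} (hN : 3 ≤ N) {F : E N → ℝ} {M : ℝ} (hF : Dec F M) {ρ : ℝ} (hρ : 0 < ρ)
    (hanti : ∀ (ω : E N), ‖ω‖ = 1 → ∀ s : ℝ, 0 < s →
      F ((ρ ^ 2 * s⁻¹) • ω) = - (F (s • ω) * (s / ρ) ^ (2 * mm N))) {x : E N} (hx : ‖x‖ = ρ) :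
    pot F x = 0 := by
  have h3 := cast3 hN
  have hx0 : x ≠ 0 := norm_pos_iff.1 (by linarith)
  unfold pot
  rw [polar_integral _ (pot_integrable hN hF hx0) hN]
  apply integral_eq_zero_of_ae
  refine Filter.Eventually.of_forall fun ω => ?_
  have hω : ‖(ω : E N)‖ = 1 := by simpa using ω.2
  set g : ℝ → ℝ := fun r => r ^ (N - 1) * (K 0 (x - r • (ω : E N)) * F (r • (ω : E N))) with hg
  show ∫ r in Ioi (0:ℝ), g r = 0
  have e1 : ∫ r in Ioi (0:ℝ), g r = ρ ^ 2 * ∫ r in Ioi (0:ℝ), g (ρ ^ 2 * r) := by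
    rw [integral_comp_mul_left_Ioi g 0 (by positivity : 0 < ρ ^ 2), mul_zero, smul_eq_mul]
    field_simp
  have e2 := integral_comp_rpow_Ioi (fun r => g (ρ ^ 2 * r)) (p := -1) (by norm_num)
  have e3 : ∫ r in Ioi (0:ℝ), g r = - ∫ r in Ioi (0:ℝ), g r := by
    conv_lhs => rw [e1, ← e2]
    rw [← integral_const_mul, ← integral_neg]
    refine setIntegral_congr_fun measurableSet_Ioi fun s hs => ?_
    have hs0 : 0 < s := hs
    simp only [Real.rpow_neg_one, abs_neg, abs_one, one_mul, smul_eq_mul, hg]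
    rw [hanti _ hω s hs0, K_zero, K_zero, norm_inversion hx hω hs0 hρ,
      Real.mul_rpow (by positivity) (norm_nonneg _)]
    have : ρ ^ 2 * (s ^ ((-1:ℝ) - 1) * ((ρ ^ 2 * s⁻¹) ^ (N - 1) * ((ρ * s⁻¹) ^ (-((N:ℝ) - 2)) * (s / ρ) ^ (2 * mm N))))
      = s ^ (N - 1) := by
      rw [show (ρ * s⁻¹) = (s / ρ)⁻¹ by field_simp, Real.inv_rpow (by positivity),
        ← Real.rpow_neg (by positivity), ← Real.rpow_add (by positivity), mul_pow, ← pow_mul]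
      have : - -((N:ℝ) - 2) + 2 * mm N = ((2 * N : ℕ) : ℝ) := by unfold mm; push_cast; ring
      rw [this, Real.rpow_natCast, show (-1 : ℝ) - 1 = ((-2 : ℤ) : ℝ) by norm_num, Real.rpow_intCast]
      obtain ⟨k, rfl⟩ : ∃ k, N = k + 1 := ⟨N - 1, by omega⟩
      simp only [Nat.add_sub_cancel]
      rw [zpow_neg, div_pow, inv_pow]
      field_simp
      norm_cast
      ring_nf
    rw [← this]
    ring
  linarith

end Ann
end
end

section
open MeasureTheory Real Set
open scoped ENNReal NNReal Topology
noncomputable section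
namespace Ann

/-- C¹ test functions -/
structure Test {N : ℕ} (Ω : Set (E N)) (φ : E N → ℝ) : Prop where
  c1 : ContDiff ℝ 1 φ
  cpt : HasCompactSupport φ
  sub : tsupport φ ⊆ Ω

lemma hasDerivAt_maxsq (s : ℝ) : HasDerivAt (fun s : ℝ => (max s 0) ^ 2) (2 * max s 0) s := by
  rcases lt_trichotomy s 0 with h | h | h
  · rw [max_eq_right h.le, mul_zero]
    refine (hasDerivAt_const s (0:ℝ)).congr_of_eventuallyEq ?_
    filter_upwards [gt_mem_nhds h] with t ht
    simp [max_eq_right (show t ≤ 0 from le_of_lt ht)]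
  · subst h
    simp only [max_self, mul_zero]
    rw [hasDerivAt_iff_isLittleO]
    simp only [max_self, ne_eq, OfNat.ofNat_ne_zero, not_false_eq_true, zero_pow, sub_zero, smul_zero]
    have h1 : (fun x : ℝ => (max x 0) ^ 2) =O[𝓝 0] (fun x : ℝ => x ^ 2) := by
      refine Asymptotics.IsBigO.of_bound 1 (Filter.Eventually.of_forall fun x => ?_)
      rw [Real.norm_eq_abs, Real.norm_eq_abs, abs_of_nonneg (by positivity), abs_of_nonneg (by positivity), one_mul]
      rcases le_total x 0 with hx | hx
      · simp [hx]; positivity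
      · simp [hx]
    refine h1.trans_isLittleO ?_
    have := Asymptotics.isLittleO_pow_pow (𝕜 := ℝ) (m := 1) (n := 2) (by norm_num)
    simpa using this
  · rw [max_eq_left h.le]
    have := (hasDerivAt_pow 2 s)
    simp only [Nat.cast_ofNat, Nat.add_one_sub_one, pow_one] at this
    refine this.congr_of_eventuallyEq ?_
    filter_upwards [lt_mem_nhds h] with t ht
    simp [max_eq_left (show 0 ≤ t from le_of_lt ht)]

lemma contDiff_maxsq : ContDiff ℝ 1 (fun s : ℝ => (max s 0) ^ 2) := by
  rw [contDiff_one_iff_deriv]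
  refine ⟨fun s => (hasDerivAt_maxsq s).differentiableAt, ?_⟩
  have : deriv (fun s : ℝ => (max s 0) ^ 2) = fun s => 2 * max s 0 := by
    ext s; exact (hasDerivAt_maxsq s).deriv
  rw [this]; fun_prop

lemma grad_contOn {N : ℕ} {Ω : Set (E N)} (hΩ : IsOpen Ω) {u : E N → ℝ} (hu : ContDiffOn ℝ 1 u Ω) :
    ContinuousOn (gradient u) Ω := by
  unfold gradient
  exact (InnerProductSpace.toDual ℝ (E N)).symm.continuous.comp_continuousOn
    (hu.continuousOn_fderiv_of_isOpen hΩ le_rfl)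

lemma integrable_of_supp {N : ℕ} {Ω : Set (E N)} {φ : E N → ℝ} (hφ : Test Ω φ) {g : E N → ℝ}
    (hg : ContinuousOn g Ω) (h0 : ∀ x, x ∉ tsupport φ → g x = 0) : Integrable g := by
  have h1 : IntegrableOn g (tsupport φ) := (hg.mono hφ.sub).integrableOn_compact hφ.cpt.isCompact
  rwa [integrableOn_iff_integrable_of_support_subset] at h1
  intro x hx
  by_contra h
  exact hx (h0 x h)

lemma integrable_pair {N : ℕ} {Ω : Set (E N)} (hΩ : IsOpen Ω) {u : E N → ℝ} (hu : ContDiffOn ℝ 1 u Ω)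
    {φ : E N → ℝ} (hφ : Test Ω φ) : Integrable (fun x => inner ℝ (gradient u x) (gradient φ x)) := by
  refine integrable_of_supp hφ ?_ ?_
  · exact (grad_contOn hΩ hu).inner (grad_cont hφ.c1).continuousOn
  · intro x hx; rw [grad_zero_of_not_mem hx, inner_zero_right]

lemma integrable_mul_test {N : ℕ} {Ω : Set (E N)} {u : E N → ℝ} (hu : ContinuousOn u Ω)
    {φ : E N → ℝ} (hφ : Test Ω φ) : Integrable (fun x => u x * φ x) := by
  refine integrable_of_supp hφ (hu.mul hφ.c1.continuous.continuousOn) ?_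
  intro x hx; rw [image_eq_zero_of_notMem_tsupport hx, mul_zero]

lemma grad_comp {N : ℕ} {u : E N → ℝ} {h : ℝ → ℝ} {h' : ℝ} {x : E N} (hu : DifferentiableAt ℝ u x)
    (hh : HasDerivAt h h' (u x)) : gradient (fun x => h (u x)) x = h' • gradient u x := by
  have := hh.comp_hasFDerivAt x hu.hasFDerivAt
  unfold gradient
  have e : fderiv ℝ (fun x => h (u x)) x = h' • fderiv ℝ u x := this.fderiv
  rw [e, map_smulₛₗ]; simp

lemma wmp {N : ℕ} (hN : 3 ≤ N) {Ω : Set (E N)} (hΩ : IsOpen Ω) (hb : Bornology.IsBounded Ω) {w : E N → ℝ} {c : ℝ}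
    (hc : 0 ≤ c) (hw1 : ContDiffOn ℝ 1 w Ω) (hw0 : ContinuousOn w (closure Ω))
    (hbd : ∀ x ∈ closure Ω, x ∉ Ω → 0 ≤ w x)
    (hsup : ∀ φ, Test Ω φ → (∀ x, 0 ≤ φ x) →
      0 ≤ ∫ x, (inner ℝ (gradient w x) (gradient φ x) + c * (w x * φ x))) :
    ∀ x ∈ closure Ω, 0 ≤ w x := by
  classical
  have hnt := nontriv hN
  intro x0 hx0'
  by_cases hx0 : x0 ∉ Ω
  · exact hbd x0 hx0' hx0
  push Not at hx0
  by_contra hneg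
  push Not at hneg
  obtain ⟨δ, hδ, hδ2⟩ : ∃ δ, 0 < δ ∧ w x0 < -δ := ⟨-(w x0) / 2, by linarith, by linarith⟩
  set φ : E N → ℝ := fun x => if x ∈ Ω then (max (-w x - δ) 0) ^ 2 else 0 with hφ
  have hφ0 : ∀ x, 0 ≤ φ x := by
    intro x; simp only [hφ]; split_ifs <;> positivity
  set Z : Set (E N) := closure Ω ∩ w ⁻¹' (Iic (-δ)) with hZ
  have hZc : IsClosed Z := hw0.preimage_isClosed_of_isClosed isClosed_closure isClosed_Iic
  have hZΩ : Z ⊆ Ω := by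
    intro x hx
    by_contra h
    have := hbd x hx.1 h
    have h2 : w x ≤ -δ := hx.2
    linarith
  have hsuppZ : Function.support φ ⊆ Z := by
    intro x hx
    have hx' : φ x ≠ 0 := hx
    simp only [hφ] at hx'
    split_ifs at hx' with h
    · refine ⟨subset_closure h, ?_⟩
      by_contra h3
      have h4 : ¬ (w x ≤ -δ) := h3
      push Not at h4
      rw [max_eq_right (by linarith)] at hx'
      simp at hx'
    · exact absurd rfl hx'
  have htZ : tsupport φ ⊆ Z := closure_minimal hsuppZ hZc
  have hZk : IsCompact Z := Metric.isCompact_of_isClosed_isBounded hZc (hb.subset hZΩ)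
  have heq : ∀ x ∈ Ω, φ =ᶠ[𝓝 x] fun x => (fun s => (max s 0) ^ 2) (-w x - δ) := by
    intro x hx
    filter_upwards [hΩ.mem_nhds hx] with y hy
    simp only [hφ, if_pos hy]
  have hcd : ∀ x ∈ Ω, ContDiffAt ℝ 1 w x := fun x hx => hw1.contDiffAt (hΩ.mem_nhds hx)
  have hT : Test Ω φ := by
    refine ⟨?_, HasCompactSupport.of_support_subset_isCompact hZk hsuppZ, htZ.trans hZΩ⟩
    rw [contDiff_iff_contDiffAt]
    intro x
    by_cases hx : x ∉ tsupport φ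
    · refine contDiffAt_const (c := (0:ℝ)) |>.congr_of_eventuallyEq ?_
      exact notMem_tsupport_iff_eventuallyEq.1 hx
    push Not at hx
    have hxΩ := hZΩ (htZ hx)
    refine ContDiffAt.congr_of_eventuallyEq ?_ (heq x hxΩ)
    exact contDiff_maxsq.contDiffAt.comp x ((hcd x hxΩ).neg.sub contDiffAt_const)
  have hgrad : ∀ x ∈ Ω, gradient φ x = (-(2 * max (-w x - δ) 0)) • gradient w x := by
    intro x hx
    have h1 : HasDerivAt (fun t : ℝ => (max (-t - δ) 0) ^ 2) (-(2 * max (-w x - δ) 0)) (w x) := by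
      have h2 : HasDerivAt (fun t : ℝ => -t - δ) (-1) (w x) := ((hasDerivAt_id (w x)).neg).sub_const δ
      have := (hasDerivAt_maxsq (-w x - δ)).comp (w x) h2
      refine this.congr_deriv (by ring)
    rw [← grad_comp ((hcd x hx).differentiableAt one_ne_zero) h1]
    unfold gradient
    rw [(heq x hx).fderiv_eq]
  set g : E N → ℝ := fun x => inner ℝ (gradient w x) (gradient φ x) + c * (w x * φ x) with hg
  have hgi : Integrable g := (integrable_pair hΩ hw1 hT).add
    ((integrable_mul_test hw1.continuousOn hT).const_mul c)
  have hgneg : ∀ x, g x ≤ 0 ∧ (g x = 0 → gradient φ x = 0) := by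
    intro x
    by_cases hx : x ∈ tsupport φ
    · have hxΩ := hZΩ (htZ hx)
      have hwx : w x ≤ -δ := (htZ hx).2
      have e1 : g x = -(2 * max (-w x - δ) 0 * ‖gradient w x‖ ^ 2) + c * (w x * φ x) := by
        simp only [hg]; rw [hgrad x hxΩ, real_inner_smul_right, real_inner_self_eq_norm_sq]; ring
      have h1 : 0 ≤ max (-w x - δ) 0 * ‖gradient w x‖ ^ 2 := by positivity
      have h2 : c * (w x * φ x) ≤ 0 :=
        mul_nonpos_of_nonneg_of_nonpos hc (mul_nonpos_of_nonpos_of_nonneg (by linarith) (hφ0 x))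
      refine ⟨by rw [e1]; linarith, fun h => ?_⟩
      have h3 : max (-w x - δ) 0 * ‖gradient w x‖ ^ 2 = 0 := by linarith
      rw [hgrad x hxΩ]
      rcases mul_eq_zero.1 h3 with h4 | h4
      · rw [h4]; simp
      · have : gradient w x = 0 := by simpa using h4
        rw [this, smul_zero]
    · simp only [hg]
      rw [grad_zero_of_not_mem hx, image_eq_zero_of_notMem_tsupport hx]; simp
  have hIntg : ∫ x, g x = 0 := le_antisymm (integral_nonpos fun x => (hgneg x).1) (hsup φ hT hφ0)
  have hae : (fun x => -g x) =ᵐ[volume] 0 := by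
    refine (integral_eq_zero_iff_of_nonneg (f := fun x => -g x) (fun x => by simpa using (hgneg x).1) hgi.neg).1 ?_
    rw [integral_neg, hIntg, neg_zero]
  have hae2 : gradient φ =ᵐ[volume] fun _ => (0 : E N) := by
    filter_upwards [hae] with x hx
    exact (hgneg x).2 (by simpa using hx)
  have hg0 : gradient φ = fun _ => (0 : E N) :=
    Continuous.ae_eq_iff_eq volume (grad_cont hT.c1) continuous_const |>.1 hae2
  have hconst := is_const_of_fderiv_eq_zero (𝕜 := ℝ) (hT.c1.differentiable one_ne_zero) (fun x => by
    have := congrFun hg0 x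
    unfold gradient at this
    simpa using this)
  have hpos : 0 < φ x0 := by
    simp only [hφ, if_pos hx0]
    have : 0 < max (-w x0 - δ) 0 := lt_max_of_lt_left (by linarith)
    positivity
  obtain ⟨y, hy⟩ : ∃ y, y ∉ Ω := by
    by_contra h
    push Not at h
    have : Ω = univ := eq_univ_of_forall h
    rw [this] at hb
    exact NormedSpace.unbounded_univ ℝ (E N) hb
  have := hconst x0 y
  rw [this] at hpos
  simp only [hφ, if_neg hy, lt_irrefl] at hpos

end Ann
end
end

section
open MeasureTheory Real Set
open scoped ENNReal NNReal Topology
noncomputable section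
namespace Ann

lemma radial_grad {N : ℕ} {f f1 : ℝ → ℝ} (hf : ∀ s, HasDerivAt f (f1 s) s) (z x : E N) :
    HasGradientAt (fun x : E N => f (‖x - z‖ ^ 2)) ((2 * f1 (‖x - z‖ ^ 2)) • (x - z)) x := by
  rw [hasGradientAt_iff_hasFDerivAt]
  have h0 : HasFDerivAt (fun x : E N => ‖x - z‖ ^ 2) (2 • innerSL ℝ (x - z)) x := by
    have := ((hasStrictFDerivAt_norm_sq (x - z)).hasFDerivAt).comp x ((hasFDerivAt_id x).sub_const z)
    exact this
  refine ((hf _).comp_hasFDerivAt x h0).congr_fderiv ?_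
  ext v
  simp
  ring

lemma radial_c1 {N : ℕ} {f f1 f2 : ℝ → ℝ} (hf : ∀ s, HasDerivAt f (f1 s) s)
    (hf1 : ∀ s, HasDerivAt f1 (f2 s) s) (z : E N) :
    ContDiff ℝ 1 (fun x : E N => f (‖x - z‖ ^ 2)) := by
  have : ContDiff ℝ 1 f := by
    rw [contDiff_one_iff_deriv]
    refine ⟨fun s => (hf s).differentiableAt, ?_⟩
    rw [show deriv f = f1 from funext fun s => (hf s).deriv]
    exact continuous_iff_continuousAt.2 fun s => (hf1 s).continuousAt
  exact this.comp ((contDiff_id.sub contDiff_const).norm_sq ℝ)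

lemma radial_ibp {N : ℕ} {f f1 f2 : ℝ → ℝ} (hf : ∀ s, HasDerivAt f (f1 s) s)
    (hf1 : ∀ s, HasDerivAt f1 (f2 s) s) (hf2 : Continuous f2) (z : E N) {φ : E N → ℝ}
    (hφ : Test univ φ) :
    ∫ x, inner ℝ (gradient (fun x : E N => f (‖x - z‖ ^ 2)) x) (gradient φ x) =
      - ∫ x, (4 * ‖x - z‖ ^ 2 * f2 (‖x - z‖ ^ 2) + 2 * N * f1 (‖x - z‖ ^ 2)) * φ x := by
  have cf1 : Continuous f1 := continuous_iff_continuousAt.2 fun s => (hf1 s).continuousAt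
  set b : Fin N → E N := fun i => EuclideanSpace.single i (1:ℝ) with hb
  set g : Fin N → E N → ℝ := fun i x => 2 * f1 (‖x - z‖ ^ 2) * (x i - z i) with hg
  have hgd : ∀ i x, HasFDerivAt (g i) ((2 * f1 (‖x - z‖ ^ 2)) • (EuclideanSpace.proj i : E N →L[ℝ] ℝ)
      + (x i - z i) • ((2 * f2 (‖x - z‖ ^ 2)) • (2 • innerSL ℝ (x - z)))) x := by
    intro i x
    have h0 : HasFDerivAt (fun x : E N => ‖x - z‖ ^ 2) (2 • innerSL ℝ (x - z)) x := by
      have := ((hasStrictFDerivAt_norm_sq (x - z)).hasFDerivAt).comp x ((hasFDerivAt_id x).sub_const z)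
      exact this
    have h1 : HasFDerivAt (fun x : E N => 2 * f1 (‖x - z‖ ^ 2)) ((2 * f2 (‖x - z‖ ^ 2)) • (2 • innerSL ℝ (x - z))) x := by
      refine (((hf1 _).comp_hasFDerivAt x h0).const_mul 2).congr_fderiv ?_
      ext v; simp; ring
    have h2 : HasFDerivAt (fun x : E N => x i - z i) (EuclideanSpace.proj i : E N →L[ℝ] ℝ) x :=
      ((EuclideanSpace.proj i : E N →L[ℝ] ℝ).hasFDerivAt).sub_const (z i)
    exact h1.mul h2
  have hgdi : ∀ i x, fderiv ℝ (g i) x (b i) = 2 * f1 (‖x - z‖ ^ 2) + 4 * f2 (‖x - z‖ ^ 2) * (x i - z i) ^ 2 := by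
    intro i x
    rw [(hgd i x).fderiv]
    have : inner ℝ (x - z) (b i) = x i - z i := by
      simp [hb, EuclideanSpace.inner_single_right]
    have e : ((EuclideanSpace.proj i : E N →L[ℝ] ℝ) (b i)) = 1 := by simp [hb]
    simp only [add_apply, smul_apply, innerSL_apply_apply, this, e, smul_eq_mul]
    simp only [nsmul_eq_mul]
    push_cast
    ring
  have hcoord : ∀ i : Fin N, Continuous fun x : E N => x i := fun i =>
    (EuclideanSpace.proj i : E N →L[ℝ] ℝ).continuous
  have hgc : ∀ i, Continuous (g i) := by
    intro i
    have := hcoord i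
    simp only [hg]; fun_prop
  have hdc : ∀ i, Continuous fun x => fderiv ℝ (g i) x (b i) := by
    intro i
    simp_rw [hgdi]
    have := hcoord i
    fun_prop
  have hφd : ∀ i, Continuous fun x => fderiv ℝ φ x (b i) := by
    intro i
    exact (hφ.c1.continuous_fderiv one_ne_zero).clm_apply continuous_const
  have hφs : ∀ i, ∀ x, x ∉ tsupport φ → fderiv ℝ φ x (b i) = 0 := by
    intro i x hx
    rw [fderiv_eq_inner, grad_zero_of_not_mem hx, inner_zero_left]
  have hI1 : ∀ i, Integrable fun x => g i x * fderiv ℝ φ x (b i) := fun i =>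
    integrable_of_supp hφ ((hgc i).mul (hφd i)).continuousOn (fun x hx => by rw [hφs i x hx, mul_zero])
  have hI2 : ∀ i, Integrable fun x => fderiv ℝ (g i) x (b i) * φ x := fun i =>
    integrable_mul_test (hdc i).continuousOn hφ
  have hI3 : ∀ i, Integrable fun x => g i x * φ x := fun i =>
    integrable_mul_test (hgc i).continuousOn hφ
  have key : ∀ i, ∫ x, g i x * fderiv ℝ φ x (b i) = - ∫ x, fderiv ℝ (g i) x (b i) * φ x := fun i =>
    integral_mul_fderiv_eq_neg_fderiv_mul_of_integrable (hI2 i) (hI1 i) (hI3 i)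
      (fun x _ => (hgd i x).differentiableAt) (fun x _ => hφ.c1.differentiable one_ne_zero x)
  have e1 : ∀ x, inner ℝ (gradient (fun x : E N => f (‖x - z‖ ^ 2)) x) (gradient φ x) =
      ∑ i, g i x * fderiv ℝ φ x (b i) := by
    intro x
    rw [(radial_grad hf z x).gradient, real_inner_comm, ← fderiv_eq_inner, map_smul]
    have : x - z = ∑ i, (x i - z i) • b i := by
      ext j
      simp [hb, Finset.sum_apply, Pi.single_apply]
    conv_lhs => rw [this]
    rw [map_sum, smul_eq_mul, Finset.mul_sum]
    refine Finset.sum_congr rfl fun i _ => ?_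
    rw [← this, map_smul, smul_eq_mul]
    simp only [hg]
    ring
  have e2 : ∀ x : E N, (4 * ‖x - z‖ ^ 2 * f2 (‖x - z‖ ^ 2) + 2 * N * f1 (‖x - z‖ ^ 2)) * φ x =
      ∑ i, fderiv ℝ (g i) x (b i) * φ x := by
    intro x
    simp_rw [hgdi]
    rw [← Finset.sum_mul, Finset.sum_add_distrib, ← Finset.mul_sum, ← Finset.mul_sum]
    have : ‖x - z‖ ^ 2 = ∑ i, (x i - z i) ^ 2 := by
      rw [EuclideanSpace.real_norm_sq_eq]; simp
    rw [← this]
    simp only [Finset.sum_const, Finset.card_univ, Fintype.card_fin, nsmul_eq_mul]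
    ring
  simp_rw [e1, e2]
  rw [integral_finsetSum _ fun i _ => hI1 i, integral_finsetSum _ fun i _ => hI2 i, ← Finset.sum_neg_distrib]
  exact Finset.sum_congr rfl fun i _ => key i

end Ann
end
end

section
open MeasureTheory Real Set
open scoped ENNReal NNReal Topology
noncomputable section
namespace Ann

/-- open / closed annuli -/
abbrev Ao (N : ℕ) (R : ℝ) : Set (E N) := annulus N R (R + 1)
def Ac (N : ℕ) (R : ℝ) : Set (E N) := {x | R ≤ ‖x‖ ∧ ‖x‖ ≤ R + 1}

lemma Ao_open {N : ℕ} (R : ℝ) : IsOpen (Ao N R) :=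
  (isOpen_lt continuous_const continuous_norm).inter (isOpen_lt continuous_norm continuous_const)

lemma Ac_closed {N : ℕ} (R : ℝ) : IsClosed (Ac N R) :=
  (isClosed_le continuous_const continuous_norm).inter (isClosed_le continuous_norm continuous_const)

lemma Ac_compact {N : ℕ} (R : ℝ) : IsCompact (Ac N R) := by
  apply Metric.isCompact_of_isClosed_isBounded (Ac_closed R)
  apply (Metric.isBounded_closedBall (x := (0 : E N)) (r := R + 1)).subset
  intro x hx
  simpa using hx.2

lemma Ao_sub {N : ℕ} (R : ℝ) : Ao N R ⊆ Ac N R := fun _ hx => ⟨hx.1.le, hx.2.le⟩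

lemma Ao_bounded {N : ℕ} (R : ℝ) : Bornology.IsBounded (Ao N R) := (Ac_compact R).isBounded.subset (Ao_sub R)

lemma closure_Ao {N : ℕ} {R : ℝ} (hR : 0 < R) : closure (Ao N R) = Ac N R := by
  apply subset_antisymm (closure_minimal (Ao_sub R) (Ac_closed R))
  intro x hx
  have hx0 : 0 < ‖x‖ := hR.trans_le hx.1
  have hxt : Filter.Tendsto (fun t : ℝ => ((1 - t) + t * ((R + 1 / 2) / ‖x‖)) • x) (𝓝[>] 0) (𝓝 x) := by
    have : Filter.Tendsto (fun t : ℝ => ((1 - t) + t * ((R + 1 / 2) / ‖x‖)) • x) (𝓝 0) (𝓝 (((1 - 0) + 0 * ((R + 1 / 2) / ‖x‖)) • x)) := by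
      apply Continuous.tendsto
      fun_prop
    simp only [sub_zero, zero_mul, add_zero, one_smul] at this
    exact this.mono_left nhdsWithin_le_nhds
  refine mem_closure_of_tendsto hxt ?_
  filter_upwards [Ioo_mem_nhdsGT (show (0:ℝ) < 1 by norm_num)] with t ht
  have h1 : ‖((1 - t) + t * ((R + 1 / 2) / ‖x‖)) • x‖ = (1 - t) * ‖x‖ + t * (R + 1 / 2) := by
    have : 0 ≤ (1 - t) + t * ((R + 1 / 2) / ‖x‖) := by
      have := ht.1; have := ht.2
      have : 0 ≤ t * ((R + 1 / 2) / ‖x‖) := by positivity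
      linarith
    rw [norm_smul, Real.norm_eq_abs, abs_of_nonneg this]
    field_simp
  show R < _ ∧ _ < R + 1
  rw [h1]
  constructor <;> nlinarith [ht.1, ht.2, hx.1, hx.2]

lemma Ac_ne {N : ℕ} {R : ℝ} (hR : 0 < R) {x : E N} (hx : x ∈ Ac N R) : x ≠ 0 :=
  norm_pos_iff.1 (hR.trans_le hx.1)

lemma Ac_not_Ao {N : ℕ} {R : ℝ} {x : E N} (hx : x ∈ Ac N R) (h : x ∉ Ao N R) : ‖x‖ = R ∨ ‖x‖ = R + 1 := by
  by_contra h2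
  push Not at h2
  exact h ⟨lt_of_le_of_ne hx.1 h2.1.symm, lt_of_le_of_ne hx.2 h2.2⟩

/-- weak Dirichlet solution of `-Δu + c u = f` in the annulus -/
structure Sol {N : ℕ} (c R : ℝ) (f u : E N → ℝ) : Prop where
  c1 : ContDiffOn ℝ 1 u {x | x ≠ 0}
  bc : ∀ x, (‖x‖ = R ∨ ‖x‖ = R + 1) → u x = 0
  weak : ∀ φ, Test (Ao N R) φ →
    ∫ x, (inner ℝ (gradient u x) (gradient φ x) + c * (u x * φ x)) = ∫ x, f x * φ x

lemma Ao_sub_ne {N : ℕ} {R : ℝ} (hR : 0 < R) : Ao N R ⊆ {x : E N | x ≠ 0} :=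
  fun _ hx => Ac_ne hR (Ao_sub R hx)

lemma Sol.c1A {N : ℕ} {c R : ℝ} {f u : E N → ℝ} (hR : 0 < R) (h : Sol c R f u) : ContDiffOn ℝ 1 u (Ao N R) :=
  h.c1.mono (Ao_sub_ne hR)

lemma Sol.contA {N : ℕ} {c R : ℝ} {f u : E N → ℝ} (hR : 0 < R) (h : Sol c R f u) : ContinuousOn u (Ac N R) :=
  h.c1.continuousOn.mono fun _ hx => Ac_ne hR hx

lemma grad_add {N : ℕ} {u v : E N → ℝ} {x : E N} (hu : DifferentiableAt ℝ u x) (hv : DifferentiableAt ℝ v x)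
    (a b : ℝ) : gradient (fun x => a * u x + b * v x) x = a • gradient u x + b • gradient v x := by
  unfold gradient
  have : fderiv ℝ (fun x => a * u x + b * v x) x = a • fderiv ℝ u x + b • fderiv ℝ v x :=
    ((hu.hasFDerivAt.const_mul a).add (hv.hasFDerivAt.const_mul b)).fderiv
  rw [this, map_add, map_smulₛₗ, map_smulₛₗ]; simp

/-- pairing of a linear combination -/
lemma pair_lin {N : ℕ} {Ω : Set (E N)} (hΩ : IsOpen Ω) {u v : E N → ℝ} (hu : ContDiffOn ℝ 1 u Ω)
    (hv : ContDiffOn ℝ 1 v Ω) (a b c : ℝ) {φ : E N → ℝ} (hφ : Test Ω φ) :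
    ∫ x, (inner ℝ (gradient (fun x => a * u x + b * v x) x) (gradient φ x) + c * ((a * u x + b * v x) * φ x)) =
     a * (∫ x, (inner ℝ (gradient u x) (gradient φ x) + c * (u x * φ x))) +
     b * (∫ x, (inner ℝ (gradient v x) (gradient φ x) + c * (v x * φ x))) := by
  have h1 : Integrable fun x => (inner ℝ (gradient u x) (gradient φ x) + c * (u x * φ x)) :=
    (integrable_pair hΩ hu hφ).add ((integrable_mul_test hu.continuousOn hφ).const_mul c)
  have h2 : Integrable fun x => (inner ℝ (gradient v x) (gradient φ x) + c * (v x * φ x)) :=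
    (integrable_pair hΩ hv hφ).add ((integrable_mul_test hv.continuousOn hφ).const_mul c)
  rw [← integral_const_mul, ← integral_const_mul, ← integral_add (h1.const_mul a) (h2.const_mul b)]
  congr 1; ext x
  by_cases hx : x ∈ tsupport φ
  · have hxΩ := hΩ.mem_nhds (hφ.sub hx)
    rw [grad_add ((hu.contDiffAt hxΩ).differentiableAt one_ne_zero)
      ((hv.contDiffAt hxΩ).differentiableAt one_ne_zero), inner_add_left, real_inner_smul_left,
      real_inner_smul_left]
    ring
  · rw [grad_zero_of_not_mem hx, image_eq_zero_of_notMem_tsupport hx]; simp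

lemma Sol.lin {N : ℕ} {c R : ℝ} {f g u v : E N → ℝ} (hR : 0 < R) (hu : Sol c R f u) (hv : Sol c R g v)
    (hf : ContinuousOn f (Ac N R)) (hg : ContinuousOn g (Ac N R)) (a b : ℝ) :
    Sol c R (fun x => a * f x + b * g x) (fun x => a * u x + b * v x) := by
  refine ⟨(contDiffOn_const.mul hu.c1).add (contDiffOn_const.mul hv.c1), ?_, ?_⟩
  · intro x hx; rw [hu.bc x hx, hv.bc x hx]; ring
  · intro φ hφ
    rw [pair_lin (Ao_open R) (hu.c1A hR) (hv.c1A hR) a b c hφ, hu.weak φ hφ, hv.weak φ hφ,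
      ← integral_const_mul, ← integral_const_mul, ← integral_add]
    · congr 1; ext x; ring
    · exact (integrable_mul_test (hf.mono (Ao_sub R)) hφ).const_mul a
    · exact (integrable_mul_test (hg.mono (Ao_sub R)) hφ).const_mul b

lemma integral_mul_test_nonneg {N : ℕ} {Ω : Set (E N)} {f φ : E N → ℝ} (hφ : Test Ω φ)
    (hφ0 : ∀ x, 0 ≤ φ x) (hf : ∀ x ∈ Ω, 0 ≤ f x) : 0 ≤ ∫ x, f x * φ x := by
  apply integral_nonneg
  intro x
  by_cases hx : x ∈ tsupport φ
  · exact mul_nonneg (hf x (hφ.sub hx)) (hφ0 x)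
  · simp [image_eq_zero_of_notMem_tsupport hx]

lemma Sol.nonneg {N : ℕ} (hN : 3 ≤ N) {c R : ℝ} {f u : E N → ℝ} (hR : 0 < R) (hc : 0 ≤ c) (hu : Sol c R f u)
    (hf : ∀ x ∈ Ao N R, 0 ≤ f x) : ∀ x ∈ Ac N R, 0 ≤ u x := by
  have := wmp hN (Ao_open (N := N) R) (Ao_bounded R) hc (hu.c1A hR) (by rw [closure_Ao hR]; exact hu.contA hR) ?_ ?_
  · rwa [closure_Ao hR] at this
  · rw [closure_Ao hR]
    intro x hx hx'
    rw [hu.bc x (Ac_not_Ao hx hx')]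
  · intro φ hφ hφ0
    rw [hu.weak φ hφ]
    exact integral_mul_test_nonneg hφ hφ0 hf

lemma Sol.unique {N : ℕ} (hN : 3 ≤ N) {c R : ℝ} {f g u v : E N → ℝ} (hR : 0 < R) (hc : 0 ≤ c) (hu : Sol c R f u)
    (hv : Sol c R g v) (hf : ContinuousOn f (Ac N R)) (hg : ContinuousOn g (Ac N R))
    (hfg : ∀ x ∈ Ao N R, f x = g x) : ∀ x ∈ Ac N R, u x = v x := by
  intro x hx
  have h1 := (hu.lin hR hv hf hg 1 (-1)).nonneg hN hR hc (fun x hx => by rw [hfg x hx]; simp) x hx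
  have h2 := (hu.lin hR hv hf hg (-1) 1).nonneg hN hR hc (fun x hx => by rw [hfg x hx]; simp) x hx
  linarith

/-- torsion barrier: comparison bound for `-Δu = f` -/
lemma Sol.bound {N : ℕ} (hN : 3 ≤ N) {R : ℝ} {f u : E N → ℝ} (hR : 2 * N ≤ R) (hu : Sol 0 R f u)
    (hf : ContinuousOn f (Ac N R)) {M : ℝ} (hM : ∀ x ∈ Ac N R, |f x| ≤ M) : ∀ x ∈ Ac N R, |u x| ≤ M / 2 := by
  have h3 := cast3 hN
  have hR0 : 0 < R := by linarith
  set P : ℝ → ℝ := fun s => (s - R ^ 2) * ((R + 1) ^ 2 - s) with hP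
  set P1 : ℝ → ℝ := fun s => R ^ 2 + (R + 1) ^ 2 - 2 * s with hP1
  set P2 : ℝ → ℝ := fun _ => -2 with hP2
  have d1 : ∀ s, HasDerivAt P (P1 s) s := by
    intro s
    have := ((hasDerivAt_id s).sub_const (R ^ 2)).mul ((hasDerivAt_id s).const_sub ((R + 1) ^ 2))
    refine this.congr_deriv ?_
    simp [hP1]; ring
  have d2 : ∀ s, HasDerivAt P1 (P2 s) s := by
    intro s
    have := ((hasDerivAt_id s).const_mul 2).const_sub (R ^ 2 + (R + 1) ^ 2)
    refine this.congr_deriv ?_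
    simp [hP2]
  set b : E N → ℝ := fun x => P (‖x - 0‖ ^ 2) with hb
  have hbc : ContDiff ℝ 1 b := radial_c1 d1 d2 0
  -- one-sided statement
  have main : ∀ s : ℝ, |s| = 1 → ∀ x ∈ Ac N R, 0 ≤ (M / (4 * R ^ 2)) * b x + s * u x := by
    intro s hs
    have hM0 : ∀ x ∈ Ac N R, 0 ≤ M := fun x hx => (abs_nonneg _).trans (hM x hx)
    intro x hx
    have hMM := hM0 x hx
    have := wmp hN (Ao_open (N := N) R) (Ao_bounded R) (w := fun x => (M / (4 * R ^ 2)) * b x + s * u x) (c := 0) le_rfl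
      ((contDiffOn_const.mul hbc.contDiffOn).add (contDiffOn_const.mul (hu.c1A hR0)))
      (by rw [closure_Ao hR0]
          exact (continuousOn_const.mul hbc.continuous.continuousOn).add (continuousOn_const.mul (hu.contA hR0))) ?_ ?_
    · rw [closure_Ao hR0] at this
      exact this x hx
    · rw [closure_Ao hR0]
      intro y hy hy'
      have h := Ac_not_Ao hy hy'
      have : b y = 0 := by
        simp only [hb, hP, sub_zero]
        rcases h with h | h <;> rw [h] <;> ring
      simp only [hu.bc y h, this]; simp
    · intro φ hφ hφ0
      rw [pair_lin (Ao_open R) hbc.contDiffOn (hu.c1A hR0) _ _ 0 hφ, hu.weak φ hφ]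
      have hφ' : Test univ φ := ⟨hφ.c1, hφ.cpt, subset_univ _⟩
      have e := radial_ibp d1 d2 continuous_const (0 : E N) hφ'
      simp only [zero_mul, add_zero]
      simp only [hb]
      rw [e, ← integral_neg, ← integral_const_mul, ← integral_const_mul, ← integral_add]
      · have e2 : (fun x : E N => M / (4 * R ^ 2) * -((4 * ‖x - 0‖ ^ 2 * P2 (‖x - 0‖ ^ 2) + 2 * ↑N * P1 (‖x - 0‖ ^ 2)) * φ x)
              + s * (f x * φ x)) = fun x => (M / (4 * R ^ 2) * -((4 * ‖x - 0‖ ^ 2 * P2 (‖x - 0‖ ^ 2) + 2 * ↑N * P1 (‖x - 0‖ ^ 2)))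
              + s * f x) * φ x := by ext x; ring
        rw [e2]
        refine integral_mul_test_nonneg hφ hφ0 fun y hy => ?_
        simp only [sub_zero, hP1, hP2]
        set t := ‖y‖ ^ 2 with ht
        have ht1 : R ^ 2 ≤ t := pow_le_pow_left₀ hR0.le hy.1.le 2
        have hb1 : 4 * R ^ 2 ≤ -(4 * t * -2 + 2 * N * (R ^ 2 + (R + 1) ^ 2 - 2 * t)) := by
          have h5 : (N:ℝ) * (R ^ 2 + (R + 1) ^ 2 - 2 * t) ≤ N * (2 * R + 1) := by gcongr; nlinarith
          nlinarith
        have h6 : M ≤ M / (4 * R ^ 2) * -(4 * t * -2 + 2 * N * (R ^ 2 + (R + 1) ^ 2 - 2 * t)) := by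
          calc M = M / (4 * R ^ 2) * (4 * R ^ 2) := by field_simp
            _ ≤ _ := by gcongr
        have h7 : |s * f y| ≤ M := by rw [abs_mul, hs, one_mul]; exact hM y (Ao_sub R hy)
        have := (abs_le.1 h7).1
        linarith
      · apply Integrable.const_mul
        refine Integrable.neg (integrable_mul_test (Ω := univ) ?_ hφ')
        apply Continuous.continuousOn
        simp only [hP1, hP2]; fun_prop
      · exact (integrable_mul_test (hf.mono (Ao_sub R)) hφ).const_mul s
  intro x hx
  have hMM : 0 ≤ M := (abs_nonneg _).trans (hM x hx)
  have h1 := main 1 (by simp) x hx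
  have h2 := main (-1) (by simp) x hx
  have h4 : (M / (4 * R ^ 2)) * b x ≤ M / 2 := by
    have hbx : b x ≤ 2 * R ^ 2 := by
      simp only [hb, hP, sub_zero]
      nlinarith [sq_nonneg (2 * ‖x‖ ^ 2 - R ^ 2 - (R + 1) ^ 2)]
    calc _ ≤ (M / (4 * R ^ 2)) * (2 * R ^ 2) := by gcongr
      _ = _ := by field_simp; norm_num
  rw [abs_le]
  constructor <;> linarith

end Ann
end
end

section
open MeasureTheory Real Set
open scoped ENNReal NNReal Topology
noncomputable section
namespace Ann

def qq (R s : ℝ) : ℝ := (Real.log s - Real.log R) / (Real.log (R + 1) - Real.log R)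

def rad (R s : ℝ) : ℝ :=
  Real.exp (Real.log R + (Real.log (R + 1) - Real.log R) * (Real.arccos (Real.cos (π * qq R s)) / π))

/-- antisymmetric extension of `f` -/
def Fx {N : ℕ} (R : ℝ) (f : E N → ℝ) (y : E N) : ℝ :=
  Real.sign (Real.sin (π * qq R ‖y‖)) *
    ((rad R ‖y‖ / ‖y‖) ^ mm N * (Ac N R).indicator f ((rad R ‖y‖ / ‖y‖) • y))

lemma logL {R : ℝ} (hR : 0 < R) : 0 < Real.log (R + 1) - Real.log R := by
  have := Real.log_lt_log hR (by linarith : R < R + 1); linarith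

lemma rad_mem {R : ℝ} (hR : 0 < R) (s : ℝ) : R ≤ rad R s ∧ rad R s ≤ R + 1 := by
  have hL := logL hR
  have h1 : 0 ≤ Real.arccos (Real.cos (π * qq R s)) / π := div_nonneg (Real.arccos_nonneg _) Real.pi_pos.le
  have h2 : Real.arccos (Real.cos (π * qq R s)) / π ≤ 1 := (div_le_one Real.pi_pos).2 (Real.arccos_le_pi _)
  unfold rad
  constructor
  · calc R = Real.exp (Real.log R) := (Real.exp_log hR).symm
      _ ≤ _ := Real.exp_le_exp.2 (by nlinarith [mul_nonneg hL.le h1])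
  · calc _ ≤ Real.exp (Real.log (R + 1)) := Real.exp_le_exp.2 (by nlinarith)
      _ = R + 1 := Real.exp_log (by linarith)

lemma Fx_eq {N : ℕ} {R : ℝ} (hR : 0 < R) (f : E N → ℝ) {y : E N} (hy : y ∈ Ao N R) : Fx R f y = f y := by
  have hL := logL hR
  have hy0 : 0 < ‖y‖ := hR.trans hy.1
  have q0 : 0 < qq R ‖y‖ := div_pos (by linarith [Real.log_lt_log hR hy.1]) hL
  have q1 : qq R ‖y‖ < 1 := (div_lt_one hL).2 (by linarith [Real.log_lt_log hy0 hy.2])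
  have hrad : rad R ‖y‖ = ‖y‖ := by
    unfold rad
    rw [Real.arccos_cos (by positivity) (by nlinarith [Real.pi_pos])]
    rw [mul_div_cancel_left₀ _ Real.pi_ne_zero, qq, mul_div_cancel₀ _ hL.ne']
    rw [add_sub_cancel, Real.exp_log hy0]
  unfold Fx
  rw [hrad, div_self hy0.ne', Real.one_rpow, one_smul, indicator_of_mem (Ao_sub R hy),
    Real.sign_of_pos (Real.sin_pos_of_pos_of_lt_pi (by positivity) (by nlinarith [Real.pi_pos]))]
  ring

lemma Fx_smul {N : ℕ} {R : ℝ} (f : E N → ℝ) {ω : E N} (hω : ‖ω‖ = 1) {s : ℝ} (hs : 0 < s) :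
    Fx R f (s • ω) = Real.sign (Real.sin (π * qq R s)) *
    ((rad R s / s) ^ mm N * (Ac N R).indicator f ((rad R s) • ω)) := by
  unfold Fx
  have : ‖s • ω‖ = s := by rw [norm_smul, hω, mul_one, Real.norm_eq_abs, abs_of_pos hs]
  rw [this, smul_smul, div_mul_cancel₀ _ hs.ne']

lemma Fx_anti {N : ℕ} {R ρ : ℝ} (hR : 0 < R) (hρ : ρ = R ∨ ρ = R + 1) (f : E N → ℝ)
    (ω : E N) (hω : ‖ω‖ = 1) (s : ℝ) (hs : 0 < s) :
    Fx R f ((ρ ^ 2 * s⁻¹) • ω) = - (Fx R f (s • ω) * (s / ρ) ^ (2 * mm N)) := by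
  have hL := logL hR
  have hρ0 : 0 < ρ := by rcases hρ with h | h <;> rw [h] <;> linarith
  have hs' : 0 < ρ ^ 2 * s⁻¹ := by positivity
  have hlog : Real.log (ρ ^ 2 * s⁻¹) = 2 * Real.log ρ - Real.log s := by
    rw [Real.log_mul (by positivity) (by positivity), Real.log_inv, Real.log_pow]; push_cast; ring
  have hq : qq R (ρ ^ 2 * s⁻¹) = - qq R s ∨ qq R (ρ ^ 2 * s⁻¹) = 2 - qq R s := by
    unfold qq
    rw [hlog]
    rcases hρ with h | h
    · left; rw [h]; ring
    · right; rw [h]; field_simp; ring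
  have hsin : Real.sin (π * qq R (ρ ^ 2 * s⁻¹)) = - Real.sin (π * qq R s) := by
    rcases hq with h | h
    · rw [h, mul_neg, Real.sin_neg]
    · rw [h, show π * (2 - qq R s) = 2 * π - π * qq R s by ring, Real.sin_two_pi_sub]
  have hcos : Real.cos (π * qq R (ρ ^ 2 * s⁻¹)) = Real.cos (π * qq R s) := by
    rcases hq with h | h
    · rw [h, mul_neg, Real.cos_neg]
    · rw [h, show π * (2 - qq R s) = 2 * π - π * qq R s by ring, Real.cos_two_pi_sub]
  have hrad : rad R (ρ ^ 2 * s⁻¹) = rad R s := by unfold rad; rw [hcos]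
  rw [Fx_smul f hω hs', Fx_smul f hω hs, hrad, hsin, Real.sign_neg]
  have hr0 : 0 < rad R s := hR.trans_le (rad_mem hR s).1
  have : (rad R s / (ρ ^ 2 * s⁻¹)) ^ mm N = (rad R s / s) ^ mm N * (s / ρ) ^ (2 * mm N) := by
    rw [Real.rpow_mul (by positivity), ← Real.mul_rpow (by positivity) (by positivity)]
    congr 1
    rw [Real.rpow_two]
    field_simp
  rw [this]; ring

lemma sign_meas : Measurable Real.sign := by
  unfold Real.sign
  refine Measurable.ite measurableSet_Iio measurable_const (Measurable.ite measurableSet_Ioi measurable_const measurable_const)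

lemma sign_abs (x : ℝ) : |Real.sign x| ≤ 1 := by
  rcases Real.sign_apply_eq x with h | h | h <;> rw [h] <;> norm_num

lemma qq_meas (R : ℝ) : Measurable (qq R) := by unfold qq; fun_prop

lemma rad_meas (R : ℝ) : Measurable (rad R) := by
  unfold rad
  have := qq_meas R
  have h2 := Real.continuous_arccos.measurable
  fun_prop

lemma mm_pos (N : ℕ) : 0 < mm N := by unfold mm; positivity

lemma Fx_dec {N : ℕ} {R M : ℝ} (hR : 0 < R) {f : E N → ℝ} (hf : ContinuousOn f (Ac N R)) (hM0 : 0 ≤ M)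
    (hM : ∀ x ∈ Ac N R, |f x| ≤ M) : Dec (Fx R f) ((R + 1) ^ mm N * M) := by
  classical
  refine ⟨?_, by positivity, ?_⟩
  · have hi : Measurable ((Ac N R).indicator f) := by
      rw [← piecewise_eq_indicator]
      exact hf.measurable_piecewise continuousOn_const (Ac_closed R).measurableSet
    have h1 : Measurable fun y : E N => qq R ‖y‖ := (qq_meas R).comp measurable_norm
    have h2 : Measurable fun y : E N => rad R ‖y‖ / ‖y‖ := ((rad_meas R).comp measurable_norm).div measurable_norm
    apply Measurable.aestronglyMeasurable
    unfold Fx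
    refine (sign_meas.comp (Real.measurable_sin.comp (h1.const_mul π))).mul ((h2.pow_const _).mul ?_)
    exact hi.comp (h2.fun_smul measurable_id)
  · intro y hy
    have hy0 : 0 < ‖y‖ := norm_pos_iff.2 hy
    have hr := rad_mem hR ‖y‖
    have hr0 : 0 < rad R ‖y‖ := hR.trans_le hr.1
    unfold Fx
    have h1 : |(Ac N R).indicator f ((rad R ‖y‖ / ‖y‖) • y)| ≤ M := by
      by_cases h : (rad R ‖y‖ / ‖y‖) • y ∈ Ac N R
      · rw [indicator_of_mem h]; exact hM _ h
      · rw [indicator_of_notMem h]; simpa using hM0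
    rw [abs_mul, abs_mul, abs_of_nonneg (by positivity : 0 ≤ (rad R ‖y‖ / ‖y‖) ^ mm N)]
    calc _ ≤ 1 * (((R + 1) ^ mm N * ‖y‖ ^ (-mm N)) * M) := by
          have : (rad R ‖y‖ / ‖y‖) ^ mm N ≤ (R + 1) ^ mm N * ‖y‖ ^ (-mm N) := by
            rw [Real.div_rpow hr0.le hy0.le, Real.rpow_neg hy0.le, div_eq_mul_inv]
            have := mm_pos N
            gcongr
            exact hr.2
          gcongr
          exact sign_abs _
      _ = _ := by ring

/-- Green operator of `-Δ` -/
def G0 {N : ℕ} (R : ℝ) (f : E N → ℝ) (x : E N) : ℝ := (((N : ℝ) - 2) * sg N)⁻¹ * pot (Fx R f) x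

lemma G0_fderiv {N : ℕ} (hN : 3 ≤ N) {R M : ℝ} {f : E N → ℝ} (hF : Dec (Fx R f) M) {x : E N} (hx : x ≠ 0) :
    HasFDerivAt (G0 R f) ((((N : ℝ) - 2) * sg N)⁻¹ • vot (Fx R f) x) x :=
  (pot_hasFDerivAt hN hF hx).const_mul _

lemma exists_bd {N : ℕ} {R : ℝ} {f : E N → ℝ} (hf : ContinuousOn f (Ac N R)) :
    ∃ M, 0 ≤ M ∧ ∀ x ∈ Ac N R, |f x| ≤ M := by
  obtain ⟨M, hM⟩ := (Ac_compact R).exists_bound_of_continuousOn hf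
  exact ⟨max M 0, le_max_right _ _, fun x hx => (hM x hx).trans (le_max_left _ _)⟩

lemma G0_sol {N : ℕ} (hN : 3 ≤ N) {R : ℝ} (hR : 0 < R) {f : E N → ℝ} (hf : ContinuousOn f (Ac N R)) :
    Sol 0 R f (G0 R f) := by
  obtain ⟨M, hM0, hM⟩ := exists_bd hf
  have hD := Fx_dec hR hf hM0 hM
  have h3 := cast3 hN
  have hsg := sg_pos hN
  have hk : ((N : ℝ) - 2) * sg N ≠ 0 := by
    have : 0 < (N:ℝ) - 2 := by linarith
    positivity
  refine ⟨contDiffOn_const.mul (pot_contDiffOn hN hD), ?_, ?_⟩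
  · intro x hx
    have hx0 : 0 < ‖x‖ := by rcases hx with h | h <;> rw [h] <;> linarith
    rw [G0, pot_vanish hN hD hx0 (fun ω hω s hs => Fx_anti hR hx f ω hω s hs) rfl, mul_zero]
  · intro φ hφ
    have key := pot_weak hN hD (δ := R / 2) (B := R + 1) (by positivity) (by positivity) hφ.c1 hφ.cpt
      (fun x hx => by have := hφ.sub hx; exact ⟨by linarith [this.1], this.2.le⟩)
    have e1 : ∀ x, inner ℝ (gradient (G0 R f) x) (gradient φ x) + 0 * (G0 R f x * φ x)
        = (((N : ℝ) - 2) * sg N)⁻¹ * vot (Fx R f) x (gradient φ x) := by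
      intro x
      by_cases hx : x ∈ tsupport φ
      · have hx0 : x ≠ 0 := Ao_sub_ne hR (hφ.sub hx)
        rw [← fderiv_eq_inner, (G0_fderiv hN hD hx0).fderiv]
        simp
      · rw [grad_zero_of_not_mem hx]; simp [image_eq_zero_of_notMem_tsupport hx]
    simp_rw [e1]
    rw [integral_const_mul, key, ← mul_assoc, inv_mul_cancel₀ hk, one_mul]
    congr 1; ext x
    by_cases hx : x ∈ tsupport φ
    · rw [Fx_eq hR f (hφ.sub hx)]
    · simp [image_eq_zero_of_notMem_tsupport hx]

lemma norm_fderiv_grad {N : ℕ} (u : E N → ℝ) (x : E N) : ‖gradient u x‖ = ‖fderiv ℝ u x‖ := by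
  unfold gradient; exact LinearIsometryEquiv.norm_map _ _

lemma G0_bound {N : ℕ} (hN : 3 ≤ N) {R : ℝ} (hR : 0 < R) :
    ∃ C, 0 ≤ C ∧ ∀ (f : E N → ℝ) (M : ℝ), ContinuousOn f (Ac N R) → 0 ≤ M → (∀ x ∈ Ac N R, |f x| ≤ M) →
      ∀ x : E N, R / 2 ≤ ‖x‖ → ‖x‖ ≤ 2 * R + 2 → |G0 R f x| ≤ C * M ∧ ‖gradient (G0 R f) x‖ ≤ C * M := by
  have h3 := cast3 hN
  have hsg := sg_pos hN
  have hk : 0 < ((N : ℝ) - 2) * sg N := by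
    have : 0 < (N:ℝ) - 2 := by linarith
    positivity
  obtain ⟨C, hC, h⟩ := pot_bound hN (δ := R / 4) (B := 2 * R + 2) (by positivity) (by positivity)
  refine ⟨(((N : ℝ) - 2) * sg N)⁻¹ * C * (R + 1) ^ mm N, by positivity, ?_⟩
  intro f M hf hM0 hM x hx hx2
  have hD := Fx_dec hR hf hM0 hM
  have hx0 : x ≠ 0 := norm_pos_iff.1 (by linarith)
  obtain ⟨h1, h2⟩ := h _ _ hD x (by linarith) hx2
  constructor
  · rw [G0, abs_mul, abs_of_pos (inv_pos.2 hk)]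
    calc _ ≤ (((N : ℝ) - 2) * sg N)⁻¹ * (C * ((R + 1) ^ mm N * M)) := by gcongr
      _ = _ := by ring
  · rw [norm_fderiv_grad, (G0_fderiv hN hD hx0).fderiv, norm_smul, Real.norm_eq_abs, abs_of_pos (inv_pos.2 hk)]
    calc _ ≤ (((N : ℝ) - 2) * sg N)⁻¹ * (C * ((R + 1) ^ mm N * M)) := by gcongr
      _ = _ := by ring

/-- solvability of `-Δu + u = f` -/
lemma exists_sol {N : ℕ} (hN : 3 ≤ N) {R : ℝ} (hR : 2 * N ≤ R) :
    ∃ C, 0 ≤ C ∧ ∀ (f : E N → ℝ), ContinuousOn f (Ac N R) → ∃ u, Sol 1 R f u ∧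
      ∀ M, 0 ≤ M → (∀ x ∈ Ac N R, |f x| ≤ M) →
      ∀ x : E N, R / 2 ≤ ‖x‖ → ‖x‖ ≤ 2 * R + 2 → |u x| ≤ C * M ∧ ‖gradient u x‖ ≤ C * M := by
  classical
  have h3 := cast3 hN
  have hR0 : 0 < R := by linarith
  obtain ⟨C, hC, hb⟩ := G0_bound hN hR0
  refine ⟨C * 2, by positivity, ?_⟩
  intro f hf
  have : CompactSpace (Ac N R) := isCompact_iff_compactSpace.1 (Ac_compact R)
  -- extension of functions on the compact annulus
  let ex : C(Ac N R, ℝ) → E N → ℝ := fun h x => if hx : x ∈ Ac N R then h ⟨x, hx⟩ else 0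
  have ex_val : ∀ h (x : Ac N R), ex h x = h x := by intro h x; simp [ex]
  have ex_cont : ∀ h, ContinuousOn (ex h) (Ac N R) := by
    intro h
    rw [continuousOn_iff_continuous_domRestrict]
    refine h.continuous.congr fun x => ?_
    rw [domRestrict_apply, ex_val]
  have cG : ∀ h, ContinuousOn (fun x => f x - G0 R (ex h) x) (Ac N R) := fun h =>
    hf.sub ((G0_sol hN hR0 (ex_cont h)).contA hR0)
  let T : C(Ac N R, ℝ) → C(Ac N R, ℝ) := fun h => ⟨(Ac N R).domRestrict (fun x => f x - G0 R (ex h) x), (cG h).domRestrict⟩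
  have hT : ContractingWith (1/2) T := by
    refine ⟨by rw [← NNReal.coe_lt_coe]; norm_num, LipschitzWith.of_dist_le_mul fun h k => ?_⟩
    rw [ContinuousMap.dist_le (by positivity)]
    intro x
    have hs := (G0_sol hN hR0 (ex_cont h)).lin hR0 (G0_sol hN hR0 (ex_cont k)) (ex_cont h) (ex_cont k) 1 (-1)
    have := hs.bound hN hR ((continuousOn_const.mul (ex_cont h)).add (continuousOn_const.mul (ex_cont k)))
      (M := dist h k) ?_ x x.2
    · rw [Real.dist_eq]
      have eT : ∀ h, T h x = f x - G0 R (ex h) x := fun h => rfl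
      rw [eT, eT]
      rw [show (f x - G0 R (ex h) x - (f x - G0 R (ex k) x)) = -(1 * G0 R (ex h) x + (-1) * G0 R (ex k) x) by ring, abs_neg]
      refine this.trans (le_of_eq ?_)
      simp; ring
    · intro y hy
      have := ContinuousMap.dist_apply_le_dist (f := h) (g := k) (⟨y, hy⟩ : Ac N R)
      rw [Real.dist_eq] at this
      have e1 := ex_val h ⟨y, hy⟩
      have e2 := ex_val k ⟨y, hy⟩
      simp only at e1 e2
      rw [e1, e2]
      convert this using 2; ring
  set h := ContractingWith.fixedPoint T hT
  have hfix : T h = h := ContractingWith.fixedPoint_isFixedPt hT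
  have heq : ∀ x ∈ Ac N R, ex h x = f x - G0 R (ex h) x := by
    intro x hx
    have : (T h) ⟨x, hx⟩ = h ⟨x, hx⟩ := by rw [hfix]
    rw [← ex_val h ⟨x, hx⟩] at this
    exact this.symm
  have hG := G0_sol hN hR0 (ex_cont h)
  refine ⟨G0 R (ex h), ⟨hG.c1, hG.bc, ?_⟩, ?_⟩
  · intro φ hφ
    have h1 := hG.weak φ hφ
    have i1 := integrable_pair (Ao_open R) (hG.c1A hR0) hφ
    have i2 := integrable_mul_test (hG.c1A hR0).continuousOn hφ
    simp only [zero_mul, add_zero] at h1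
    simp only [one_mul]
    rw [integral_add i1 i2, h1, ← integral_add (integrable_mul_test ((ex_cont h).mono (Ao_sub R)) hφ) i2]
    congr 1; ext x
    by_cases hx : x ∈ tsupport φ
    · rw [heq x (Ao_sub R (hφ.sub hx))]; ring
    · simp [image_eq_zero_of_notMem_tsupport hx]
  · intro M hM0 hM x hx hx2
    have hnorm : ∀ y ∈ Ac N R, |ex h y| ≤ 2 * M := by
      have hb1 : ∀ y ∈ Ac N R, |ex h y| ≤ ‖h‖ := by
        intro y hy
        have := h.norm_coe_le_norm ⟨y, hy⟩
        rwa [← ex_val h ⟨y, hy⟩] at this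
      have hb2 := hG.bound hN hR (ex_cont h) hb1
      have : ‖h‖ ≤ M + ‖h‖ / 2 := by
        rw [ContinuousMap.norm_le _ (by positivity)]
        intro y
        rw [← ex_val h y, heq y y.2, Real.norm_eq_abs]
        exact (abs_sub _ _).trans (add_le_add (hM y y.2) (hb2 y y.2))
      intro y hy
      have := hb1 y hy
      linarith
    have := hb (ex h) (2 * M) (ex_cont h) (by positivity) hnorm x hx hx2
    rwa [mul_assoc]

end Ann
end
end

section
open MeasureTheory Real Set
open scoped ENNReal NNReal Topology
noncomputable section
namespace Ann

def eN (N : ℕ) : E N := if h : 0 < N then EuclideanSpace.single ⟨N - 1, by omega⟩ 1 else 0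

lemma lastCoord_eq {N : ℕ} (x : E N) : lastCoord x = inner ℝ (eN N) x := by
  unfold lastCoord eN
  split_ifs with h
  · simp [EuclideanSpace.inner_single_left]
  · simp

lemma eN_norm {N : ℕ} (hN : 3 ≤ N) : ‖eN N‖ = 1 := by
  unfold eN
  rw [dif_pos (by omega)]
  simp

lemma lastCoord_le {N : ℕ} (hN : 3 ≤ N) (x : E N) : |lastCoord x| ≤ ‖x‖ := by
  rw [lastCoord_eq]
  have := abs_real_inner_le_norm (eN N) x
  rwa [eN_norm hN, one_mul] at this

lemma lastCoord_cont {N : ℕ} : Continuous (lastCoord : E N → ℝ) := by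
  have : (lastCoord : E N → ℝ) = fun x => inner ℝ (eN N) x := by ext x; exact lastCoord_eq x
  rw [this]; exact continuous_const.inner continuous_id

lemma lastCoord_smul {N : ℕ} (a : ℝ) (x : E N) : lastCoord (a • x) = a * lastCoord x := by
  rw [lastCoord_eq, lastCoord_eq, real_inner_smul_right]

/-- the cone -/
structure Cone {N : ℕ} (R : ℝ) (f : E N → ℝ) : Prop where
  cont : ContinuousOn f (Ac N R)
  nn : ∀ x ∈ Ac N R, 0 ≤ f x
  mono : ∀ x ∈ Ac N R, ∀ y ∈ Ac N R, ‖x‖ = ‖y‖ → |lastCoord x| ≤ |lastCoord y| → f y ≤ f x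

def Rf {N : ℕ} (n : E N) : E N ≃ₗᵢ[ℝ] E N := (ℝ ∙ n)ᗮ.reflection

lemma Rf_apply {N : ℕ} (n z : E N) : Rf n z = z - (2 * (inner ℝ n z / ‖n‖ ^ 2)) • n := by
  unfold Rf
  rw [Submodule.reflection_orthogonal_apply, Submodule.reflection_singleton_apply]
  simp [mul_smul, two_smul]

lemma Rf_swap {N : ℕ} {x y : E N} (h : ‖x‖ = ‖y‖) : Rf (x - y) x = y := Submodule.reflection_sub h

lemma Rf_last {N : ℕ} (n z : E N) :
    lastCoord (Rf n z) = lastCoord z - (2 * (inner ℝ n z / ‖n‖ ^ 2)) * lastCoord n := by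
  rw [lastCoord_eq, lastCoord_eq, lastCoord_eq, Rf_apply, inner_sub_right, real_inner_smul_right]

lemma Ac_iso {N : ℕ} {R : ℝ} (σ : E N ≃ₗᵢ[ℝ] E N) {x : E N} (hx : x ∈ Ac N R) : σ x ∈ Ac N R := by
  unfold Ac at *; simpa using hx

lemma grad_iso {N : ℕ} (σ : E N ≃ₗᵢ[ℝ] E N) (u : E N → ℝ) (x v : E N) :
    inner ℝ (gradient (fun x => u (σ x)) x) v = inner ℝ (gradient u (σ x)) (σ v) := by
  rw [← fderiv_eq_inner, ← fderiv_eq_inner]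
  have := σ.toContinuousLinearEquiv.comp_right_fderiv (f := u) (x := x)
  have h2 : fderiv ℝ (fun x => u (σ x)) x = (fderiv ℝ u (σ x)).comp (σ.toContinuousLinearEquiv : E N →L[ℝ] E N) := this
  rw [h2]; rfl

lemma grad_iso' {N : ℕ} (σ : E N ≃ₗᵢ[ℝ] E N) (φ : E N → ℝ) (x : E N) :
    gradient (fun x => φ (σ.symm x)) (σ x) = σ (gradient φ x) := by
  apply ext_inner_right ℝ
  intro v
  rw [grad_iso σ.symm φ (σ x) v, σ.symm_apply_apply]
  rw [← σ.inner_map_map, σ.apply_symm_apply]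

lemma Sol.iso {N : ℕ} {c R : ℝ} {f u : E N → ℝ} (hu : Sol c R f u) (σ : E N ≃ₗᵢ[ℝ] E N) :
    Sol c R (fun x => f (σ x)) (fun x => u (σ x)) := by
  refine ⟨?_, ?_, ?_⟩
  · refine hu.c1.comp σ.contDiff.contDiffOn ?_
    intro x hx
    simpa using hx
  · intro x hx; exact hu.bc _ (by simpa using hx)
  · intro φ hφ
    have hφ' : Test (Ao N R) (fun x => φ (σ.symm x)) := by
      refine ⟨hφ.c1.comp σ.symm.contDiff, ?_, ?_⟩
      · exact hφ.cpt.comp_homeomorph σ.symm.toHomeomorph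
      · intro x hx
        have h1 : σ.symm x ∈ tsupport φ := by
          exact (tsupport_comp_subset_preimage φ σ.symm.continuous) hx
        have := hφ.sub h1
        have e : ‖σ.symm x‖ = ‖x‖ := σ.symm.norm_map x
        exact ⟨e ▸ this.1, e ▸ this.2⟩
    have h1 := hu.weak _ hφ'
    have mp : ∀ g : E N → ℝ, ∫ x, g x = ∫ x, g (σ x) := fun g =>
      (σ.measurePreserving.integral_comp' (f := σ.toMeasurableEquiv) g).symm
    rw [mp, mp (fun x => f x * φ (σ.symm x))] at h1
    simp only [grad_iso', σ.symm_apply_apply] at h1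
    rw [← h1]
    congr 1; ext x
    rw [grad_iso]

lemma Sol.symm1 {N : ℕ} (hN : 3 ≤ N) {c R : ℝ} {f u : E N → ℝ} (hR : 0 < R) (hc : 0 ≤ c) (hf : Cone R f) (hu : Sol c R f u)
    (σ : E N ≃ₗᵢ[ℝ] E N) (hσ : ∀ z, |lastCoord (σ z)| = |lastCoord z|) : ∀ x ∈ Ac N R, u (σ x) = u x := by
  refine (hu.iso σ).unique hN hR hc hu ?_ hf.cont ?_
  · exact hf.cont.comp σ.continuous.continuousOn fun x hx => Ac_iso σ hx
  · intro x hx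
    have h1 := Ao_sub R hx
    have h2 := Ac_iso σ h1
    exact le_antisymm (hf.mono _ h1 _ h2 (by simp) (hσ x).ge) (hf.mono _ h2 _ h1 (by simp) (hσ x).le)

lemma Sol.symm2 {N : ℕ} (hN : 3 ≤ N) {c R : ℝ} {f u : E N → ℝ} (hR : 0 < R) (hc : 0 ≤ c) (hf : Cone R f) (hu : Sol c R f u)
    {x y : E N} (hx : x ∈ Ac N R) (hxy : ‖x‖ = ‖y‖) (hl : |lastCoord x| = |lastCoord y|) : u x = u y := by
  have key : ∀ x ∈ Ac N R, ∀ y, ‖x‖ = ‖y‖ → lastCoord x = lastCoord y → u y = u x := by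
    intro x hx y hxy hl
    have h := hu.symm1 hN hR hc hf (Rf (x - y)) (fun z => ?_) x hx
    · rwa [Rf_swap hxy] at h
    · rw [Rf_last]
      have : lastCoord (x - y) = 0 := by
        rw [lastCoord_eq, inner_sub_right, ← lastCoord_eq, ← lastCoord_eq, hl, sub_self]
      rw [this]; simp
  have hρ : ∀ z : E N, lastCoord (Rf (eN N) z) = - lastCoord z := by
    intro z
    rw [Rf_last, eN_norm hN, ← lastCoord_eq]
    have : lastCoord (eN N) = 1 := by rw [lastCoord_eq, real_inner_self_eq_norm_sq, eN_norm hN]; norm_num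
    rw [this]; ring
  rcases abs_eq_abs.1 hl with h | h
  · exact (key x hx y hxy h).symm
  · have h1 := hu.symm1 hN hR hc hf (Rf (eN N)) (fun z => by rw [hρ, abs_neg]) x hx
    have h2 := key (Rf (eN N) x) (Ac_iso _ hx) y (by simpa using hxy) (by rw [hρ, h, neg_neg])
    rw [h2, h1]

lemma Sol.polar1 {N : ℕ} (hN : 3 ≤ N) {c R : ℝ} {f u : E N → ℝ} (hR : 0 < R) (hc : 0 ≤ c) (hf : Cone R f) (hu : Sol c R f u)
    {x y : E N} (hx : x ∈ Ac N R) (hxy : ‖x‖ = ‖y‖) (hl0 : 0 ≤ lastCoord x) (hl : lastCoord x ≤ lastCoord y) : u y ≤ u x := by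
  have hy : y ∈ Ac N R := by unfold Ac at *; simpa [← hxy] using hx
  by_cases hyo : y ∈ Ao N R
  swap
  · have h1 := Ac_not_Ao hy hyo
    rw [hu.bc y h1, hu.bc x (by rw [hxy]; exact h1)]
  rcases (hl0.trans hl).eq_or_lt with h0 | hpos
  · exact (hu.symm2 hN hR hc hf hx hxy (by rw [← h0, le_antisymm (h0 ▸ hl) hl0])).ge
  by_cases hne : x = y
  · rw [hne]
  set n := y - x with hn
  have hn0 : 0 < ‖n‖ := norm_pos_iff.2 (sub_ne_zero.2 (Ne.symm hne))
  have hnl : 0 ≤ lastCoord n := by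
    rw [lastCoord_eq, hn, inner_sub_right, ← lastCoord_eq, ← lastCoord_eq]; linarith
  set Ω : Set (E N) := Ao N R ∩ {z | 0 < inner ℝ n z} ∩ {z | 0 < lastCoord z - inner ℝ n z / ‖n‖ ^ 2 * lastCoord n} with hΩ
  have ci : Continuous fun z : E N => inner ℝ n z := continuous_const.inner continuous_id
  have cl : Continuous fun z : E N => lastCoord z - inner ℝ n z / ‖n‖ ^ 2 * lastCoord n :=
    lastCoord_cont.sub ((ci.div_const _).mul_const _)
  have hΩo : IsOpen Ω := ((Ao_open R).inter (isOpen_lt continuous_const ci)).inter (isOpen_lt continuous_const cl)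
  have hΩA : Ω ⊆ Ao N R := fun z hz => hz.1.1
  have hcl : closure Ω ⊆ Ac N R ∩ {z | 0 ≤ inner ℝ n z} ∩ {z | 0 ≤ lastCoord z - inner ℝ n z / ‖n‖ ^ 2 * lastCoord n} := by
    apply closure_minimal
    · intro z hz
      exact ⟨⟨Ao_sub R hz.1.1, (le_of_lt hz.1.2 : (0:ℝ) ≤ _)⟩, (le_of_lt hz.2 : (0:ℝ) ≤ _)⟩
    · exact ((Ac_closed R).inter (isClosed_le continuous_const ci)).inter (isClosed_le continuous_const cl)
  have hfs : ContinuousOn (fun x => f (Rf n x)) (Ac N R) :=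
    hf.cont.comp (Rf n).continuous.continuousOn fun x hx => Ac_iso _ hx
  have hw := (hu.iso (Rf n)).lin hR hu hfs hf.cont 1 (-1)
  have := wmp hN hΩo ((Ao_bounded R).subset hΩA) hc ((hw.c1A hR).mono hΩA)
    ((hw.contA hR).mono fun z hz => (hcl hz).1.1) ?_ ?_ y ?_
  · have h1 : Rf n y = x := Rf_swap hxy.symm
    rw [h1] at this
    linarith
  · intro z hz hzΩ
    obtain ⟨⟨h1, h2⟩, h3⟩ := hcl hz
    by_cases hzo : z ∈ Ao N R
    swap
    · rw [hw.bc z (Ac_not_Ao h1 hzo)]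
    rcases (show 0 ≤ inner ℝ n z from h2).eq_or_lt with h4 | h4
    · have : Rf n z = z := by rw [Rf_apply, ← h4]; simp
      rw [this]; simp
    rcases (show 0 ≤ lastCoord z - inner ℝ n z / ‖n‖ ^ 2 * lastCoord n from h3).eq_or_lt with h5 | h5
    · have : u (Rf n z) = u z := by
        apply hu.symm2 hN hR hc hf (Ac_iso _ h1) (by simp)
        rw [Rf_last, abs_eq_abs]
        right; linarith
      rw [this]; simp
    · exact absurd ⟨⟨hzo, h4⟩, h5⟩ hzΩ
  · intro φ hφ hφ0
    rw [hw.weak φ ⟨hφ.c1, hφ.cpt, hφ.sub.trans hΩA⟩]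
    refine integral_mul_test_nonneg hφ hφ0 ?_
    rintro z ⟨⟨hz1, hz2⟩, hz3⟩
    have hz2 : 0 < inner ℝ n z := hz2
    have hz3 : 0 < lastCoord z - inner ℝ n z / ‖n‖ ^ 2 * lastCoord n := hz3
    have := hf.mono _ (Ac_iso (Rf n) (Ao_sub R hz1)) _ (Ao_sub R hz1) (by simp) ?_
    · linarith
    · rw [← sq_le_sq, Rf_last]
      have h6 : 0 ≤ inner ℝ n z / ‖n‖ ^ 2 * lastCoord n := by positivity
      nlinarith
  · apply subset_closure
    have e1 : inner ℝ n y = ‖n‖ ^ 2 / 2 := by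
      rw [hn, inner_sub_left, real_inner_self_eq_norm_sq, @norm_sub_sq_real, hxy, real_inner_comm]; ring
    refine ⟨⟨hyo, ?_⟩, ?_⟩
    · show 0 < inner ℝ n y
      rw [e1]; positivity
    · show 0 < lastCoord y - inner ℝ n y / ‖n‖ ^ 2 * lastCoord n
      have e2 : inner ℝ n y / ‖n‖ ^ 2 = 1 / 2 := by rw [e1]; field_simp
      rw [e2, show lastCoord n = lastCoord y - lastCoord x by
        rw [lastCoord_eq, hn, inner_sub_right, ← lastCoord_eq, ← lastCoord_eq]]
      linarith

/-- the solution operator preserves the cone -/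
lemma Sol.cone {N : ℕ} (hN : 3 ≤ N) {c R : ℝ} {f u : E N → ℝ} (hR : 0 < R) (hc : 0 ≤ c) (hf : Cone R f) (hu : Sol c R f u) :
    Cone R u := by
  refine ⟨hu.contA hR, hu.nonneg hN hR hc fun x hx => hf.nn x (Ao_sub R hx), ?_⟩
  have hρ : ∀ z : E N, ∃ z' : E N, ‖z'‖ = ‖z‖ ∧ lastCoord z' = |lastCoord z| := by
    intro z
    rcases abs_choice (lastCoord z) with h | h
    · exact ⟨z, rfl, h.symm⟩
    · refine ⟨-z, norm_neg z, ?_⟩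
      rw [h, lastCoord_eq, lastCoord_eq, inner_neg_right]
  intro x hx y hy hxy hl
  obtain ⟨x', hx1, hx2⟩ := hρ x
  obtain ⟨y', hy1, hy2⟩ := hρ y
  rw [hu.symm2 hN hR hc hf hx hx1.symm (by rw [hx2, abs_abs]), hu.symm2 hN hR hc hf hy hy1.symm (by rw [hy2, abs_abs])]
  refine hu.polar1 hN hR hc hf ?_ (by rw [hx1, hy1, hxy]) (by rw [hx2]; positivity) (by rw [hx2, hy2]; exact hl)
  unfold Ac at *; simpa [hx1] using hx

end Ann
end
end

section
open MeasureTheory Real Set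
open scoped ENNReal NNReal Topology
noncomputable section
namespace Ann

/-- cut-off nonlinearity -/
def hc (ε t : ℝ) : ℝ := (max (t - ε) 0) ^ 2 * t / (t ^ 2 + ε ^ 2)
def hc' (ε t : ℝ) : ℝ :=
  ((2 * max (t - ε) 0 * t + (max (t - ε) 0) ^ 2) * (t ^ 2 + ε ^ 2) - (max (t - ε) 0) ^ 2 * t * (2 * t)) / (t ^ 2 + ε ^ 2) ^ 2

lemma hc_deriv {ε : ℝ} (hε : 0 < ε) (t : ℝ) : HasDerivAt (hc ε) (hc' ε t) t := by
  have h1 : HasDerivAt (fun t => (max (t - ε) 0) ^ 2) (2 * max (t - ε) 0) t := by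
    have := (hasDerivAt_maxsq (t - ε)).comp t ((hasDerivAt_id t).sub_const ε)
    rw [mul_one] at this
    exact this
  have h2 := h1.mul (hasDerivAt_id t)
  have h3 : HasDerivAt (fun t : ℝ => t ^ 2 + ε ^ 2) (2 * t) t := by
    simpa using (hasDerivAt_pow 2 t).add_const (ε ^ 2)
  have := h2.div h3 (by positivity)
  refine this.congr_deriv ?_
  simp [hc']

lemma hc_c1 {ε : ℝ} (hε : 0 < ε) : ContDiff ℝ 1 (hc ε) := by
  rw [contDiff_one_iff_deriv]
  refine ⟨fun s => (hc_deriv hε s).differentiableAt, ?_⟩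
  have : deriv (hc ε) = hc' ε := by ext s; exact (hc_deriv hε s).deriv
  rw [this]
  unfold hc'
  refine Continuous.div (by fun_prop) (by fun_prop) fun t => by positivity

lemma hc_zero {ε t : ℝ} (h : t ≤ ε) : hc ε t = 0 := by
  unfold hc; rw [max_eq_right (by linarith)]; simp

lemma hc'_cont {ε : ℝ} (hε : 0 < ε) : Continuous (hc' ε) := by
  unfold hc'
  refine Continuous.div (by fun_prop) (by fun_prop) fun t => by positivity

lemma max_le_t {ε t : ℝ} (hε : 0 < ε) (ht : 0 ≤ t) : max (t - ε) 0 ≤ t := max_le (by linarith) ht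

lemma hc_bd {ε t : ℝ} (hε : 0 < ε) (ht : 0 ≤ t) : |hc ε t| ≤ t := by
  have h0 : 0 ≤ max (t - ε) 0 := le_max_right _ _
  have h1 := max_le_t hε ht
  unfold hc
  rw [abs_of_nonneg (by positivity), div_le_iff₀ (by positivity)]
  have : (max (t - ε) 0) ^ 2 ≤ t ^ 2 := by gcongr
  nlinarith [mul_le_mul_of_nonneg_right this ht, mul_nonneg ht (sq_nonneg ε)]

lemma hc'_bd {ε t : ℝ} (hε : 0 < ε) (ht : 0 ≤ t) : |hc' ε t| ≤ 5 := by
  have h0 : 0 ≤ max (t - ε) 0 := le_max_right _ _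
  have h1 := max_le_t hε ht
  unfold hc'
  set m := max (t - ε) 0
  have hm : m ^ 2 ≤ t ^ 2 := by gcongr
  have hmt : m * t ≤ t ^ 2 := by nlinarith
  have hmt0 : 0 ≤ m * t := by positivity
  set d := t ^ 2 + ε ^ 2 with hd
  have hd0 : 0 < d := by positivity
  have htd : t ^ 2 ≤ d := by rw [hd]; nlinarith
  have k1 : (2 * m * t + m ^ 2) * d ≤ 3 * d ^ 2 := by nlinarith
  have k2 : m ^ 2 * t * (2 * t) ≤ 2 * d ^ 2 := by
    calc m ^ 2 * t * (2 * t) = 2 * (m ^ 2 * t ^ 2) := by ring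
      _ ≤ 2 * (d * d) := by gcongr; exact hm.trans htd
      _ = _ := by ring
  have k3 : 0 ≤ (2 * m * t + m ^ 2) * d := by positivity
  have k4 : 0 ≤ m ^ 2 * t * (2 * t) := by positivity
  rw [abs_le, le_div_iff₀ (by positivity), div_le_iff₀ (by positivity)]
  constructor <;> nlinarith

lemma hc_lim {t : ℝ} (ht : 0 < t) {e : ℕ → ℝ} (he : Filter.Tendsto e Filter.atTop (𝓝 0)) :
    Filter.Tendsto (fun n => hc (e n) t) Filter.atTop (𝓝 t) ∧
    Filter.Tendsto (fun n => hc' (e n) t) Filter.atTop (𝓝 1) := by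
  have h1 : ContinuousAt (fun ε => hc ε t) 0 := by
    unfold hc
    refine ContinuousAt.div (by fun_prop) (by fun_prop) (by positivity)
  have h2 : ContinuousAt (fun ε => hc' ε t) 0 := by
    unfold hc'
    refine ContinuousAt.div (by fun_prop) (by fun_prop) (by positivity)
  have e1 : hc 0 t = t := by unfold hc; rw [max_eq_left (by linarith)]; field_simp; ring
  have e2 : hc' 0 t = 1 := by unfold hc'; rw [max_eq_left (by linarith)]; field_simp; ring
  constructor
  · have := h1.tendsto.comp he; rwa [e1] at this
  · have := h2.tendsto.comp he; rwa [e2] at this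

lemma contOn_ne_Ac {N : ℕ} {R : ℝ} (hR : 0 < R) {u : E N → ℝ} (h : ContDiffOn ℝ 1 u {x | x ≠ 0}) :
    ContinuousOn u (Ac N R) ∧ ContinuousOn (gradient u) (Ac N R) := by
  have hs : Ac N R ⊆ {x : E N | x ≠ 0} := fun x hx => Ac_ne hR hx
  exact ⟨h.continuousOn.mono hs, (grad_contOn isOpen_ne h).mono hs⟩

/-- the truncation is a test function -/
lemma cut_test {N : ℕ} {R : ℝ} (hR : 0 < R) {v : E N → ℝ} (hv : ContDiffOn ℝ 1 v {x | x ≠ 0})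
    (hv0 : ∀ x, (‖x‖ = R ∨ ‖x‖ = R + 1) → v x = 0) {ε : ℝ} (hε : 0 < ε) :
    Test (Ao N R) ((Ao N R).indicator fun x => hc ε (v x)) := by
  set φ := (Ao N R).indicator fun x => hc ε (v x) with hφ
  set Kc := Ac N R ∩ v ⁻¹' (Ici ε) with hK
  have hKc : IsCompact Kc := by
    apply (Ac_compact R).of_isClosed_subset ?_ inter_subset_left
    exact (contOn_ne_Ac hR hv).1.preimage_isClosed_of_isClosed (Ac_closed R) isClosed_Ici
  have hKA : Kc ⊆ Ao N R := by
    rintro x ⟨h1, h2⟩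
    by_contra h
    have := hv0 x (Ac_not_Ao h1 h)
    simp only [mem_preimage, mem_Ici] at h2
    linarith
  have h0 : ∀ x, x ∉ Kc → φ x = 0 := by
    intro x hx
    by_cases hxA : x ∈ Ao N R
    · rw [hφ, indicator_of_mem hxA]
      apply hc_zero
      by_contra h
      exact hx ⟨Ao_sub R hxA, le_of_lt (not_le.1 h)⟩
    · rw [hφ, indicator_of_notMem hxA]
  have hts : tsupport φ ⊆ Kc := by
    apply closure_minimal ?_ hKc.isClosed
    intro x hx
    by_contra h
    exact hx (h0 x h)
  refine ⟨?_, HasCompactSupport.of_support_subset_isCompact hKc (subset_closure.trans hts), hts.trans hKA⟩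
  rw [contDiff_iff_contDiffAt]
  intro x
  by_cases hx : x ∈ Kc
  · have hxA := (Ao_open R).mem_nhds (hKA hx)
    have : ContDiffAt ℝ 1 (fun x => hc ε (v x)) x :=
      (hc_c1 hε).contDiffAt.comp x ((hv.mono (Ao_sub_ne hR)).contDiffAt hxA)
    refine this.congr_of_eventuallyEq ?_
    filter_upwards [hxA] with y hy
    rw [hφ, indicator_of_mem hy]
  · have : ContDiffAt ℝ 1 (fun _ : E N => (0:ℝ)) x := contDiffAt_const
    refine this.congr_of_eventuallyEq ?_
    filter_upwards [hKc.isClosed.isOpen_compl.mem_nhds hx] with y hy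
    exact h0 y hy

/-- testing the equation with `v ≥ 0`, `v = 0` on the boundary -/
lemma Sol.test_nonneg {N : ℕ} {c R : ℝ} (hR : 0 < R) {f u v : E N → ℝ} (hu : Sol c R f u)
    (hf : ContinuousOn f (Ac N R)) (hv : ContDiffOn ℝ 1 v {x | x ≠ 0})
    (hv0 : ∀ x, (‖x‖ = R ∨ ‖x‖ = R + 1) → v x = 0) (hvn : ∀ x ∈ Ac N R, 0 ≤ v x) :
    ∫ x in Ao N R, (inner ℝ (gradient u x) (gradient v x) + c * (u x * v x)) = ∫ x in Ao N R, f x * v x := by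
  obtain ⟨cu, cgu⟩ := contOn_ne_Ac hR hu.c1
  obtain ⟨cv, cgv⟩ := contOn_ne_Ac hR hv
  set e : ℕ → ℝ := fun n => 1 / ((n : ℝ) + 1) with he
  have hepos : ∀ n, 0 < e n := fun n => by rw [he]; positivity
  have helim : Filter.Tendsto e Filter.atTop (𝓝 0) := tendsto_one_div_add_atTop_nhds_zero_nat
  have hA := (Ao_open (N := N) R).measurableSet
  have key : ∀ n, ∫ x in Ao N R, (inner ℝ (gradient u x) (hc' (e n) (v x) • gradient v x) + c * (u x * hc (e n) (v x)))
      = ∫ x in Ao N R, f x * hc (e n) (v x) := by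
    intro n
    have ht := cut_test hR hv hv0 (hepos n)
    have h := hu.weak _ ht
    rw [← setIntegral_eq_integral_of_forall_compl_eq_zero (s := Ao N R),
      ← setIntegral_eq_integral_of_forall_compl_eq_zero (s := Ao N R) (f := fun x => f x * _)] at h
    · have e3 : ∫ x in Ao N R, f x * (Ao N R).indicator (fun x => hc (e n) (v x)) x = ∫ x in Ao N R, f x * hc (e n) (v x) := by
        refine setIntegral_congr_fun hA fun x hx => ?_
        simp only [indicator_of_mem hx]
      · rw [← e3, ← h]
        refine setIntegral_congr_fun hA fun x hx => ?_
        have hxA := (Ao_open R).mem_nhds hx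
        have e1 : gradient ((Ao N R).indicator fun x => hc (e n) (v x)) x = hc' (e n) (v x) • gradient v x := by
          rw [← grad_comp (((hv.mono (Ao_sub_ne hR)).contDiffAt hxA).differentiableAt one_ne_zero) (hc_deriv (hepos n) (v x))]
          unfold gradient
          congr 1
          apply Filter.EventuallyEq.fderiv_eq
          filter_upwards [hxA] with y hy
          rw [indicator_of_mem hy]
        simp only [e1, indicator_of_mem hx]
    · intro x hx
      rw [indicator_of_notMem hx, mul_zero]
    · intro x hx
      rw [indicator_of_notMem hx, grad_zero_of_not_mem fun h => hx (ht.sub h)]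
      simp
  have hfin : volume (Ao N R) < ⊤ := (Ao_bounded R).measure_lt_top
  have hfin' : IsFiniteMeasure (volume.restrict (Ao N R)) := ⟨by simpa using hfin⟩
  obtain ⟨Mf, hMf⟩ := (Ac_compact R).exists_bound_of_continuousOn hf
  obtain ⟨Mu, hMu⟩ := (Ac_compact R).exists_bound_of_continuousOn cu
  obtain ⟨Mv, hMv⟩ := (Ac_compact R).exists_bound_of_continuousOn cv
  obtain ⟨Mgu, hMgu⟩ := (Ac_compact R).exists_bound_of_continuousOn cgu
  obtain ⟨Mgv, hMgv⟩ := (Ac_compact R).exists_bound_of_continuousOn cgv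
  have ptw : ∀ x ∈ Ao N R, Filter.Tendsto (fun n => hc (e n) (v x)) Filter.atTop (𝓝 (v x)) ∧
      Filter.Tendsto (fun n => hc' (e n) (v x) • gradient v x) Filter.atTop (𝓝 (gradient v x)) := by
    intro x hx
    rcases (hvn x (Ao_sub R hx)).eq_or_lt with h | h
    · have hmin : IsLocalMin v x := by
        filter_upwards [(Ao_open R).mem_nhds hx] with y hy
        rw [← h]; exact hvn y (Ao_sub R hy)
      have : gradient v x = 0 := by unfold gradient; rw [hmin.fderiv_eq_zero, map_zero]
      rw [this, ← h]
      constructor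
      · refine tendsto_const_nhds.congr fun n => ?_
        rw [hc_zero (hepos n).le]
      · simp
    · obtain ⟨h1, h2⟩ := hc_lim h helim
      refine ⟨h1, ?_⟩
      have := h2.smul_const (gradient v x)
      rwa [one_smul] at this
  have L1 : Filter.Tendsto (fun n => ∫ x in Ao N R, (inner ℝ (gradient u x) (hc' (e n) (v x) • gradient v x) + c * (u x * hc (e n) (v x))))
      Filter.atTop (𝓝 (∫ x in Ao N R, (inner ℝ (gradient u x) (gradient v x) + c * (u x * v x)))) := by
    refine tendsto_integral_of_dominated_convergence (fun _ => Mgu * (5 * Mgv) + |c| * (Mu * Mv)) ?_ (integrable_const _) ?_ ?_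
    · intro n
      apply ContinuousOn.aestronglyMeasurable ?_ hA
      have c1 : ContinuousOn (fun x => hc' (e n) (v x)) (Ao N R) := (hc'_cont (hepos n)).comp_continuousOn (cv.mono (Ao_sub R))
      have c2 : ContinuousOn (fun x => hc (e n) (v x)) (Ao N R) := (hc_c1 (hepos n)).continuous.comp_continuousOn (cv.mono (Ao_sub R))
      exact ((cgu.mono (Ao_sub R)).inner (c1.smul (cgv.mono (Ao_sub R)))).add
        (continuousOn_const.mul ((cu.mono (Ao_sub R)).mul c2))
    · intro n
      filter_upwards [ae_restrict_mem hA] with x hx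
      have hx' := Ao_sub R hx
      have b1 := hc_bd (hepos n) (hvn x hx')
      have b2 := hc'_bd (hepos n) (hvn x hx')
      have b3 := hMgu x hx'
      have b4 := hMgv x hx'
      have b5 := hMu x hx'
      have b6 := hMv x hx'
      rw [Real.norm_eq_abs] at b5 b6
      have b7 : |hc (e n) (v x)| ≤ Mv := b1.trans ((le_abs_self _).trans b6)
      calc _ ≤ ‖inner ℝ (gradient u x) (hc' (e n) (v x) • gradient v x)‖ + ‖c * (u x * hc (e n) (v x))‖ := norm_add_le _ _
        _ ≤ ‖gradient u x‖ * (|hc' (e n) (v x)| * ‖gradient v x‖) + |c| * (|u x| * |hc (e n) (v x)|) := by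
            gcongr
            · refine (norm_inner_le_norm _ _).trans ?_
              rw [norm_smul, Real.norm_eq_abs]
            · rw [Real.norm_eq_abs, abs_mul, abs_mul]
        _ ≤ _ := by
            have : 0 ≤ Mgu := (norm_nonneg _).trans b3
            have : 0 ≤ Mu := (abs_nonneg _).trans b5
            gcongr
    · filter_upwards [ae_restrict_mem hA] with x hx
      obtain ⟨h1, h2⟩ := ptw x hx
      exact (tendsto_const_nhds.inner h2).add ((h1.const_mul (u x)).const_mul c)
  have L2 : Filter.Tendsto (fun n => ∫ x in Ao N R, f x * hc (e n) (v x))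
      Filter.atTop (𝓝 (∫ x in Ao N R, f x * v x)) := by
    refine tendsto_integral_of_dominated_convergence (fun _ => Mf * Mv) ?_ (integrable_const _) ?_ ?_
    · intro n
      apply ContinuousOn.aestronglyMeasurable ?_ hA
      have c2 : ContinuousOn (fun x => hc (e n) (v x)) (Ao N R) := (hc_c1 (hepos n)).continuous.comp_continuousOn (cv.mono (Ao_sub R))
      exact (hf.mono (Ao_sub R)).mul c2
    · intro n
      filter_upwards [ae_restrict_mem hA] with x hx
      have hx' := Ao_sub R hx
      have b1 := hc_bd (hepos n) (hvn x hx')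
      have b5 := hMf x hx'
      have b6 := hMv x hx'
      rw [Real.norm_eq_abs] at b5 b6
      have b7 : |hc (e n) (v x)| ≤ Mv := b1.trans ((le_abs_self _).trans b6)
      rw [Real.norm_eq_abs, abs_mul]
      have : 0 ≤ Mf := (abs_nonneg _).trans b5
      gcongr
    · filter_upwards [ae_restrict_mem hA] with x hx
      exact (ptw x hx).1.const_mul (f x)
  simp_rw [key] at L1
  exact tendsto_nhds_unique L1 L2

end Ann
end
end

section
open MeasureTheory Real Set
open scoped ENNReal NNReal Topology
noncomputable section
namespace Ann

lemma Ao_preconnected {N : ℕ} (hN : 3 ≤ N) {R : ℝ} (hR : 0 < R) : IsPreconnected (Ao N R) := by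
  have hs : IsPreconnected (Metric.sphere (0 : E N) 1) := by
    apply isPreconnected_sphere
    rw [← Module.finrank_eq_rank]
    simp
    omega
  have hp := (isPreconnected_Ioo (a := R) (b := R + 1)).prod hs
  have := hp.image (fun z : ℝ × E N => z.1 • z.2) (by fun_prop)
  convert this
  ext x
  constructor
  · intro hx
    have hx0 : 0 < ‖x‖ := hR.trans hx.1
    refine ⟨(‖x‖, ‖x‖⁻¹ • x), ⟨⟨hx.1, hx.2⟩, ?_⟩, ?_⟩
    · simp [norm_smul, hx0.ne']
    · simp [smul_smul, hx0.ne']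
  · rintro ⟨⟨s, ω⟩, ⟨hs, hω⟩, rfl⟩
    have : ‖s • ω‖ = s := by
      rw [mem_sphere_zero_iff_norm] at hω
      rw [norm_smul, hω, mul_one, Real.norm_eq_abs, abs_of_pos (hR.trans hs.1)]
    exact ⟨by rw [this]; exact hs.1, by rw [this]; exact hs.2⟩

/-- local Hopf barrier -/
lemma hopf_local {N : ℕ} (hN : 3 ≤ N) {R : ℝ} (hR : 0 < R) {f u : E N → ℝ} (hu : Sol 1 R f u)
    (hf : ∀ x ∈ Ao N R, 0 ≤ f x) {x x1 : E N} {ρ : ℝ} (hρ : ‖x - x1‖ < 2 * ρ) (hne : x ≠ x1)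
    (hball : Metric.closedBall x1 (2 * ρ) ⊆ Ao N R) (h1 : 0 < u x1) : 0 < u x := by
  have hρ0 : 0 < ρ := by have := norm_nonneg (x - x1); linarith
  have hd0 : 0 < ‖x - x1‖ := norm_pos_iff.2 (sub_ne_zero.2 hne)
  have hx1A : x1 ∈ Ao N R := hball (Metric.mem_closedBall_self (by linarith))
  have hun := hu.nonneg hN hR zero_le_one hf
  have hcu : ContinuousAt u x1 := ((hu.c1A hR).continuousOn).continuousAt ((Ao_open R).mem_nhds hx1A)
  obtain ⟨δ0, hδ0, hδ0'⟩ := Metric.eventually_nhds_iff_ball.1 (hcu.eventually (lt_mem_nhds (show u x1 / 2 < u x1 by linarith)))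
  set δ := min (δ0 / 2) (‖x - x1‖ / 2) with hδ
  have hδp : 0 < δ := by rw [hδ]; positivity
  have hδ1 : δ < δ0 := (min_le_left _ _).trans_lt (by linarith)
  have hδ2 : δ < ‖x - x1‖ := (min_le_right _ _).trans_lt (by linarith)
  set k : ℝ := (2 * N + 1) / (4 * δ ^ 2) + 1 with hk
  have hk1 : 1 ≤ k := by
    have : 0 ≤ (2 * (N:ℝ) + 1) / (4 * δ ^ 2) := by positivity
    linarith
  have hkk : 1 ≤ 4 * δ ^ 2 * k ^ 2 - 2 * N * k := by
    have : 4 * δ ^ 2 * k = (2 * N + 1) + 4 * δ ^ 2 := by rw [hk]; field_simp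
    nlinarith [sq_nonneg δ]
  set c0 := Real.exp (-(k * (2 * ρ) ^ 2)) with hc0
  set P : ℝ → ℝ := fun s => Real.exp (-(k * s)) - c0 with hP
  set P1 : ℝ → ℝ := fun s => -k * Real.exp (-(k * s)) with hP1
  set P2 : ℝ → ℝ := fun s => k ^ 2 * Real.exp (-(k * s)) with hP2
  have de : ∀ s, HasDerivAt (fun s => Real.exp (-(k * s))) (-k * Real.exp (-(k * s))) s := by
    intro s
    have := (((hasDerivAt_id s).const_mul k).neg).exp
    refine this.congr_deriv ?_
    simp; ring
  have d1 : ∀ s, HasDerivAt P (P1 s) s := fun s => (de s).sub_const c0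
  have d2 : ∀ s, HasDerivAt P1 (P2 s) s := by
    intro s
    refine ((de s).const_mul (-k)).congr_deriv ?_
    simp only [hP2]; ring
  set b : E N → ℝ := fun x => P (‖x - x1‖ ^ 2) with hb
  have hbc : ContDiff ℝ 1 b := radial_c1 d1 d2 x1
  set Ω : Set (E N) := {z | δ < ‖z - x1‖ ∧ ‖z - x1‖ < 2 * ρ} with hΩ
  have cn : Continuous fun z : E N => ‖z - x1‖ := by fun_prop
  have hΩo : IsOpen Ω := (isOpen_lt continuous_const cn).inter (isOpen_lt cn continuous_const)
  have hcl : closure Ω ⊆ {z | δ ≤ ‖z - x1‖ ∧ ‖z - x1‖ ≤ 2 * ρ} :=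
    closure_minimal (fun z hz => ⟨hz.1.le, hz.2.le⟩)
      ((isClosed_le continuous_const cn).inter (isClosed_le cn continuous_const))
  have hclA : closure Ω ⊆ Ao N R := fun z hz => hball (by rw [Metric.mem_closedBall, dist_eq_norm]; exact (hcl hz).2)
  have hΩA : Ω ⊆ Ao N R := subset_closure.trans hclA
  set μ := u x1 / 2 with hμ
  have hμ0 : 0 < μ := by rw [hμ]; linarith
  have key := wmp hN hΩo ((Ao_bounded R).subset hΩA) (w := fun x => (-μ) * b x + 1 * u x) (c := 1) zero_le_one
    ((contDiffOn_const.mul hbc.contDiffOn).add (contDiffOn_const.mul ((hu.c1A hR).mono hΩA)))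
    ((continuousOn_const.mul hbc.continuous.continuousOn).add (continuousOn_const.mul ((hu.c1A hR).continuousOn.mono hclA))) ?_ ?_ x ?_
  · have hbx : 0 < b x := by
      simp only [hb, hP, hc0, sub_pos, Real.exp_lt_exp, neg_lt_neg_iff]
      gcongr
    nlinarith [mul_pos hμ0 hbx]
  · intro z hz hz2
    have h3 := hcl hz
    rcases h3.1.eq_or_lt with h4 | h4
    · have h5 : u x1 / 2 < u z := hδ0' z (by rw [Metric.mem_ball, dist_eq_norm, ← h4]; exact hδ1)
      have h6 : b z ≤ 1 := by
        have : Real.exp (-(k * ‖z - x1‖ ^ 2)) ≤ 1 := by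
          rw [Real.exp_le_one_iff]; nlinarith [sq_nonneg ‖z - x1‖]
        have : 0 < c0 := Real.exp_pos _
        simp only [hb, hP]; linarith
      nlinarith
    · have h5 : ‖z - x1‖ = 2 * ρ := le_antisymm h3.2 (not_lt.1 fun h => hz2 ⟨h4, h⟩)
      have h6 : b z = 0 := by simp only [hb, hP, h5, hc0, sub_self]
      rw [h6]
      have := hun z (Ao_sub R (hclA hz))
      linarith
  · intro φ hφ hφ0
    have hφA : Test (Ao N R) φ := ⟨hφ.c1, hφ.cpt, hφ.sub.trans hΩA⟩
    rw [pair_lin (Ao_open R) hbc.contDiffOn (hu.c1A hR) _ _ 1 hφA, hu.weak φ hφA, one_mul]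
    have hφ' : Test univ φ := ⟨hφ.c1, hφ.cpt, subset_univ _⟩
    have hP2c : Continuous P2 := by simp only [hP2]; fun_prop
    have hP1c : Continuous P1 := by simp only [hP1]; fun_prop
    have e := radial_ibp d1 d2 hP2c x1 hφ'
    have i1 : Integrable fun x => (4 * ‖x - x1‖ ^ 2 * P2 (‖x - x1‖ ^ 2) + 2 * N * P1 (‖x - x1‖ ^ 2)) * φ x := by
      refine integrable_mul_test (Ω := univ) (Continuous.continuousOn ?_) hφ'
      fun_prop
    have i2 : Integrable fun x => b x * φ x := integrable_mul_test hbc.continuous.continuousOn hφ'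
    have e2 : ∫ x, (inner ℝ (gradient b x) (gradient φ x) + 1 * (b x * φ x)) =
        -∫ x, (4 * ‖x - x1‖ ^ 2 * P2 (‖x - x1‖ ^ 2) + 2 * N * P1 (‖x - x1‖ ^ 2) - b x) * φ x := by
      simp only [one_mul]
      rw [integral_add (integrable_pair isOpen_univ hbc.contDiffOn hφ') i2, e]
      simp_rw [sub_mul]
      rw [integral_sub i1 i2]; ring
    rw [e2]
    have p1 : 0 ≤ ∫ x, (4 * ‖x - x1‖ ^ 2 * P2 (‖x - x1‖ ^ 2) + 2 * N * P1 (‖x - x1‖ ^ 2) - b x) * φ x := by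
      refine integral_mul_test_nonneg hφ hφ0 fun z hz => ?_
      simp only [hb, hP, hP1, hP2]
      set E0 := Real.exp (-(k * ‖z - x1‖ ^ 2))
      have hE : 0 < E0 := Real.exp_pos _
      have hc : 0 < c0 := Real.exp_pos _
      have hδz : δ ^ 2 ≤ ‖z - x1‖ ^ 2 := by have := hz.1; gcongr
      have : 1 ≤ 4 * ‖z - x1‖ ^ 2 * k ^ 2 - 2 * N * k := by nlinarith [sq_nonneg k]
      nlinarith
    have p2 := integral_mul_test_nonneg hφA hφ0 hf
    nlinarith
  · exact subset_closure ⟨hδ2, hρ⟩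

/-- strong maximum principle -/
lemma Sol.pos {N : ℕ} (hN : 3 ≤ N) {R : ℝ} (hR : 0 < R) {f u : E N → ℝ} (hu : Sol 1 R f u)
    (hf : ∀ x ∈ Ao N R, 0 ≤ f x) {x0 : E N} (hx0 : x0 ∈ Ao N R) (h0 : 0 < u x0) : ∀ x ∈ Ao N R, 0 < u x := by
  set U : Set (E N) := Ao N R ∩ u ⁻¹' (Ioi 0) with hU
  have hUo : IsOpen U := (hu.c1A hR).continuousOn.isOpen_inter_preimage (Ao_open R) isOpen_Ioi
  have := (Ao_preconnected hN hR).subset_of_closure_inter_subset hUo ⟨x0, hx0, hx0, h0⟩ ?_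
  · intro x hx; exact (this hx).2
  · rintro x ⟨hxc, hxA⟩
    obtain ⟨r, hr, hrA⟩ := Metric.isOpen_iff.1 (Ao_open R) x hxA
    obtain ⟨x1, hx1, hd⟩ := Metric.mem_closure_iff.1 hxc (r / 4) (by positivity)
    refine ⟨hxA, ?_⟩
    by_cases hne : x = x1
    · rw [hne]; exact hx1.2
    · rw [dist_eq_norm] at hd
      refine hopf_local hN hR hu hf (ρ := r / 4) (x1 := x1) (by linarith [norm_nonneg (x - x1)]) hne ?_ hx1.2
      intro z hz
      apply hrA
      rw [Metric.mem_closedBall] at hz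
      rw [Metric.mem_ball]
      have := dist_triangle z x1 x
      rw [dist_comm x1 x, dist_eq_norm x x1] at this
      linarith

end Ann
end
end

section
open MeasureTheory Real Set
open scoped ENNReal NNReal Topology
noncomputable section
namespace Ann

/-- index of the last coordinate -/
def ll {N : ℕ} (hN : 3 ≤ N) : Fin N := ⟨N - 1, by omega⟩
def zz {N : ℕ} (hN : 3 ≤ N) : Fin N := ⟨0, by omega⟩

lemma zz_ne {N : ℕ} (hN : 3 ≤ N) : zz hN ≠ ll hN := by
  simp only [zz, ll, ne_eq, Fin.mk.injEq]; omega

lemma lastCoord_ll {N : ℕ} (hN : 3 ≤ N) (x : E N) : lastCoord x = x (ll hN) := by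
  unfold lastCoord ll
  rw [dif_pos (by omega)]

lemma coord_le {N : ℕ} (x : E N) (i : Fin N) : |x i| ≤ ‖x‖ := by
  have := PiLp.norm_apply_le (p := 2) (β := fun _ : Fin N => ℝ) x i
  exact this

lemma vol_box {N : ℕ} (s : Fin N → Set ℝ) (hs : ∀ i, MeasurableSet (s i)) :
    volume {x : E N | ∀ i, x i ∈ s i} = ∏ i, volume (s i) := by
  have h := (PiLp.volume_preserving_ofLp (Fin N)).measure_preimage (s := univ.pi s)
    (MeasurableSet.univ_pi hs).nullMeasurableSet
  rw [volume_pi_pi] at h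
  rw [← h]
  congr 1
  ext x
  simp

def band {N : ℕ} (τ : ℝ) : Set (S N) := {ω | |lastCoord (ω : E N)| ≤ τ}

lemma band_meas {N : ℕ} (τ : ℝ) : MeasurableSet (band τ : Set (S N)) := by
  apply IsClosed.measurableSet
  exact isClosed_le (lastCoord_cont.comp continuous_subtype_val).abs continuous_const

lemma band_lower {N : ℕ} (hN : 3 ≤ N) : ∃ c, 0 < c ∧ ∀ τ : ℝ, 0 < τ → τ ≤ 1 →
    ENNReal.ofReal (c * τ) ≤ sig N (band τ) := by
  have h3 := cast3 hN
  have hN0 : (0:ℝ) < N := by linarith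
  set g : Fin N → ℝ := fun i => if i = zz hN then 1 / (2 * N) else if i = ll hN then 1 / N else 2 / N with hg
  have hgp : ∀ i, 0 < g i := by intro i; simp only [hg]; split_ifs <;> positivity
  refine ⟨∏ i, g i, Finset.prod_pos fun i _ => hgp i, ?_⟩
  intro τ h0 h1
  set s : Fin N → Set ℝ := fun i => if i = zz hN then Ioo (1 / (2 * N)) (1 / N : ℝ) else
    if i = ll hN then Ioo (-(τ / (2 * N))) (τ / (2 * N)) else Ioo (-(1 / N)) (1 / N) with hs
  have hv : volume {x : E N | ∀ i, x i ∈ s i} = ENNReal.ofReal ((∏ i, g i) * τ) := by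
    rw [vol_box]
    · have : ∀ i, volume (s i) = ENNReal.ofReal (g i * (if i = ll hN then τ else 1)) := by
        intro i
        simp only [hs, hg]
        by_cases h : i = zz hN
        · rw [if_pos h, if_pos h, if_neg (by rw [h]; exact zz_ne hN), Real.volume_Ioo]
          congr 1; field_simp; norm_num
        · rw [if_neg h, if_neg h]
          by_cases h' : i = ll hN
          · rw [if_pos h', if_pos h', if_pos h', Real.volume_Ioo]
            congr 1; field_simp; norm_num
          · rw [if_neg h', if_neg h', if_neg h', Real.volume_Ioo]
            congr 1; ring
      simp_rw [this]
      rw [← ENNReal.ofReal_prod_of_nonneg]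
      · rw [Finset.prod_mul_distrib, Finset.prod_ite_eq' Finset.univ (ll hN)]; simp
      · intro i _
        have := hgp i
        split_ifs <;> positivity
    · intro i; simp only [hs]; split_ifs <;> exact measurableSet_Ioo
  rw [← hv]
  rw [sig, Measure.toSphere_apply' _ (band_meas τ)]
  have hfin : (1 : ℝ≥0∞) ≤ (Module.finrank ℝ (E N) : ℝ≥0∞) := by
    rw [finrank_euclideanSpace_fin]; exact_mod_cast (by omega : 1 ≤ N)
  refine le_trans ?_ (le_mul_of_one_le_left (zero_le) hfin)
  apply measure_mono
  intro y hy
  have hy0 : y (zz hN) ∈ Ioo (1 / (2 * (N:ℝ))) (1 / (N : ℝ)) := by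
    have := hy (zz hN); simpa only [hs, if_pos] using this
  have hyl : y (ll hN) ∈ Ioo (-(τ / (2 * N))) (τ / (2 * N)) := by
    have := hy (ll hN); simpa only [hs, if_neg (zz_ne hN).symm, if_pos] using this
  have hyb : ∀ i, |y i| ≤ 1 / N := by
    intro i
    have := hy i
    simp only [hs] at this
    split_ifs at this with h h'
    · rw [abs_of_pos (lt_trans (by positivity) this.1)]; exact this.2.le
    · rw [abs_le]
      have h5 : τ / (2 * N) ≤ 1 / N := by rw [div_le_div_iff₀ (by positivity) (by positivity)]; nlinarith
      exact ⟨by linarith [this.1], by linarith [this.2]⟩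
    · rw [abs_le]; exact ⟨this.1.le, this.2.le⟩
  have hn1 : ‖y‖ < 1 := by
    rw [EuclideanSpace.norm_eq, Real.sqrt_lt' one_pos]
    calc ∑ i, ‖y i‖ ^ 2 ≤ ∑ i : Fin N, (1 / N : ℝ) ^ 2 := by
          apply Finset.sum_le_sum; intro i _
          exact pow_le_pow_left₀ (norm_nonneg _) (hyb i) 2
      _ = 1 / N := by simp; field_simp
      _ < 1 ^ 2 := by rw [div_lt_iff₀ hN0]; linarith
  have hn0 : 1 / (2 * N) ≤ ‖y‖ := (le_trans hy0.1.le (le_abs_self _)).trans (coord_le y _)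
  have hn00 : 0 < ‖y‖ := lt_of_lt_of_le (by positivity) hn0
  rw [Set.mem_smul]
  refine ⟨‖y‖, ⟨hn00, hn1⟩, ‖y‖⁻¹ • y, ?_, by rw [smul_smul, mul_inv_cancel₀ hn00.ne', one_smul]⟩
  refine ⟨⟨‖y‖⁻¹ • y, by simp [norm_smul, hn00.ne']⟩, ?_, rfl⟩
  show |lastCoord (‖y‖⁻¹ • y)| ≤ τ
  rw [lastCoord_smul, abs_mul, abs_of_pos (inv_pos.2 hn00), lastCoord_ll hN, inv_mul_le_iff₀ hn00]
  have : |y (ll hN)| ≤ τ / (2 * N) := abs_le.2 ⟨hyl.1.le, hyl.2.le⟩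
  calc _ ≤ _ := this
    _ = 1 / (2 * N) * τ := by ring
    _ ≤ _ := by gcongr

lemma band_upper {N : ℕ} (hN : 3 ≤ N) : ∃ c, 0 < c ∧ ∀ τ : ℝ, 0 ≤ τ →
    sig N (band τ) ≤ ENNReal.ofReal (c * τ) := by
  have h3 := cast3 hN
  refine ⟨N * 2 ^ N, by positivity, ?_⟩
  intro τ h0
  rw [sig, Measure.toSphere_apply' _ (band_meas τ), finrank_euclideanSpace_fin]
  have hv : volume {x : E N | ∀ i, x i ∈ (fun i => if i = ll hN then Icc (-τ) τ else Icc (-1:ℝ) 1) i} = ENNReal.ofReal (2 ^ N * τ) := by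
    rw [vol_box]
    · have : ∀ i, volume ((fun i => if i = ll hN then Icc (-τ) τ else Icc (-1:ℝ) 1) i) = ENNReal.ofReal (2 * (if i = ll hN then τ else 1)) := by
        intro i
        dsimp only
        by_cases h' : i = ll hN
        · rw [if_pos h', if_pos h', Real.volume_Icc]
          congr 1; ring
        · rw [if_neg h', if_neg h', Real.volume_Icc]
          congr 1; ring
      simp_rw [this]
      rw [← ENNReal.ofReal_prod_of_nonneg]
      · rw [Finset.prod_mul_distrib, Finset.prod_ite_eq' Finset.univ (ll hN)]; simp
      · intro i _
        split_ifs <;> positivity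
    · intro i; split_ifs <;> exact measurableSet_Icc
  calc _ ≤ (N : ℝ≥0∞) * volume {x : E N | ∀ i, x i ∈ (fun i => if i = ll hN then Icc (-τ) τ else Icc (-1:ℝ) 1) i} := by
        gcongr
        intro y hy
        obtain ⟨r, hr, z, ⟨ω, hω, rfl⟩, rfl⟩ := Set.mem_smul.1 hy
        have hωn : ‖(ω : E N)‖ = 1 := by simpa using ω.2
        intro i
        have hω' : |lastCoord (ω : E N)| ≤ τ := hω
        rw [lastCoord_ll hN] at hω'
        have e : (r • (ω : E N)) i = r * (ω : E N) i := rfl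
        dsimp only
        rw [e]
        split_ifs with h
        · rw [h, mem_Icc, ← abs_le, abs_mul, abs_of_pos hr.1]
          calc _ ≤ 1 * |(ω : E N) (ll hN)| := by gcongr; exact hr.2.le
            _ ≤ τ := by simpa using hω'
        · rw [mem_Icc, ← abs_le, abs_mul, abs_of_pos hr.1]
          have := coord_le (ω : E N) i
          rw [hωn] at this
          calc _ ≤ 1 * |(ω : E N) i| := by gcongr; exact hr.2.le
            _ ≤ 1 := by simpa using this
    _ = _ := by
        rw [hv, ← ENNReal.ofReal_natCast, ← ENNReal.ofReal_mul (by positivity)]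
        congr 1; ring

end Ann
end
end

section
open MeasureTheory Real Set
open scoped ENNReal NNReal Topology
noncomputable section
namespace Ann

def Pt {N : ℕ} (t : ℝ) (y : E N) : ℝ := ∏ i, |y i| ^ (-t)

lemma Pt_nonneg {N : ℕ} (t : ℝ) (y : E N) : 0 ≤ Pt t y :=
  Finset.prod_nonneg fun i _ => by positivity

lemma Pt_meas {N : ℕ} (t : ℝ) : Measurable (Pt t : E N → ℝ) := by
  unfold Pt
  fun_prop

lemma Pt_smul {N : ℕ} (t : ℝ) {r : ℝ} (hr : 0 < r) (y : E N) : Pt t (r • y) = (r ^ (-t)) ^ N * Pt t y := by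
  unfold Pt
  have : ∀ i, |(r • y) i| ^ (-t) = r ^ (-t) * |y i| ^ (-t) := by
    intro i
    have e : (r • y) i = r * y i := rfl
    rw [e, abs_mul, abs_of_pos hr, Real.mul_rpow hr.le (abs_nonneg _)]
  simp_rw [this]
  rw [Finset.prod_mul_distrib]; simp

def w1 (t : ℝ) : ℝ → ℝ := fun x => (Icc (0:ℝ) 2).indicator (fun s => s ^ (-t)) ‖x‖

lemma w1_int {t : ℝ} (ht : t < 1) : Integrable (w1 t) := by
  unfold w1
  rw [integrable_fun_norm_addHaar volume]
  simp only [Module.finrank_self, le_refl, tsub_eq_zero_of_le, pow_zero, one_smul]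
  rw [integrableOn_indicator_iff measurableSet_Icc]
  have h := intervalIntegral.intervalIntegrable_rpow' (a := 0) (b := 2) (r := -t) (by linarith)
  rw [intervalIntegrable_iff_integrableOn_Ioc_of_le (by norm_num)] at h
  refine h.mono_set ?_
  intro x hx; exact ⟨hx.2, hx.1.2⟩

lemma Pt_sphere {N : ℕ} (hN : 3 ≤ N) {t : ℝ} (h0 : 0 < t) (ht : t < 1) :
    ∫⁻ ω : S N, ENNReal.ofReal (Pt t (ω : E N)) ∂(sig N) ≠ ∞ := by
  have hI : Integrable (fun y : E N => ∏ i, w1 t (y i)) := by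
    have h1 : Integrable (fun y : Fin N → ℝ => ∏ i, w1 t (y i)) :=
      Integrable.fintype_prod (f := fun _ => w1 t) fun _ => w1_int ht
    have := ((EuclideanSpace.volume_preserving_symm_measurableEquiv_toLp (Fin N)).integrable_comp_emb
      (MeasurableEquiv.measurableEmbedding _)).2 h1
    exact this
  have hm1 : Measurable (w1 t) := by
    unfold w1
    refine Measurable.comp (g := (Icc (0:ℝ) 2).indicator (fun s => s ^ (-t))) ?_ measurable_norm
    exact Measurable.indicator (by fun_prop) measurableSet_Icc
  have hm : Measurable fun y : E N => ENNReal.ofReal (∏ i, w1 t (y i)) := by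
    refine Measurable.ennreal_ofReal ?_
    refine Finset.measurable_prod _ fun i _ => hm1.comp (by fun_prop)
  have hfin : ∫⁻ y : E N, ENNReal.ofReal (∏ i, w1 t (y i)) ≠ ∞ := by
    have := hI.lintegral_lt_top
    exact this.ne
  rw [polar_lintegral _ hm hN] at hfin
  have hk : 0 < ((2:ℝ) ^ (-t)) ^ N := by positivity
  have hle : ∫⁻ ω : S N, ENNReal.ofReal (((2:ℝ) ^ (-t)) ^ N) * ENNReal.ofReal (Pt t (ω : E N)) ∂(sig N) ≤
    ∫⁻ ω : S N, (∫⁻ r in Ioi (0:ℝ), ENNReal.ofReal (r ^ (N - 1)) * ENNReal.ofReal (∏ i, w1 t ((r • (ω : E N)) i))) ∂(sig N) := by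
    apply lintegral_mono
    intro ω
    have hω : ‖(ω : E N)‖ = 1 := by simp
    calc _ = ∫⁻ r in Ioo (1:ℝ) 2, ENNReal.ofReal (((2:ℝ) ^ (-t)) ^ N) * ENNReal.ofReal (Pt t (ω : E N)) := by
          rw [setLIntegral_const, Real.volume_Ioo]; norm_num
      _ ≤ ∫⁻ r in Ioo (1:ℝ) 2, ENNReal.ofReal (r ^ (N - 1)) * ENNReal.ofReal (∏ i, w1 t ((r • (ω : E N)) i)) := by
          apply setLIntegral_mono' measurableSet_Ioo
          intro r hr
          have hr0 : 0 < r := by linarith [hr.1]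
          have e : ∏ i, w1 t ((r • (ω : E N)) i) = Pt t (r • (ω : E N)) := by
            unfold Pt w1
            refine Finset.prod_congr rfl fun i _ => ?_
            rw [indicator_of_mem]; · rfl
            refine ⟨norm_nonneg _, ?_⟩
            refine (coord_le _ i).trans ?_
            rw [norm_smul, hω, Real.norm_eq_abs, abs_of_pos hr0]; linarith [hr.2]
          rw [e, Pt_smul t hr0, ← ENNReal.ofReal_mul (by positivity), ← ENNReal.ofReal_mul (by positivity)]
          apply ENNReal.ofReal_le_ofReal
          have h5 : (2:ℝ) ^ (-t) ≤ r ^ (-t) := Real.rpow_le_rpow_of_nonpos hr0 hr.2.le (by linarith)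
          have h6 : 1 ≤ r ^ (N - 1) := one_le_pow₀ hr.1.le
          have h7 := Pt_nonneg t (ω : E N)
          calc _ ≤ (r ^ (-t)) ^ N * Pt t (ω : E N) := by gcongr
            _ = 1 * ((r ^ (-t)) ^ N * Pt t (ω : E N)) := by ring
            _ ≤ _ := by gcongr
      _ ≤ _ := lintegral_mono_set (fun r hr => lt_trans one_pos hr.1)
  rw [lintegral_const_mul' _ _ ENNReal.ofReal_ne_top] at hle
  have := ne_top_of_le_ne_top hfin hle
  intro h
  rw [h, ENNReal.mul_top (by simpa using hk)] at this
  exact this rfl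

/-- kernel bound by a product weight -/
lemma kern_bound {N : ℕ} (hN : 3 ≤ N) {R α : ℝ} (hR : 0 < R) (h0 : 0 < α) (h1 : α < 1) {r : ℝ}
    {t : ℝ} (htd : t = 1 - (1 - α) / (2 * ((N:ℝ) - 2)))
    {y : E N} (hy : y ∈ Ac N R) (hne : ∀ i, y i ≠ 0) :
    K 0 (EuclideanSpace.single (zz hN) r - y) * |y (ll hN)| ^ (-α) ≤ (R + 1) ^ (2:ℝ) * Pt t y := by
  have h3 := cast3 hN
  have hN2 : 0 < (N:ℝ) - 2 := by linarith
  set γ := (1 - α) / (2 * ((N:ℝ) - 2)) with hγ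
  have hγ0 : 0 < γ := by have : 0 < 1 - α := by linarith
                         positivity
  have hγ1 : ((N:ℝ) - 2) * γ = (1 - α) / 2 := by rw [hγ]; field_simp
  have hγ2 : γ ≤ (1 - α) / 2 := by rw [← hγ1]; nlinarith
  set d := ‖EuclideanSpace.single (zz hN) r - y‖ with hd
  have hdi : ∀ i, i ≠ zz hN → |y i| ≤ d := by
    intro i hi
    have := coord_le (EuclideanSpace.single (zz hN) r - y) i
    have e : (EuclideanSpace.single (zz hN) r - y) i = - y i := by
      simp [hi]
    rwa [e, abs_neg] at this
  have hpos : ∀ i, 0 < |y i| := fun i => abs_pos.2 (hne i)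
  have hup : ∀ i, |y i| ≤ R + 1 := fun i => (coord_le y i).trans hy.2
  have hd0 : 0 < d := (hpos _).trans_le (hdi (ll hN) (zz_ne hN).symm)
  set T : Finset (Fin N) := (Finset.univ.erase (zz hN)).erase (ll hN) with hT
  have hcard : T.card = N - 2 := by
    rw [hT, Finset.card_erase_of_mem (by simp [(zz_ne hN).symm]), Finset.card_erase_of_mem (by simp)]
    simp; omega
  have hPt : Pt t y = |y (zz hN)| ^ (-t) * (|y (ll hN)| ^ (-t) * ∏ i ∈ T, |y i| ^ (-t)) := by
    unfold Pt
    rw [hT, Finset.mul_prod_erase _ (fun i => |y i| ^ (-t)) (by simp [(zz_ne hN).symm]), Finset.mul_prod_erase _ (fun i => |y i| ^ (-t)) (by simp)]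
  have ht0 : 0 < t := by rw [htd]; linarith
  have hK : K 0 (EuclideanSpace.single (zz hN) r - y) ≤ |y (ll hN)| ^ (-((1 - α) / 2)) * ∏ i ∈ T, |y i| ^ (-t) := by
    rw [K_zero, ← hd]
    have e1 : d ^ (-((N:ℝ) - 2)) = ∏ i ∈ T, d ^ (-1 : ℝ) := by
      rw [Finset.prod_const, hcard, ← Real.rpow_natCast, ← Real.rpow_mul hd0.le, Nat.cast_sub (by omega)]
      congr 1; push_cast; ring
    have e2 : |y (ll hN)| ^ (-((1 - α) / 2)) = ∏ i ∈ T, |y (ll hN)| ^ (-γ) := by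
      rw [Finset.prod_const, hcard, ← Real.rpow_natCast, ← Real.rpow_mul (abs_nonneg _), Nat.cast_sub (by omega), ← hγ1]
      congr 1; push_cast; ring
    rw [e1, e2, ← Finset.prod_mul_distrib]
    apply Finset.prod_le_prod
    · intro i _; positivity
    · intro i hi
      have hi' : i ≠ zz hN := by
        rw [hT] at hi; exact (Finset.mem_erase.1 (Finset.mem_erase.1 hi).2).1
      calc d ^ (-1:ℝ) = d ^ (-γ) * d ^ (-t) := by rw [← Real.rpow_add hd0]; congr 1; rw [htd]; ring
        _ ≤ _ := by
          apply mul_le_mul _ _ (by positivity) (by positivity)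
          · exact Real.rpow_le_rpow_of_nonpos (hpos _) (hdi (ll hN) (zz_ne hN).symm) (by linarith)
          · exact Real.rpow_le_rpow_of_nonpos (hpos _) (hdi i hi') (by linarith)
  have hP0 : 0 ≤ ∏ i ∈ T, |y i| ^ (-t) := Finset.prod_nonneg fun i _ => by positivity
  have hl : |y (ll hN)| ^ (-((1 - α) / 2)) * |y (ll hN)| ^ (-α) ≤ (R + 1) * |y (ll hN)| ^ (-t) := by
    rw [← Real.rpow_add (hpos _), show -((1 - α) / 2) + -α = (t - (1 + α) / 2) + -t by ring, Real.rpow_add (hpos _)]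
    gcongr
    calc _ ≤ (R + 1) ^ (t - (1 + α) / 2) := Real.rpow_le_rpow (abs_nonneg _) (hup _) (by rw [htd]; linarith)
      _ ≤ (R + 1) ^ (1:ℝ) := Real.rpow_le_rpow_of_exponent_le (by linarith) (by rw [htd]; linarith)
      _ = _ := Real.rpow_one _
  have hz : 1 ≤ (R + 1) * |y (zz hN)| ^ (-t) := by
    have h5 : |y (zz hN)| ^ t ≤ R + 1 := by
      calc _ ≤ (R + 1) ^ t := Real.rpow_le_rpow (abs_nonneg _) (hup _) ht0.le
        _ ≤ (R + 1) ^ (1:ℝ) := Real.rpow_le_rpow_of_exponent_le (by linarith) (by rw [htd]; linarith)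
        _ = _ := Real.rpow_one _
    rw [Real.rpow_neg (abs_nonneg _), ← div_eq_mul_inv, le_div_iff₀ (Real.rpow_pos_of_pos (hpos _) _), one_mul]
    exact h5
  rw [hPt]
  calc _ ≤ (|y (ll hN)| ^ (-((1 - α) / 2)) * ∏ i ∈ T, |y i| ^ (-t)) * |y (ll hN)| ^ (-α) := by gcongr
    _ = (|y (ll hN)| ^ (-((1 - α) / 2)) * |y (ll hN)| ^ (-α)) * ∏ i ∈ T, |y i| ^ (-t) := by ring
    _ ≤ ((R + 1) * |y (ll hN)| ^ (-t)) * ∏ i ∈ T, |y i| ^ (-t) := by gcongr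
    _ = 1 * (((R + 1) * |y (ll hN)| ^ (-t)) * ∏ i ∈ T, |y i| ^ (-t)) := by ring
    _ ≤ ((R + 1) * |y (zz hN)| ^ (-t)) * (((R + 1) * |y (ll hN)| ^ (-t)) * ∏ i ∈ T, |y i| ^ (-t)) := by gcongr
    _ = _ := by rw [Real.rpow_two]; ring

end Ann
end
end

section
open MeasureTheory Real Set
open scoped ENNReal NNReal Topology
noncomputable section
namespace Ann

lemma intOn_Ao {N : ℕ} {R : ℝ} {g : E N → ℝ} (hg : ContinuousOn g (Ac N R)) : IntegrableOn g (Ao N R) :=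
  (hg.integrableOn_compact (Ac_compact R)).mono_set (Ao_sub R)

lemma Ao_meas {N : ℕ} (R : ℝ) : MeasurableSet (Ao N R) := (Ao_open R).measurableSet

lemma ind_meas {N : ℕ} {R : ℝ} {f : E N → ℝ} (hf : ContinuousOn f (Ac N R)) : Measurable ((Ao N R).indicator f) := by
  classical
  rw [← piecewise_eq_indicator]
  exact (hf.mono (Ao_sub R)).measurable_piecewise continuousOn_const (Ao_meas R)

lemma ae_coord {N : ℕ} : ∀ᵐ y : E N, ∀ i, y i ≠ 0 := by
  rw [ae_all_iff]
  intro i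
  have h := Measure.ae_eval_ne (fun _ : Fin N => (volume : Measure ℝ)) i 0
  exact (PiLp.volume_preserving_ofLp (Fin N)).quasiMeasurePreserving.ae h

/-- spherical slice of `f^q` -/
def slice {N : ℕ} (R q : ℝ) (f : E N → ℝ) (s : ℝ) : ℝ≥0∞ :=
  ∫⁻ ω : S N, ENNReal.ofReal (((Ao N R).indicator f (s • (ω : E N))) ^ q) ∂(sig N)

lemma slice_meas0 {N : ℕ} {R q : ℝ} {f : E N → ℝ} (hf : ContinuousOn f (Ac N R)) :
    Measurable fun z : ℝ × S N => ENNReal.ofReal (((Ao N R).indicator f (z.1 • (z.2 : E N))) ^ q) := by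
  have h : Measurable fun z : ℝ × S N => z.1 • (z.2 : E N) := by
    apply Continuous.measurable
    exact continuous_fst.fun_smul (continuous_subtype_val.comp continuous_snd)
  exact (((ind_meas hf).comp h).pow_const q).ennreal_ofReal

lemma slice_meas {N : ℕ} {R q : ℝ} {f : E N → ℝ} (hf : ContinuousOn f (Ac N R)) : Measurable (slice R q f) :=
  (slice_meas0 hf).lintegral_prod_right'

lemma slice_total {N : ℕ} (hN : 3 ≤ N) {R q : ℝ} (hq : 0 < q) {f : E N → ℝ} (hf : ContinuousOn f (Ac N R))
    (hf0 : ∀ x ∈ Ac N R, 0 ≤ f x) (h1 : ∫ x in Ao N R, f x ^ q ≤ 1) :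
    ∫⁻ r in Ioi (0:ℝ), ENNReal.ofReal (r ^ (N - 1)) * slice R q f r ≤ 1 := by
  have e1 : ∫⁻ x : E N, ENNReal.ofReal (((Ao N R).indicator f x) ^ q) ≤ 1 := by
    have e : (fun x : E N => ENNReal.ofReal (((Ao N R).indicator f x) ^ q)) =
        (Ao N R).indicator (fun x => ENNReal.ofReal (f x ^ q)) := by
      ext x
      by_cases hx : x ∈ Ao N R
      · simp [hx]
      · simp [hx, Real.zero_rpow hq.ne']
    rw [e, lintegral_indicator (Ao_meas R), ← ofReal_integral_eq_lintegral_ofReal]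
    · exact ENNReal.ofReal_le_one.2 h1
    · exact intOn_Ao (hf.rpow_const fun x hx => Or.inr hq.le)
    · rw [Filter.EventuallyLE, ae_restrict_iff' (Ao_meas R)]
      exact Filter.Eventually.of_forall fun x hx => Real.rpow_nonneg (hf0 x (Ao_sub R hx)) q
  rw [polar_lintegral _ (((ind_meas hf).pow_const q).ennreal_ofReal) hN] at e1
  refine le_trans (le_of_eq ?_) e1
  rw [lintegral_lintegral_swap]
  · apply lintegral_congr
    intro r
    rw [slice, lintegral_const_mul' _ _ ENNReal.ofReal_ne_top]
  · apply Measurable.aemeasurable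
    have h2 := (slice_meas0 (q := q) hf).comp measurable_swap
    have h3 : Measurable fun z : S N × ℝ => ENNReal.ofReal (z.2 ^ (N - 1)) := by fun_prop
    exact h3.mul h2

lemma slice_bound {N : ℕ} (hN : 3 ≤ N) {R q : ℝ} (hR : 0 < R) (hq : 1 < q) :
    ∃ C, 0 ≤ C ∧ ∀ f : E N → ℝ, Cone R f → ∀ y ∈ Ao N R, y (ll hN) ≠ 0 →
      ENNReal.ofReal (f y) ≤ (1 + slice R q f ‖y‖) * ENNReal.ofReal (C * |y (ll hN)| ^ (-(1 / q))) := by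
  obtain ⟨c, hc, hb⟩ := band_lower hN
  have hα : 0 < 1 / q := by positivity
  refine ⟨c ^ (-(1 / q)) * (R + 1) ^ (1 / q), by positivity, ?_⟩
  intro f hf y hy hyl
  have hyn : 0 < ‖y‖ := hR.trans hy.1
  have hyl' := abs_pos.2 hyl
  set τ := |y (ll hN)| / ‖y‖ with hτ
  have hτ0 : 0 < τ := by positivity
  have hτ1 : τ ≤ 1 := by rw [hτ, div_le_one hyn]; exact coord_le _ _
  have hf0 := hf.nn y (Ao_sub R hy)
  have h1 : ENNReal.ofReal (f y ^ q) * ENNReal.ofReal (c * τ) ≤ slice R q f ‖y‖ := by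
    calc _ ≤ ENNReal.ofReal (f y ^ q) * sig N (band τ) := by gcongr; exact hb τ hτ0 hτ1
      _ = ∫⁻ ω in band τ, ENNReal.ofReal (f y ^ q) ∂(sig N) := by rw [setLIntegral_const]
      _ ≤ ∫⁻ ω in band τ, ENNReal.ofReal (((Ao N R).indicator f (‖y‖ • (ω : E N))) ^ q) ∂(sig N) := by
          apply setLIntegral_mono' (band_meas τ)
          intro ω hω
          have hn : ‖‖y‖ • (ω : E N)‖ = ‖y‖ := by rw [norm_smul]; simp
          have hm : ‖y‖ • (ω : E N) ∈ Ao N R := by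
            show R < _ ∧ _ < R + 1
            rw [hn]; exact hy
          rw [indicator_of_mem hm]
          apply ENNReal.ofReal_le_ofReal
          apply Real.rpow_le_rpow hf0 _ (by linarith)
          apply hf.mono _ (Ao_sub R hm) _ (Ao_sub R hy) hn
          rw [lastCoord_smul, abs_mul, abs_of_pos hyn, lastCoord_ll hN y]
          have h5 : |lastCoord (ω : E N)| ≤ τ := hω
          calc _ ≤ ‖y‖ * τ := by gcongr
            _ = _ := by rw [hτ]; field_simp
      _ ≤ _ := setLIntegral_le_lintegral _ _
  have hcτ : 0 < c * τ := by positivity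
  have h2 : ENNReal.ofReal (f y ^ q) ≤ slice R q f ‖y‖ * ENNReal.ofReal ((c * τ)⁻¹) := by
    calc _ = (ENNReal.ofReal (f y ^ q) * ENNReal.ofReal (c * τ)) * ENNReal.ofReal ((c * τ)⁻¹) := by
          rw [mul_assoc, ← ENNReal.ofReal_mul hcτ.le, mul_inv_cancel₀ hcτ.ne', ENNReal.ofReal_one, mul_one]
      _ ≤ _ := by gcongr
  have h3 : ENNReal.ofReal (f y) = (ENNReal.ofReal (f y ^ q)) ^ (1 / q) := by
    rw [ENNReal.ofReal_rpow_of_nonneg (by positivity) hα.le, ← Real.rpow_mul hf0, mul_one_div_cancel (by linarith), Real.rpow_one]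
  rw [h3]
  calc _ ≤ (slice R q f ‖y‖ * ENNReal.ofReal ((c * τ)⁻¹)) ^ (1 / q) := ENNReal.rpow_le_rpow h2 hα.le
    _ = (slice R q f ‖y‖) ^ (1 / q) * (ENNReal.ofReal ((c * τ)⁻¹)) ^ (1 / q) := ENNReal.mul_rpow_of_nonneg _ _ hα.le
    _ ≤ (1 + slice R q f ‖y‖) * ENNReal.ofReal (c ^ (-(1 / q)) * (R + 1) ^ (1 / q) * |y (ll hN)| ^ (-(1 / q))) := by
        gcongr
        · calc _ ≤ (1 + slice R q f ‖y‖) ^ (1 / q) := ENNReal.rpow_le_rpow le_add_self hα.le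
            _ ≤ (1 + slice R q f ‖y‖) ^ (1:ℝ) := ENNReal.rpow_le_rpow_of_exponent_le le_self_add
                (by rw [div_le_one (by linarith)]; exact hq.le)
            _ = _ := ENNReal.rpow_one _
        · rw [ENNReal.ofReal_rpow_of_nonneg (by positivity) hα.le]
          apply ENNReal.ofReal_le_ofReal
          rw [← Real.rpow_neg_one, ← Real.rpow_mul hcτ.le, neg_one_mul, hτ, Real.mul_rpow hc.le (by positivity),
            Real.div_rpow hyl'.le hyn.le, mul_assoc]
          gcongr
          rw [Real.rpow_neg hyn.le (1 / q), div_inv_eq_mul, mul_comm]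
          gcongr
          exact hy.2.le

lemma pot_cone_bound {N : ℕ} (hN : 3 ≤ N) {R q : ℝ} (hR : 1 ≤ R) (hq : 1 < q) :
    ∃ C, 0 ≤ C ∧ ∀ f : E N → ℝ, Cone R f → ∫ x in Ao N R, f x ^ q ≤ 1 → ∀ r : ℝ,
      pot ((Ao N R).indicator f) (EuclideanSpace.single (zz hN) r) ≤ C := by
  have h3 := cast3 hN
  have hR0 : 0 < R := by linarith
  obtain ⟨C0, hC0, hsl⟩ := slice_bound hN hR0 hq
  have hα0 : 0 < 1 / q := by positivity
  have hα1 : 1 / q < 1 := by rw [div_lt_one (by linarith)]; exact hq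
  set t := 1 - (1 - 1 / q) / (2 * ((N:ℝ) - 2)) with ht
  have ht1 : t < 1 := by
    have : 0 < (1 - 1 / q) / (2 * ((N:ℝ) - 2)) := div_pos (by linarith) (by linarith)
    linarith
  have ht0 : 0 < t := by
    have : (1 - 1 / q) / (2 * ((N:ℝ) - 2)) < 1 := by rw [div_lt_one (by linarith)]; linarith
    linarith
  have hP := Pt_sphere hN ht0 ht1
  set P := ∫⁻ ω : S N, ENNReal.ofReal (Pt t (ω : E N)) ∂(sig N) with hPd
  set C1 := C0 * (R + 1) ^ (2:ℝ) with hC1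
  have hC10 : 0 ≤ C1 := by positivity
  set Q : ℝ≥0∞ := ENNReal.ofReal C1 * P * (ENNReal.ofReal ((R + 1) ^ (N - 1)) + 1) with hQ
  have hQt : Q ≠ ∞ := by
    rw [hQ]
    exact ENNReal.mul_ne_top (ENNReal.mul_ne_top ENNReal.ofReal_ne_top hP) (by simp)
  refine ⟨Q.toReal, ENNReal.toReal_nonneg, ?_⟩
  intro f hf h1 r
  set x : E N := EuclideanSpace.single (zz hN) r with hx
  set F := (Ao N R).indicator f with hF
  have hFm := ind_meas hf.cont
  have hF0 : ∀ y, 0 ≤ F y := fun y => indicator_nonneg (fun z hz => hf.nn z (Ao_sub R hz)) y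
  unfold pot
  rw [integral_eq_lintegral_of_nonneg_ae]
  rotate_left
  · exact Filter.Eventually.of_forall fun y => mul_nonneg (K_nonneg le_rfl _) (hF0 y)
  · exact (((K_meas 0).comp (measurable_const.sub measurable_id)).mul hFm).aestronglyMeasurable
  refine ENNReal.toReal_mono hQt ?_
  have key : ∀ᵐ y : E N, ENNReal.ofReal (K 0 (x - y) * F y) ≤
      (Ao N R).indicator (fun y => ENNReal.ofReal (C1 * Pt t y) * (1 + slice R q f ‖y‖)) y := by
    filter_upwards [ae_coord] with y hy
    by_cases hyA : y ∈ Ao N R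
    · rw [indicator_of_mem hyA, hF, indicator_of_mem hyA]
      have hk := kern_bound hN hR0 hα0 hα1 (r := r) ht (Ao_sub R hyA) hy
      rw [ENNReal.ofReal_mul (K_nonneg le_rfl _)]
      calc _ ≤ ENNReal.ofReal (K 0 (x - y)) * ((1 + slice R q f ‖y‖) * ENNReal.ofReal (C0 * |y (ll hN)| ^ (-(1 / q)))) := by
            gcongr
            exact hsl f hf y hyA (hy _)
        _ = ENNReal.ofReal (C0 * (K 0 (x - y) * |y (ll hN)| ^ (-(1 / q)))) * (1 + slice R q f ‖y‖) := by
            rw [show C0 * (K 0 (x - y) * |y (ll hN)| ^ (-(1 / q))) = K 0 (x - y) * (C0 * |y (ll hN)| ^ (-(1 / q))) by ring,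
              ENNReal.ofReal_mul (K_nonneg le_rfl _)]
            ring
        _ ≤ _ := by
            have e : C0 * (K 0 (x - y) * |y (ll hN)| ^ (-(1 / q))) ≤ C1 * Pt t y := by
              rw [hC1, mul_assoc]
              exact mul_le_mul_of_nonneg_left hk hC0
            exact mul_le_mul' (ENNReal.ofReal_le_ofReal e) le_rfl
    · rw [hF, indicator_of_notMem hyA]; simp
  refine (lintegral_mono_ae key).trans ?_
  have hsm := slice_meas (q := q) hf.cont
  rw [polar_lintegral _ ?_ hN]
  swap
  · refine Measurable.indicator ?_ (Ao_meas R)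
    exact (((Pt_meas t).const_mul C1).ennreal_ofReal).mul ((hsm.comp measurable_norm).const_add 1)
  have hin : ∀ ω : S N, (∫⁻ r in Ioi (0:ℝ), ENNReal.ofReal (r ^ (N - 1)) *
      (Ao N R).indicator (fun y => ENNReal.ofReal (C1 * Pt t y) * (1 + slice R q f ‖y‖)) (r • (ω : E N))) ≤
      ENNReal.ofReal (Pt t (ω : E N)) * (ENNReal.ofReal C1 * (ENNReal.ofReal ((R + 1) ^ (N - 1)) + 1)) := by
    intro ω
    have hω : ‖(ω : E N)‖ = 1 := by simp
    have hPn := Pt_nonneg t (ω : E N)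
    calc _ ≤ ∫⁻ r in Ioi (0:ℝ), ENNReal.ofReal (C1 * Pt t (ω : E N)) * ((Ioo R (R + 1)).indicator (fun _ => ENNReal.ofReal ((R + 1) ^ (N - 1))) r +
            ENNReal.ofReal (r ^ (N - 1)) * slice R q f r) := by
          apply setLIntegral_mono' measurableSet_Ioi
          intro s hs
          have hs0 : 0 < s := hs
          have hn : ‖s • (ω : E N)‖ = s := by rw [norm_smul, hω, Real.norm_eq_abs, abs_of_pos hs0, mul_one]
          by_cases hm : s • (ω : E N) ∈ Ao N R
          · have hm' : s ∈ Ioo R (R + 1) := by have := hm; rw [Ao, annulus, mem_ofPred_eq, hn] at this; exact this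
            rw [indicator_of_mem hm, indicator_of_mem hm', hn, Pt_smul t hs0]
            have h5 : (s ^ (-t)) ^ N ≤ 1 := pow_le_one₀ (by positivity)
              (Real.rpow_le_one_of_one_le_of_nonpos (by linarith [hm'.1]) (by linarith))
            calc _ ≤ ENNReal.ofReal (s ^ (N - 1)) * (ENNReal.ofReal (C1 * Pt t (ω : E N)) * (1 + slice R q f s)) := by
                  gcongr
                  exact mul_le_of_le_one_left hPn h5
              _ = ENNReal.ofReal (C1 * Pt t (ω : E N)) * (ENNReal.ofReal (s ^ (N - 1)) + ENNReal.ofReal (s ^ (N - 1)) * slice R q f s) := by ring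
              _ ≤ _ := by
                  gcongr
                  exact hm'.2.le
          · rw [indicator_of_notMem hm, mul_zero]; exact zero_le
      _ = ENNReal.ofReal (C1 * Pt t (ω : E N)) * ((∫⁻ r in Ioi (0:ℝ), (Ioo R (R + 1)).indicator (fun _ => ENNReal.ofReal ((R + 1) ^ (N - 1))) r) +
            ∫⁻ r in Ioi (0:ℝ), ENNReal.ofReal (r ^ (N - 1)) * slice R q f r) := by
          rw [lintegral_const_mul' _ _ ENNReal.ofReal_ne_top, lintegral_add_left]
          exact measurable_const.indicator measurableSet_Ioo
      _ ≤ ENNReal.ofReal (C1 * Pt t (ω : E N)) * (ENNReal.ofReal ((R + 1) ^ (N - 1)) + 1) := by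
          gcongr
          · refine (setLIntegral_le_lintegral _ _).trans ?_
            rw [lintegral_indicator measurableSet_Ioo, setLIntegral_const, Real.volume_Ioo]
            simp
          · exact slice_total hN (by linarith) hf.cont hf.nn h1
      _ = _ := by rw [ENNReal.ofReal_mul hC10]; ring
  refine (lintegral_mono hin).trans ?_
  rw [lintegral_mul_const' _ _ (ENNReal.mul_ne_top ENNReal.ofReal_ne_top (by simp)), hQ]
  apply le_of_eq; ring

lemma ind_dec {N : ℕ} {R M : ℝ} (hR : 0 < R) {f : E N → ℝ} (hf : ContinuousOn f (Ac N R)) (hM0 : 0 ≤ M)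
    (hM : ∀ x ∈ Ac N R, |f x| ≤ M) : Dec ((Ao N R).indicator f) (M * (R + 1) ^ mm N) := by
  refine ⟨(ind_meas hf).aestronglyMeasurable, by positivity, ?_⟩
  intro y hy
  have hy0 : 0 < ‖y‖ := norm_pos_iff.2 hy
  by_cases h : y ∈ Ao N R
  · rw [indicator_of_mem h]
    calc _ ≤ M * 1 := by rw [mul_one]; exact hM y (Ao_sub R h)
      _ ≤ M * ((R + 1) ^ mm N * ‖y‖ ^ (-mm N)) := by
        gcongr
        rw [Real.rpow_neg hy0.le, ← div_eq_mul_inv, one_le_div (by positivity)]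
        exact Real.rpow_le_rpow hy0.le h.2.le (mm_pos N).le
      _ = _ := by ring
  · rw [indicator_of_notMem h]; simp; positivity

/-- sup bound for solutions with cone data of bounded `L^q` norm -/
lemma sol_sup {N : ℕ} (hN : 3 ≤ N) {R q : ℝ} (hR : 1 ≤ R) (hq : 1 < q) :
    ∃ C, 0 ≤ C ∧ ∀ f u : E N → ℝ, Cone R f → ∫ x in Ao N R, f x ^ q ≤ 1 → Sol 1 R f u →
      ∀ x ∈ Ac N R, u x ≤ C := by
  have h3 := cast3 hN
  have hR0 : 0 < R := by linarith
  have hsg := sg_pos hN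
  have hk : 0 < ((N : ℝ) - 2) * sg N := by
    have : 0 < (N:ℝ) - 2 := by linarith
    positivity
  obtain ⟨C, hC, hb⟩ := pot_cone_bound hN hR hq
  refine ⟨(((N : ℝ) - 2) * sg N)⁻¹ * C, by positivity, ?_⟩
  intro f u hf h1 hu x hx
  obtain ⟨M, hM0, hM⟩ := exists_bd hf.cont
  set F := (Ao N R).indicator f with hF
  have hD : Dec F _ := ind_dec hR0 hf.cont hM0 hM
  set V : E N → ℝ := fun x => (((N : ℝ) - 2) * sg N)⁻¹ * pot F x with hV
  have hV1 : ContDiffOn ℝ 1 V {x | x ≠ 0} := contDiffOn_const.mul (pot_contDiffOn hN hD)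
  have hF0 : ∀ y, 0 ≤ F y := fun y => indicator_nonneg (fun z hz => hf.nn z (Ao_sub R hz)) y
  have hV0 : ∀ x, 0 ≤ V x := fun x => mul_nonneg (by positivity)
    (integral_nonneg fun y => mul_nonneg (K_nonneg le_rfl _) (hF0 y))
  have hun := hu.nonneg hN hR0 zero_le_one (fun x hx => hf.nn x (Ao_sub R hx))
  have hw : ∀ x ∈ Ac N R, 0 ≤ 1 * V x + (-1) * u x := by
    have := wmp hN (Ao_open (N := N) R) (Ao_bounded R) (w := fun x => 1 * V x + (-1) * u x) (c := 0) le_rfl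
      ((contDiffOn_const.mul (hV1.mono (Ao_sub_ne hR0))).add (contDiffOn_const.mul (hu.c1A hR0)))
      (by rw [closure_Ao hR0]
          exact (continuousOn_const.mul (hV1.continuousOn.mono fun _ hx => Ac_ne hR0 hx)).add (continuousOn_const.mul (hu.contA hR0))) ?_ ?_
    · rwa [closure_Ao hR0] at this
    · rw [closure_Ao hR0]
      intro y hy hy'
      rw [hu.bc y (Ac_not_Ao hy hy')]
      have := hV0 y
      simpa using this
    · intro φ hφ hφ0
      rw [pair_lin (Ao_open R) (hV1.mono (Ao_sub_ne hR0)) (hu.c1A hR0) _ _ 0 hφ]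
      have hw := hu.weak φ hφ
      have i1 := integrable_pair (Ao_open R) (hu.c1A hR0) hφ
      have i2 := integrable_mul_test (hu.c1A hR0).continuousOn hφ
      rw [integral_add i1 (i2.const_mul 1), integral_const_mul, one_mul] at hw
      have e1 : ∀ x, inner ℝ (gradient V x) (gradient φ x) + 0 * (V x * φ x)
          = (((N : ℝ) - 2) * sg N)⁻¹ * vot F x (gradient φ x) := by
        intro x
        by_cases hx : x ∈ tsupport φ
        · have hx0 : x ≠ 0 := Ao_sub_ne hR0 (hφ.sub hx)
          rw [← fderiv_eq_inner, ((pot_hasFDerivAt hN hD hx0).const_mul _).fderiv]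
          simp
        · rw [grad_zero_of_not_mem hx]; simp [image_eq_zero_of_notMem_tsupport hx]
      have key := pot_weak hN hD (δ := R / 2) (B := R + 1) (by positivity) (by positivity) hφ.c1 hφ.cpt
        (fun x hx => by have := hφ.sub hx; exact ⟨by linarith [this.1], this.2.le⟩)
      have e2 : ∫ x, (inner ℝ (gradient V x) (gradient φ x) + 0 * (V x * φ x)) = ∫ x, f x * φ x := by
        simp_rw [e1]
        rw [integral_const_mul, key, ← mul_assoc, inv_mul_cancel₀ hk.ne', one_mul]
        congr 1; ext x
        by_cases hx : x ∈ tsupport φ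
        · rw [hF, indicator_of_mem (hφ.sub hx)]
        · simp [image_eq_zero_of_notMem_tsupport hx]
      have e3 : ∫ x, (inner ℝ (gradient u x) (gradient φ x) + 0 * (u x * φ x)) = ∫ x, inner ℝ (gradient u x) (gradient φ x) := by
        congr 1; ext x; ring
      rw [e2, e3]
      have := integral_mul_test_nonneg hφ hφ0 (fun x hx => hun x (Ao_sub R hx))
      linarith
  set y : E N := EuclideanSpace.single (zz hN) ‖x‖ with hy
  have hyn : ‖y‖ = ‖x‖ := by simp [hy]
  have hyA : y ∈ Ac N R := by
    show R ≤ _ ∧ _ ≤ R + 1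
    rw [hyn]; exact hx
  have hyl : lastCoord y = 0 := by
    rw [lastCoord_ll hN, hy]
    simp [(zz_ne hN).symm]
  have h5 := (hu.cone hN hR0 zero_le_one hf).mono y hyA x hx hyn (by rw [hyl]; simp)
  have h6 := hw y hyA
  have h7 : V y ≤ (((N : ℝ) - 2) * sg N)⁻¹ * C := by
    simp only [hV]
    gcongr
    exact hb f hf h1 _
  linarith

end Ann
end
end

section
open MeasureTheory Real Set
open scoped ENNReal NNReal Topology
noncomputable section
namespace Ann

def Hn {N : ℕ} (R : ℝ) (u : E N → ℝ) : ℝ := ∫ x in Ao N R, (‖gradient u x‖ ^ 2 + u x ^ 2)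
def IP {N : ℕ} (R p : ℝ) (u : E N → ℝ) : ℝ := ∫ x in Ao N R, u x ^ p
def qc (p : ℝ) : ℝ := p / (p - 1)
def phi {N : ℕ} (R p : ℝ) (u : E N → ℝ) (x : E N) : ℝ := u x ^ (p - 1) * IP R p u ^ (-(1 - 1 / p))

lemma ae_Ao {N : ℕ} {R : ℝ} {P : E N → Prop} (h : ∀ x ∈ Ao N R, P x) : ∀ᵐ x ∂(volume.restrict (Ao N R)), P x :=
  ae_restrict_of_forall_mem (Ao_meas R) h

lemma qc_gt {p : ℝ} (hp : 2 < p) : 1 < qc p := by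
  unfold qc; rw [lt_div_iff₀ (by linarith)]; linarith

lemma qc_conj {p : ℝ} (hp : 2 < p) : (qc p).HolderConjugate p := by
  rw [Real.holderConjugate_iff]
  refine ⟨qc_gt hp, ?_⟩
  unfold qc
  have : p - 1 ≠ 0 := by linarith
  field_simp; ring

lemma pow_cont {N : ℕ} {R a : ℝ} (ha : 0 ≤ a) {u : E N → ℝ} (hu : ContinuousOn u (Ac N R)) :
    ContinuousOn (fun x => u x ^ a) (Ac N R) := hu.rpow_const fun _ _ => Or.inr ha

lemma pair_le {N : ℕ} {R : ℝ} (hR : 0 < R) {f u v : E N → ℝ} (hu : Sol 1 R f u)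
    (hf : ContinuousOn f (Ac N R)) (hv : ContDiffOn ℝ 1 v {x | x ≠ 0})
    (hv0 : ∀ x, (‖x‖ = R ∨ ‖x‖ = R + 1) → v x = 0) (hvn : ∀ x ∈ Ac N R, 0 ≤ v x) (l : ℝ) :
    2 * l * (∫ x in Ao N R, f x * v x) ≤ Hn R u + l ^ 2 * Hn R v := by
  obtain ⟨cu, cgu⟩ := contOn_ne_Ac hR hu.c1
  obtain ⟨cv, cgv⟩ := contOn_ne_Ac hR hv
  rw [← hu.test_nonneg hR hf hv hv0 hvn, Hn, Hn, ← integral_const_mul, ← integral_const_mul, ← integral_add]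
  · apply integral_mono
    · exact intOn_Ao (continuousOn_const.mul ((cgu.inner cgv).add (continuousOn_const.mul (cu.mul cv))))
    · exact (intOn_Ao ((cgu.norm.pow 2).add (cu.pow 2))).add ((intOn_Ao ((cgv.norm.pow 2).add (cv.pow 2))).const_mul _)
    · intro x
      dsimp only
      have h1 : 0 ≤ ‖gradient u x - l • gradient v x‖ ^ 2 := by positivity
      rw [norm_sub_sq_real, real_inner_smul_right, norm_smul, mul_pow, Real.norm_eq_abs, sq_abs] at h1
      nlinarith [sq_nonneg (u x - l * v x)]
  · exact intOn_Ao ((cgu.norm.pow 2).add (cu.pow 2))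
  · exact (intOn_Ao ((cgv.norm.pow 2).add (cv.pow 2))).const_mul _

lemma energy {N : ℕ} (hN : 3 ≤ N) {R : ℝ} (hR : 0 < R) {f u : E N → ℝ} (hu : Sol 1 R f u) (hf : Cone R f) :
    Hn R u = ∫ x in Ao N R, f x * u x := by
  rw [← hu.test_nonneg hR hf.cont hu.c1 hu.bc (hu.cone hN hR zero_le_one hf).nn, Hn]
  congr 1; ext x
  rw [real_inner_self_eq_norm_sq]; ring

lemma memLp_Ao {N : ℕ} {R : ℝ} {u : E N → ℝ} (hu : ContinuousOn u (Ac N R)) (p : ℝ≥0∞) :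
    MemLp u p (volume.restrict (Ao N R)) := by
  obtain ⟨M, hM0, hM⟩ := exists_bd hu
  have : IsFiniteMeasure (volume.restrict (Ao N R)) := ⟨by
    rw [Measure.restrict_apply_univ]; exact (Ao_bounded R).measure_lt_top⟩
  exact MemLp.of_bound ((hu.mono (Ao_sub R)).aestronglyMeasurable (Ao_meas R)) M (ae_Ao fun x hx => hM x (Ao_sub R hx))

lemma holder {N : ℕ} {R p : ℝ} (hp : 2 < p) {f u : E N → ℝ} (hf : Cone R f) (hu : Cone R u) (h1 : IP R (qc p) f = 1) :
    ∫ x in Ao N R, f x * u x ≤ IP R p u ^ (1 / p) := by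
  have := integral_mul_le_Lp_mul_Lq_of_nonneg (μ := volume.restrict (Ao N R)) (qc_conj hp) (f := f) (g := u)
    (ae_Ao fun x hx => hf.nn x (Ao_sub R hx)) (ae_Ao fun x hx => hu.nn x (Ao_sub R hx))
    (memLp_Ao hf.cont _) (memLp_Ao hu.cont _)
  have h1' : ∫ x in Ao N R, f x ^ (qc p) = 1 := h1
  rw [h1', Real.one_rpow, one_mul] at this
  exact this

lemma IP_nonneg {N : ℕ} {R p : ℝ} {u : E N → ℝ} (hu : ∀ x ∈ Ac N R, 0 ≤ u x) : 0 ≤ IP R p u :=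
  setIntegral_nonneg (Ao_meas R) fun x hx => Real.rpow_nonneg (hu x (Ao_sub R hx)) _

lemma phi_cone {N : ℕ} {R p : ℝ} (hp : 2 < p) {u : E N → ℝ} (hu : Cone R u) : Cone R (phi R p u) := by
  have h0 := IP_nonneg (p := p) hu.nn
  refine ⟨(pow_cont (by linarith) hu.cont).mul continuousOn_const, ?_, ?_⟩
  · intro x hx
    exact mul_nonneg (Real.rpow_nonneg (hu.nn x hx) _) (Real.rpow_nonneg h0 _)
  · intro x hx y hy hxy hl
    unfold phi
    have := hu.mono x hx y hy hxy hl
    have := hu.nn y hy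
    have h5 : 0 ≤ p - 1 := by linarith
    have := Real.rpow_nonneg h0 (-(1 - 1 / p))
    gcongr

lemma phi_one {N : ℕ} {R p : ℝ} (hp : 2 < p) {u : E N → ℝ} (hu : Cone R u) (hI : 0 < IP R p u) :
    IP R (qc p) (phi R p u) = 1 := by
  have hp1 : p - 1 ≠ 0 := by linarith
  have hp0 : p ≠ 0 := by linarith
  have e : ∀ x ∈ Ao N R, phi R p u x ^ (qc p) = u x ^ p * (IP R p u)⁻¹ := by
    intro x hx
    have h0 := hu.nn x (Ao_sub R hx)
    unfold phi
    rw [Real.mul_rpow (Real.rpow_nonneg h0 _) (Real.rpow_nonneg hI.le _), ← Real.rpow_mul h0, ← Real.rpow_mul hI.le,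
      ← Real.rpow_neg_one]
    congr 2
    · unfold qc; field_simp
    · unfold qc; field_simp
  rw [IP, setIntegral_congr_fun (Ao_meas R) e, integral_mul_const]
  exact mul_inv_cancel₀ hI.ne'

lemma phi_pair {N : ℕ} {R p : ℝ} (hp : 2 < p) {u : E N → ℝ} (hu : Cone R u) (hI : 0 < IP R p u) :
    ∫ x in Ao N R, phi R p u x * u x = IP R p u ^ (1 / p) := by
  have e : ∀ x ∈ Ao N R, phi R p u x * u x = u x ^ p * IP R p u ^ (-(1 - 1 / p)) := by
    intro x hx
    have h0 := hu.nn x (Ao_sub R hx)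
    unfold phi
    have := Real.rpow_add_one' h0 (y := p - 1) (by linarith)
    rw [sub_add_cancel] at this
    rw [this]; ring
  rw [setIntegral_congr_fun (Ao_meas R) e, integral_mul_const]
  have : IP R p u ^ (1 / p) = IP R p u ^ (1:ℝ) * IP R p u ^ (-(1 - 1 / p)) := by
    rw [← Real.rpow_add hI]; congr 1; ring
  rw [this, Real.rpow_one]; rfl

/-- admissible pairs for the dual problem -/
structure Adm {N : ℕ} (R p : ℝ) (f u : E N → ℝ) : Prop where
  cone : Cone R f
  one : IP R (qc p) f = 1
  sol : Sol 1 R f u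

lemma phi_step {N : ℕ} (hN : 3 ≤ N) {R p : ℝ} (hR : 0 < R) (hp : 2 < p) {w v : E N → ℝ} (hwC : Cone R w)
    (hw : ContDiffOn ℝ 1 w {x | x ≠ 0}) (hw0 : ∀ x, (‖x‖ = R ∨ ‖x‖ = R + 1) → w x = 0)
    (hI : 0 < IP R p w) (hv : Sol 1 R (phi R p w) v) (l : ℝ) :
    2 * l * IP R p w ^ (1 / p) ≤ (∫ x in Ao N R, phi R p w x * v x) + l ^ 2 * Hn R w := by
  have hC := phi_cone hp hwC
  rw [← phi_pair hp hwC hI, ← energy hN hR hv hC]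
  exact pair_le hR hv hC.cont hw hw0 hwC.nn l

def Jset (N : ℕ) (R p : ℝ) : Set ℝ := {j | ∃ f u : E N → ℝ, Adm R p f u ∧ j = ∫ x in Ao N R, f x * u x}

lemma Jset_bdd {N : ℕ} (hN : 3 ≤ N) {R p : ℝ} (hR : 1 ≤ R) (hp : 2 < p) : BddAbove (Jset N R p) := by
  have hR0 : 0 < R := by linarith
  have hq := qc_gt hp
  obtain ⟨C, hC, hb⟩ := sol_sup (N := N) hN hR hq
  refine ⟨(∫ x in Ao N R, C ^ p) ^ (1 / p), ?_⟩
  rintro j ⟨f, u, h, rfl⟩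
  have hu := h.sol.cone hN hR0 zero_le_one h.cone
  refine (holder hp h.cone hu h.one).trans ?_
  apply Real.rpow_le_rpow (IP_nonneg hu.nn) _ (by positivity)
  unfold IP
  apply setIntegral_mono_on (intOn_Ao (pow_cont (by linarith) hu.cont)) (intOn_Ao continuousOn_const) (Ao_meas R)
  intro x hx
  exact Real.rpow_le_rpow (hu.nn x (Ao_sub R hx)) (hb f u h.cone h.one.le h.sol x (Ao_sub R hx)) (by linarith)

lemma exists_subseq {N : ℕ} {R D : ℝ} (hR : 0 < R) {v : ℕ → E N → ℝ} (hv : ∀ n, ContDiffOn ℝ 1 (v n) {x | x ≠ 0})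
    (hD : ∀ n, ∀ x : E N, R / 2 ≤ ‖x‖ → ‖x‖ ≤ 2 * R + 2 → |v n x| ≤ D ∧ ‖gradient (v n) x‖ ≤ D) :
    ∃ (w : E N → ℝ) (φ : ℕ → ℕ), StrictMono φ ∧ ContinuousOn w (Ac N R) ∧
      ∀ x ∈ Ac N R, Filter.Tendsto (fun n => v (φ n) x) Filter.atTop (𝓝 (w x)) := by
  classical
  have hcs : CompactSpace (Ac N R) := isCompact_iff_compactSpace.1 (Ac_compact R)
  have hAs : ∀ x ∈ Ac N R, R / 2 ≤ ‖x‖ ∧ ‖x‖ ≤ 2 * R + 2 := fun x hx => ⟨by linarith [hx.1], by linarith [hx.2]⟩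
  have hc : ∀ n, ContinuousOn (v n) (Ac N R) := fun n => (contOn_ne_Ac hR (hv n)).1
  let V : ℕ → BoundedContinuousFunction (Ac N R) ℝ := fun n =>
    BoundedContinuousFunction.mkOfCompact ⟨(Ac N R).domRestrict (v n), (hc n).domRestrict⟩
  have hV : ∀ n x, V n x = v n x := fun n x => rfl
  have hcomp := BoundedContinuousFunction.arzela_ascoli (Icc (-D) D) isCompact_Icc (range V) ?_ ?_
  · obtain ⟨W, -, φ, hφ, hlim⟩ := hcomp.tendsto_subseq (x := V) (fun n => subset_closure ⟨n, rfl⟩)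
    refine ⟨fun x => if h : x ∈ Ac N R then W ⟨x, h⟩ else 0, φ, hφ, ?_, ?_⟩
    · rw [continuousOn_iff_continuous_domRestrict]
      convert W.continuous using 1
      ext x
      simp
    · intro x hx
      simp only [dif_pos hx]
      exact (BoundedContinuousFunction.tendsto_iff_tendstoUniformly.1 hlim).tendsto_at ⟨x, hx⟩
  · rintro f x ⟨n, rfl⟩
    rw [hV]
    exact abs_le.1 (hD n x (hAs x x.2).1 (hAs x x.2).2).1
  · intro x0
    refine Metric.equicontinuousAt_of_continuity_modulus (fun x => D * dist x0 x) ?_ _ ?_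
    · have : Continuous fun x : Ac N R => D * dist x0 x := by fun_prop
      have h := this.tendsto x0
      simpa using h
    · filter_upwards [Metric.ball_mem_nhds x0 (half_pos hR)] with x hx
      rintro ⟨f, n, rfl⟩
      show dist (V n x0) (V n x) ≤ _
      rw [hV, hV]
      have hb : ∀ y ∈ Metric.ball (x0 : E N) (R / 2), R / 2 ≤ ‖y‖ ∧ ‖y‖ ≤ 2 * R + 2 := by
        intro y hy
        rw [Metric.mem_ball, dist_eq_norm] at hy
        have h1 := norm_sub_norm_le (x0 : E N) y
        have h2 := norm_sub_norm_le y (x0 : E N)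
        rw [norm_sub_rev] at h1
        have h3 := x0.2.1; have h4 := x0.2.2
        exact ⟨by linarith, by linarith⟩
      have := Convex.norm_image_sub_le_of_norm_fderiv_le (𝕜 := ℝ) (f := v n) (C := D) (s := Metric.ball (x0 : E N) (R / 2))
        (x := x0) (y := x) ?_ ?_ (convex_ball _ _) (Metric.mem_ball_self (half_pos hR)) hx
      · rw [dist_comm, dist_comm x0 x]
        exact this
      · intro y hy
        have hy0 : y ≠ 0 := norm_pos_iff.1 (lt_of_lt_of_le (half_pos hR) (hb y hy).1)
        exact ((hv n).contDiffAt (isOpen_ne.mem_nhds hy0)).differentiableAt one_ne_zero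
      · intro y hy
        rw [← norm_fderiv_grad]
        exact (hD n y (hb y hy).1 (hb y hy).2).2

lemma dual_lower {N : ℕ} (hN : 3 ≤ N) {R p : ℝ} (hR : 2 * N ≤ R) (hp : 2 < p) {w : E N → ℝ} (hwC : Cone R w)
    (hw : ContDiffOn ℝ 1 w {x | x ≠ 0}) (hw0 : ∀ x, (‖x‖ = R ∨ ‖x‖ = R + 1) → w x = 0)
    (hI : 0 < IP R p w) : (IP R p w ^ (1 / p)) ^ 2 ≤ sSup (Jset N R p) * Hn R w := by
  have h3 := cast3 hN
  have hR0 : 0 < R := by linarith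
  obtain ⟨C, hC, hex⟩ := exists_sol hN hR
  have hc := phi_cone hp hwC
  obtain ⟨v, hv, -⟩ := hex _ hc.cont
  have hJ : (∫ x in Ao N R, phi R p w x * v x) ≤ sSup (Jset N R p) :=
    le_csSup (Jset_bdd hN (by linarith) hp) ⟨_, v, ⟨hc, phi_one hp hwC hI, hv⟩, rfl⟩
  have key : ∀ l : ℝ, 0 ≤ Hn R w * (l * l) + (-2 * IP R p w ^ (1 / p)) * l + sSup (Jset N R p) := by
    intro l
    have := phi_step hN hR0 hp hwC hw hw0 hI hv l
    nlinarith
  have := discrim_le_zero key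
  unfold discrim at this
  nlinarith

lemma phi_eq {N : ℕ} {R p : ℝ} (hp : 2 < p) {u : E N → ℝ} {k : ℝ} (hk : 0 < k) (hI : IP R p u ^ (1 / p) = k)
    (h0 : 0 ≤ IP R p u) (x : E N) : phi R p u x = u x ^ (p - 1) * k ^ (-(p - 1)) := by
  unfold phi
  rw [← hI, ← Real.rpow_mul h0]
  congr 2
  field_simp

lemma improve {N : ℕ} (hN : 3 ≤ N) {R p s : ℝ} (hR : 2 * N ≤ R) (hp : 2 < p) (hs : 0 < s) :
    ∃ D, 0 ≤ D ∧ ∀ f u : E N → ℝ, Adm R p f u → s < ∫ x in Ao N R, f x * u x → ∃ g v : E N → ℝ, Adm R p g v ∧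
      (∫ x in Ao N R, f x * u x) ≤ (∫ x in Ao N R, g x * v x) ∧
      ∀ x : E N, R / 2 ≤ ‖x‖ → ‖x‖ ≤ 2 * R + 2 → |v x| ≤ D ∧ ‖gradient v x‖ ≤ D := by
  have h3 := cast3 hN
  have hR0 : 0 < R := by linarith
  obtain ⟨C, hC, hex⟩ := exists_sol hN hR
  obtain ⟨C2, hC2, hsup⟩ := sol_sup (N := N) hN (by linarith : 1 ≤ R) (qc_gt hp)
  refine ⟨C * (C2 ^ (p - 1) * s ^ (-(p - 1))), by positivity, ?_⟩
  intro f u h hJ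
  have hu := h.sol.cone hN hR0 zero_le_one h.cone
  have hh := holder hp h.cone hu h.one
  have hk : 0 < IP R p u ^ (1 / p) := by linarith
  have hI0 : 0 ≤ IP R p u := IP_nonneg hu.nn
  have hI : 0 < IP R p u := by
    rcases hI0.lt_or_eq with h | h
    · exact h
    · rw [← h, Real.zero_rpow (by positivity)] at hk; exact absurd hk (lt_irrefl _)
  have hc := phi_cone hp hu
  obtain ⟨v, hv, hb⟩ := hex _ hc.cont
  refine ⟨phi R p u, v, ⟨hc, phi_one hp hu hI, hv⟩, ?_, ?_⟩
  · have := phi_step hN hR0 hp hu h.sol.c1 h.sol.bc hI hv 1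
    rw [energy hN hR0 h.sol h.cone] at this
    linarith
  · apply hb _ (by positivity)
    intro x hx
    rw [abs_of_nonneg (hc.nn x hx), phi_eq hp hk rfl hI0]
    have h1 := hu.nn x hx
    have h2 := hsup f u h.cone h.one.le h.sol x hx
    have h5 : 0 ≤ p - 1 := by linarith
    have h6 : (IP R p u ^ (1 / p)) ^ (-(p - 1)) ≤ s ^ (-(p - 1)) :=
      Real.rpow_le_rpow_of_nonpos hs (by linarith) (by linarith)
    gcongr

end Ann
end
end

section
open MeasureTheory Real Set
open scoped ENNReal NNReal Topology
noncomputable section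
namespace Ann

lemma Sol.congr_rhs {N : ℕ} {c R : ℝ} {f g u : E N → ℝ} (hu : Sol c R f u) (h : ∀ x ∈ Ao N R, f x = g x) :
    Sol c R g u := by
  refine ⟨hu.c1, hu.bc, ?_⟩
  intro φ hφ
  rw [hu.weak φ hφ]
  congr 1; ext x
  by_cases hx : x ∈ Ao N R
  · rw [h x hx]
  · have : φ x = 0 := image_eq_zero_of_notMem_tsupport fun hh => hx (hφ.sub hh)
    rw [this, mul_zero, mul_zero]

lemma eq_of_pair {N : ℕ} {R : ℝ} (hR : 0 < R) {f u v : E N → ℝ} (hu : Sol 1 R f u)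
    (hf : ContinuousOn f (Ac N R)) (hv : ContDiffOn ℝ 1 v {x | x ≠ 0})
    (hv0 : ∀ x, (‖x‖ = R ∨ ‖x‖ = R + 1) → v x = 0) (hvn : ∀ x ∈ Ac N R, 0 ≤ v x)
    (h : Hn R u + Hn R v ≤ 2 * ∫ x in Ao N R, f x * v x) : ∀ x ∈ Ao N R, u x = v x := by
  obtain ⟨cu, cgu⟩ := contOn_ne_Ac hR hu.c1
  obtain ⟨cv, cgv⟩ := contOn_ne_Ac hR hv
  have i1 : IntegrableOn (fun x => ‖gradient u x‖ ^ 2 + u x ^ 2) (Ao N R) := intOn_Ao ((cgu.norm.pow 2).add (cu.pow 2))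
  have i2 : IntegrableOn (fun x => ‖gradient v x‖ ^ 2 + v x ^ 2) (Ao N R) := intOn_Ao ((cgv.norm.pow 2).add (cv.pow 2))
  have i3 : IntegrableOn (fun x => inner ℝ (gradient u x) (gradient v x) + 1 * (u x * v x)) (Ao N R) :=
    intOn_Ao ((cgu.inner cgv).add (continuousOn_const.mul (cu.mul cv)))
  have i4 : IntegrableOn (fun x => (u x - v x) ^ 2) (Ao N R) := intOn_Ao ((cu.sub cv).pow 2)
  have i12 : IntegrableOn (fun x => (‖gradient u x‖ ^ 2 + u x ^ 2) + (‖gradient v x‖ ^ 2 + v x ^ 2)) (Ao N R) := i1.add i2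
  rw [← hu.test_nonneg hR hf hv hv0 hvn] at h
  have hle : ∫ x in Ao N R, (u x - v x) ^ 2 ≤ 0 := by
    have : ∫ x in Ao N R, (u x - v x) ^ 2 ≤ ∫ x in Ao N R, ((‖gradient u x‖ ^ 2 + u x ^ 2) + (‖gradient v x‖ ^ 2 + v x ^ 2)
        - 2 * (inner ℝ (gradient u x) (gradient v x) + 1 * (u x * v x))) := by
      refine integral_mono i4 (i12.sub (i3.const_mul 2)) ?_
      intro x
      dsimp only
      have h1 : 0 ≤ ‖gradient u x - gradient v x‖ ^ 2 := by positivity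
      rw [norm_sub_sq_real] at h1
      nlinarith
    have e : (∫ x in Ao N R, ((‖gradient u x‖ ^ 2 + u x ^ 2) + (‖gradient v x‖ ^ 2 + v x ^ 2)
        - 2 * (inner ℝ (gradient u x) (gradient v x) + 1 * (u x * v x)))) = Hn R u + Hn R v -
        2 * ∫ x in Ao N R, (inner ℝ (gradient u x) (gradient v x) + 1 * (u x * v x)) := by
      rw [integral_sub i12 (i3.const_mul 2), integral_add i1 i2, integral_const_mul]; rfl
    linarith
  have h0 : ∫ x in Ao N R, (u x - v x) ^ 2 = 0 := le_antisymm hle (integral_nonneg fun x => sq_nonneg _)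
  rw [integral_eq_zero_iff_of_nonneg (fun x => sq_nonneg _) i4] at h0
  have h1 : u =ᵐ[volume.restrict (Ao N R)] v := by
    filter_upwards [h0] with x hx
    have : (u x - v x) ^ 2 = 0 := hx
    exact sub_eq_zero.1 (pow_eq_zero_iff two_ne_zero |>.1 this)
  exact Measure.eqOn_open_of_ae_eq h1 (Ao_open R) (cu.mono (Ao_sub R)) (cv.mono (Ao_sub R))

lemma Cone_lim {N : ℕ} {R : ℝ} {v : ℕ → E N → ℝ} {w : E N → ℝ} (hv : ∀ n, Cone R (v n)) (hc : ContinuousOn w (Ac N R))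
    (hl : ∀ x ∈ Ac N R, Filter.Tendsto (fun n => v n x) Filter.atTop (𝓝 (w x))) : Cone R w := by
  refine ⟨hc, ?_, ?_⟩
  · intro x hx
    exact ge_of_tendsto' (hl x hx) fun n => (hv n).nn x hx
  · intro x hx y hy h1 h2
    exact le_of_tendsto_of_tendsto' (hl y hy) (hl x hx) fun n => (hv n).mono x hx y hy h1 h2

lemma lim_int {N : ℕ} {R D : ℝ} {F : ℕ → E N → ℝ} {w : E N → ℝ} (hc : ∀ n, ContinuousOn (F n) (Ac N R))
    (hD : ∀ n, ∀ x ∈ Ac N R, |F n x| ≤ D)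
    (hl : ∀ x ∈ Ac N R, Filter.Tendsto (fun n => F n x) Filter.atTop (𝓝 (w x))) :
    Filter.Tendsto (fun n => ∫ x in Ao N R, F n x) Filter.atTop (𝓝 (∫ x in Ao N R, w x)) := by
  apply tendsto_integral_of_dominated_convergence (fun _ => D)
  · intro n
    exact (intOn_Ao (hc n)).aestronglyMeasurable
  · exact intOn_Ao continuousOn_const
  · intro n
    exact ae_Ao fun x hx => hD n x (Ao_sub R hx)
  · exact ae_Ao fun x hx => hl x (Ao_sub R hx)

lemma pos_of_rpow {a p s : ℝ} (ha : 0 ≤ a) (hp : 0 < p) (hs : 0 < s) (h : s ≤ a ^ (1 / p)) : 0 < a := by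
  rcases ha.lt_or_eq with h1 | h1
  · exact h1
  · rw [← h1, Real.zero_rpow (by positivity)] at h; linarith

theorem dual {N : ℕ} (hN : 3 ≤ N) {R p : ℝ} (hR : 2 * N ≤ R) (hp : 2 < p) {w0 : E N → ℝ} (hwC : Cone R w0)
    (hw : ContDiffOn ℝ 1 w0 {x | x ≠ 0}) (hw0 : ∀ x, (‖x‖ = R ∨ ‖x‖ = R + 1) → w0 x = 0)
    (hI : 0 < IP R p w0) :
    ∃ (S : ℝ) (u : E N → ℝ), 0 < S ∧ Cone R u ∧ Sol 1 R (fun x => u x ^ (p - 1) * S ^ (-(p - 1))) u ∧ IP R p u ^ (1 / p) = S ∧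
      (IP R p w0 ^ (1 / p)) ^ 2 ≤ S * Hn R w0 := by
  have h3 := cast3 hN
  have hR0 : 0 < R := by linarith
  have hR1 : 1 ≤ R := by linarith
  have hp0 : 0 < p := by linarith
  have hbdd := Jset_bdd (N := N) hN hR1 hp
  have hlow := dual_lower hN hR hp hwC hw hw0 hI
  set S := sSup (Jset N R p) with hS
  have hle : ∀ f u : E N → ℝ, Adm R p f u → (∫ x in Ao N R, f x * u x) ≤ S := fun f u h =>
    le_csSup hbdd ⟨f, u, h, rfl⟩
  have hSpos : 0 < S := by
    have h1 : 0 ≤ Hn R w0 := integral_nonneg fun x => by positivity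
    have h2 : 0 < (IP R p w0 ^ (1 / p)) ^ 2 := by positivity
    by_contra hcon
    push Not at hcon
    nlinarith
  obtain ⟨C, hC, hex⟩ := exists_sol hN hR
  have hne : (Jset N R p).Nonempty := by
    have hc := phi_cone hp hwC
    obtain ⟨v, hv, -⟩ := hex _ hc.cont
    exact ⟨_, _, v, ⟨hc, phi_one hp hwC hI, hv⟩, rfl⟩
  obtain ⟨D, hD0, himp⟩ := improve (N := N) hN hR hp (half_pos hSpos)
  have hseq : ∀ n : ℕ, ∃ g v : E N → ℝ, Adm R p g v ∧ S - S / 2 * (1 / ((n:ℝ) + 1)) < (∫ x in Ao N R, g x * v x) ∧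
      ∀ x : E N, R / 2 ≤ ‖x‖ → ‖x‖ ≤ 2 * R + 2 → |v x| ≤ D ∧ ‖gradient v x‖ ≤ D := by
    intro n
    have hpos : 0 < 1 / ((n:ℝ) + 1) := by positivity
    have hle1 : 1 / ((n:ℝ) + 1) ≤ 1 := by
      rw [div_le_one (by positivity)]; linarith [(Nat.cast_nonneg n : (0:ℝ) ≤ n)]
    obtain ⟨j, ⟨f, u, hfu, rfl⟩, hj⟩ := exists_lt_of_lt_csSup hne (show S - S / 2 * (1 / ((n:ℝ) + 1)) < sSup (Jset N R p) by
      rw [← hS]; nlinarith)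
    obtain ⟨g, v, hgv, h1, h2⟩ := himp f u hfu (by nlinarith)
    exact ⟨g, v, hgv, by linarith, h2⟩
  choose g v hgv hJ hb using hseq
  obtain ⟨w, φ, hφ, hwc, hlim⟩ := exists_subseq hR0 (fun n => (hgv n).sol.c1) hb
  have hvC : ∀ n, Cone R (v n) := fun n => (hgv n).sol.cone hN hR0 zero_le_one (hgv n).cone
  have hwCone : Cone R w := Cone_lim (fun n => hvC (φ n)) hwc hlim
  have hvD : ∀ n, ∀ x ∈ Ac N R, |v n x| ≤ D := fun n x hx => (hb n x (by linarith [hx.1]) (by linarith [hx.2])).1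
  have hIlim : Filter.Tendsto (fun n => IP R p (v (φ n))) Filter.atTop (𝓝 (IP R p w)) := by
    apply lim_int (D := D ^ p) (fun n => pow_cont hp0.le (hvC _).cont)
    · intro n x hx
      have h0 := (hvC (φ n)).nn x hx
      rw [abs_of_nonneg (by positivity)]
      exact Real.rpow_le_rpow h0 ((le_abs_self _).trans (hvD _ x hx)) hp0.le
    · intro x hx
      exact (hlim x hx).rpow_const (Or.inr hp0.le)
  have hIlim2 := hIlim.rpow_const (p := 1 / p) (Or.inr (by positivity))
  have hseqlim : Filter.Tendsto (fun n : ℕ => S - S / 2 * (1 / ((φ n:ℝ) + 1))) Filter.atTop (𝓝 S) := by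
    have h1 := (tendsto_one_div_add_atTop_nhds_zero_nat (𝕜 := ℝ)).comp hφ.tendsto_atTop
    have h2 := (h1.const_mul (S / 2)).const_sub S
    rw [mul_zero, sub_zero] at h2
    exact h2
  have hkS : S ≤ IP R p w ^ (1 / p) := by
    refine le_of_tendsto_of_tendsto' hseqlim hIlim2 fun n => ?_
    exact (hJ (φ n)).le.trans (holder hp (hgv _).cone (hvC _) (hgv _).one)
  have hIw : 0 < IP R p w := pos_of_rpow (IP_nonneg hwCone.nn) hp0 hSpos hkS
  -- first step
  have hhC := phi_cone hp hwCone
  obtain ⟨z, hz, -⟩ := hex _ hhC.cont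
  have hAz : Adm R p (phi R p w) z := ⟨hhC, phi_one hp hwCone hIw, hz⟩
  have hpl : Filter.Tendsto (fun n => ∫ x in Ao N R, phi R p w x * v (φ n) x) Filter.atTop
      (𝓝 (∫ x in Ao N R, phi R p w x * w x)) := by
    obtain ⟨M, hM0, hM⟩ := exists_bd hhC.cont
    apply lim_int (D := M * D) (fun n => hhC.cont.mul (hvC _).cont)
    · intro n x hx
      rw [Pi.mul_apply, abs_mul]
      exact mul_le_mul (hM x hx) (hvD _ x hx) (abs_nonneg _) hM0
    · intro x hx
      exact (hlim x hx).const_mul _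
  rw [phi_pair hp hwCone hIw] at hpl
  have hJh : S ≤ ∫ x in Ao N R, phi R p w x * z x := by
    have : IP R p w ^ (1 / p) ≤ ((∫ x in Ao N R, phi R p w x * z x) + S) / 2 := by
      refine le_of_tendsto' hpl fun n => ?_
      have h1 := pair_le hR0 hz hhC.cont (hgv (φ n)).sol.c1 (hgv (φ n)).sol.bc (hvC (φ n)).nn 1
      rw [energy hN hR0 hz hhC, energy hN hR0 (hgv (φ n)).sol (hgv (φ n)).cone] at h1
      have h2 := hle _ _ (hgv (φ n))
      linarith
    linarith
  have hzC : Cone R z := hz.cone hN hR0 zero_le_one hhC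
  have hk : S ≤ IP R p z ^ (1 / p) := hJh.trans (holder hp hhC hzC hAz.one)
  have hIz : 0 < IP R p z := pos_of_rpow (IP_nonneg hzC.nn) hp0 hSpos hk
  have hgC := phi_cone hp hzC
  obtain ⟨y, hy, -⟩ := hex _ hgC.cont
  have hAy : Adm R p (phi R p z) y := ⟨hgC, phi_one hp hzC hIz, hy⟩
  have hyle := hle _ _ hAy
  have hzle := hle _ _ hAz
  have h2 := phi_step hN hR0 hp hzC hz.c1 hz.bc hIz hy 1
  rw [energy hN hR0 hz hhC] at h2
  have hkeq : IP R p z ^ (1 / p) = S := by linarith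
  have hyz : ∀ x ∈ Ao N R, y x = z x := by
    apply eq_of_pair hR0 hy hgC.cont hz.c1 hz.bc hzC.nn
    rw [phi_pair hp hzC hIz, energy hN hR0 hz hhC, energy hN hR0 hy hgC]
    linarith
  refine ⟨S, y, hSpos, hy.cone hN hR0 zero_le_one hgC, hy.congr_rhs ?_, ?_, hlow⟩
  · intro x hx
    rw [phi_eq hp hSpos hkeq hIz.le, hyz x hx]
  · rw [← hkeq]
    congr 1
    exact setIntegral_congr_fun (Ao_meas R) fun x hx => by rw [hyz x hx]

end Ann
end
end

section
open MeasureTheory Real Set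
open scoped ENNReal NNReal Topology
noncomputable section
namespace Ann

lemma Ac_unique {N : ℕ} {R : ℝ} (hR : 0 < R) : UniqueDiffOn ℝ (Ac N R) := by
  intro x hx
  have hx0 : 0 < ‖x‖ := hR.trans_le hx.1
  set c : E N := ((R + 1 / 2) / ‖x‖) • x with hc
  have hcn : ‖c‖ = R + 1 / 2 := by
    rw [hc, norm_smul, Real.norm_eq_abs, abs_of_pos (by positivity)]; field_simp
  have hsub : Metric.closedBall c (1 / 2) ⊆ Ac N R := by
    intro y hy
    rw [Metric.mem_closedBall, dist_eq_norm] at hy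
    have h1 := norm_sub_norm_le y c
    have h2 := norm_sub_norm_le c y
    rw [norm_sub_rev] at h2
    exact ⟨by linarith, by linarith⟩
  have hmem : x ∈ Metric.closedBall c (1 / 2) := by
    rw [Metric.mem_closedBall, dist_eq_norm]
    have : x - c = (1 - (R + 1 / 2) / ‖x‖) • x := by rw [hc, sub_smul, one_smul]
    rw [this, norm_smul, Real.norm_eq_abs]
    have e : |1 - (R + 1 / 2) / ‖x‖| * ‖x‖ = |‖x‖ - (R + 1 / 2)| := by
      rw [← abs_of_pos hx0, ← abs_mul, abs_of_pos hx0]; congr 1; field_simp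
    rw [e, abs_le]
    exact ⟨by linarith [hx.1], by linarith [hx.2]⟩
  exact (uniqueDiffOn_convex (convex_closedBall c (1 / 2))
    ⟨c, Metric.ball_subset_interior_closedBall (Metric.mem_ball_self (by norm_num))⟩ x hmem).mono hsub

lemma fdw_eq {N : ℕ} {R : ℝ} {u : E N → ℝ} {x : E N} (hx : x ∈ Ao N R) :
    fderivWithin ℝ u (Ac N R) x = fderiv ℝ u x :=
  fderivWithin_of_mem_nhds (Filter.mem_of_superset ((Ao_open R).mem_nhds hx) (Ao_sub R))

lemma ray_deriv {N : ℕ} {R : ℝ} (hR : 0 < R) {u : E N → ℝ} (hu : ContDiffOn ℝ 1 u (Ac N R)) {ω : E N} (hω : ‖ω‖ = 1)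
    (h0 : u (R • ω) = 0) {r0 : ℝ} (hr : r0 ∈ Ioo R (R + 1)) (h1 : 1 ≤ |u (r0 • ω)|) :
    1 ≤ ∫ r in R..(R + 1), ‖fderivWithin ℝ u (Ac N R) (r • ω)‖ ^ 2 := by
  have hcd : ContinuousOn (fderivWithin ℝ u (Ac N R)) (Ac N R) := hu.continuousOn_fderivWithin (Ac_unique hR) le_rfl
  have hline : Continuous fun r : ℝ => r • ω := by fun_prop
  have hn : ∀ r, 0 < r → ‖r • ω‖ = r := fun r hr => by
    rw [norm_smul, hω, mul_one, Real.norm_eq_abs, abs_of_pos hr]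
  have hmaps : MapsTo (fun r : ℝ => r • ω) (Icc R (R + 1)) (Ac N R) := by
    intro r hr
    have := hn r (hR.trans_le hr.1)
    exact ⟨by rw [this]; exact hr.1, by rw [this]; exact hr.2⟩
  have hg : ContinuousOn (fun r : ℝ => ‖fderivWithin ℝ u (Ac N R) (r • ω)‖) (Icc R (R + 1)) :=
    (hcd.comp hline.continuousOn hmaps).norm
  have hf' : ContinuousOn (fun r : ℝ => fderivWithin ℝ u (Ac N R) (r • ω) ω) (Icc R (R + 1)) :=
    (hcd.comp hline.continuousOn hmaps).clm_apply continuousOn_const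
  have hsub : Icc R r0 ⊆ Icc R (R + 1) := Icc_subset_Icc le_rfl hr.2.le
  have ftc := intervalIntegral.integral_eq_sub_of_hasDerivAt_of_le (f := fun r : ℝ => u (r • ω))
    (f' := fun r : ℝ => fderivWithin ℝ u (Ac N R) (r • ω) ω) hr.1.le
    (hu.continuousOn.comp hline.continuousOn (hmaps.mono_left hsub)) ?_ ?_
  · rw [h0, sub_zero] at ftc
    have hi1 : IntervalIntegrable (fun r : ℝ => ‖fderivWithin ℝ u (Ac N R) (r • ω)‖) volume R r0 := by
      apply ContinuousOn.intervalIntegrable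
      rw [uIcc_of_le hr.1.le]; exact hg.mono hsub
    have hi2 : IntervalIntegrable (fun r : ℝ => ‖fderivWithin ℝ u (Ac N R) (r • ω)‖) volume R (R + 1) := by
      apply ContinuousOn.intervalIntegrable
      rw [uIcc_of_le (by linarith)]; exact hg
    have hi3 : IntervalIntegrable (fun r : ℝ => ‖fderivWithin ℝ u (Ac N R) (r • ω)‖ ^ 2) volume R (R + 1) := by
      apply ContinuousOn.intervalIntegrable
      rw [uIcc_of_le (by linarith)]; exact hg.pow 2
    have a1 : |u (r0 • ω)| ≤ ∫ r in R..r0, ‖fderivWithin ℝ u (Ac N R) (r • ω)‖ := by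
      rw [← ftc, ← Real.norm_eq_abs]
      apply intervalIntegral.norm_integral_le_of_norm_le hr.1.le _ hi1
      refine Filter.Eventually.of_forall fun r hr => ?_
      have := (fderivWithin ℝ u (Ac N R) (r • ω)).le_opNorm ω
      rwa [hω, mul_one] at this
    have a2 : (∫ r in R..r0, ‖fderivWithin ℝ u (Ac N R) (r • ω)‖) ≤ ∫ r in R..(R + 1), ‖fderivWithin ℝ u (Ac N R) (r • ω)‖ :=
      intervalIntegral.integral_mono_interval le_rfl hr.1.le hr.2.le
        (Filter.Eventually.of_forall fun r => norm_nonneg _) hi2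
    have a3 : (∫ r in R..(R + 1), ‖fderivWithin ℝ u (Ac N R) (r • ω)‖) ≤
        ∫ r in R..(R + 1), (1 / 2 + 1 / 2 * ‖fderivWithin ℝ u (Ac N R) (r • ω)‖ ^ 2) := by
      apply intervalIntegral.integral_mono (by linarith) hi2 (intervalIntegrable_const.add (hi3.const_mul _))
      intro r
      dsimp only
      nlinarith [sq_nonneg (‖fderivWithin ℝ u (Ac N R) (r • ω)‖ - 1)]
    rw [intervalIntegral.integral_add intervalIntegrable_const (hi3.const_mul _), intervalIntegral.integral_const,
      intervalIntegral.integral_const_mul] at a3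
    simp at a3
    linarith
  · intro r hrr
    have hmem : r • ω ∈ Ao N R := by
      have := hn r (hR.trans hrr.1)
      exact ⟨by rw [this]; exact hrr.1, by rw [this]; linarith [hrr.2, hr.2]⟩
    have hd : DifferentiableAt ℝ u (r • ω) :=
      (hu.contDiffAt (Filter.mem_of_superset ((Ao_open R).mem_nhds hmem) (Ao_sub R))).differentiableAt one_ne_zero
    rw [fdw_eq hmem]
    have hl : HasDerivAt (fun r : ℝ => r • ω) ω r := by
      have := (hasDerivAt_id r).smul_const ω
      rwa [one_smul] at this
    exact hd.hasFDerivAt.comp_hasDerivAt r hl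
  · apply ContinuousOn.intervalIntegrable
    rw [uIcc_of_le hr.1.le]; exact hf'.mono hsub

lemma polar_lower {N : ℕ} (hN : 3 ≤ N) {R : ℝ} (hR : 0 < R) {g : E N → ℝ} (hg : ContinuousOn g (Ac N R))
    (hg0 : ∀ x ∈ Ac N R, 0 ≤ g x) (h : ∀ ω : E N, ‖ω‖ = 1 → 1 ≤ ∫ r in R..(R + 1), g (r • ω)) :
    sg N * R ^ (N - 1) ≤ ∫ x in Ao N R, g x := by
  have hIntg : Integrable ((Ao N R).indicator g) := (intOn_Ao hg).integrable_indicator (Ao_meas R)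
  have h0 : 0 ≤ ∫ x in Ao N R, g x := setIntegral_nonneg (Ao_meas R) fun x hx => hg0 x (Ao_sub R hx)
  rw [← ENNReal.ofReal_le_ofReal_iff h0, ofReal_integral_eq_lintegral_ofReal (intOn_Ao hg) (ae_Ao fun x hx => hg0 x (Ao_sub R hx)),
    ← lintegral_indicator (Ao_meas R)]
  have hme : Measurable ((Ao N R).indicator fun x => ENNReal.ofReal (g x)) := by
    have : ((Ao N R).indicator fun x => ENNReal.ofReal (g x)) = fun x => ENNReal.ofReal ((Ao N R).indicator g x) := by
      ext x; by_cases hx : x ∈ Ao N R <;> simp [hx]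
    rw [this]; exact (ind_meas hg).ennreal_ofReal
  rw [polar_lintegral _ hme hN]
  have hin : ∀ ω : S N, ENNReal.ofReal (R ^ (N - 1)) ≤ ∫⁻ r in Ioi (0:ℝ), ENNReal.ofReal (r ^ (N - 1)) *
      (Ao N R).indicator (fun x => ENNReal.ofReal (g x)) (r • (ω : E N)) := by
    intro ω
    have hω : ‖(ω : E N)‖ = 1 := by simp
    have hn : ∀ r, 0 < r → ‖r • (ω : E N)‖ = r := fun r hr => by
      rw [norm_smul, hω, mul_one, Real.norm_eq_abs, abs_of_pos hr]
    have hmaps : MapsTo (fun r : ℝ => r • (ω : E N)) (Icc R (R + 1)) (Ac N R) := by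
      intro r hr
      have := hn r (hR.trans_le hr.1)
      exact ⟨by rw [this]; exact hr.1, by rw [this]; exact hr.2⟩
    have hc : ContinuousOn (fun r : ℝ => g (r • (ω : E N))) (Icc R (R + 1)) :=
      hg.comp (by fun_prop : Continuous fun r : ℝ => r • (ω : E N)).continuousOn hmaps
    have hgi : IntegrableOn (fun r : ℝ => g (r • (ω : E N))) (Ioc R (R + 1)) :=
      (hc.integrableOn_Icc).mono_set Ioc_subset_Icc_self
    have h1 := h ω hω
    rw [intervalIntegral.integral_of_le (by linarith), integral_Ioc_eq_integral_Ioo] at h1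
    have h2 : (1:ℝ≥0∞) ≤ ∫⁻ r in Ioo R (R + 1), ENNReal.ofReal (g (r • (ω : E N))) := by
      rw [← ofReal_integral_eq_lintegral_ofReal (hgi.mono_set Ioo_subset_Ioc_self)]
      · exact ENNReal.one_le_ofReal.2 h1
      · exact ae_restrict_of_forall_mem measurableSet_Ioo fun r hr => hg0 _ (hmaps (Ioo_subset_Icc_self hr))
    calc ENNReal.ofReal (R ^ (N - 1)) ≤ ENNReal.ofReal (R ^ (N - 1)) * ∫⁻ r in Ioo R (R + 1), ENNReal.ofReal (g (r • (ω : E N))) :=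
          le_mul_of_one_le_right' h2
      _ = ∫⁻ r in Ioo R (R + 1), ENNReal.ofReal (R ^ (N - 1)) * ENNReal.ofReal (g (r • (ω : E N))) :=
          (lintegral_const_mul' _ _ ENNReal.ofReal_ne_top).symm
      _ ≤ ∫⁻ r in Ioo R (R + 1), ENNReal.ofReal (r ^ (N - 1)) *
            (Ao N R).indicator (fun x => ENNReal.ofReal (g x)) (r • (ω : E N)) := by
          apply setLIntegral_mono' measurableSet_Ioo
          intro r hr
          have hrp := hn r (hR.trans hr.1)
          have hm : r • (ω : E N) ∈ Ao N R := ⟨by rw [hrp]; exact hr.1, by rw [hrp]; exact hr.2⟩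
          rw [indicator_of_mem hm]
          have := hr.1.le
          gcongr
      _ ≤ _ := lintegral_mono_set fun r hr => hR.trans hr.1
  calc ENNReal.ofReal (sg N * R ^ (N - 1)) = ∫⁻ ω : S N, ENNReal.ofReal (R ^ (N - 1)) ∂(sig N) := by
        rw [lintegral_const, sg, ENNReal.ofReal_mul measureReal_nonneg, mul_comm]
        congr 1
        rw [Measure.real, ENNReal.ofReal_toReal]
        exact (measure_lt_top _ _).ne
    _ ≤ _ := lintegral_mono hin

lemma radial_big {N : ℕ} (hN : 3 ≤ N) {R p : ℝ} (hR : 0 < R) (hp : 2 < p) {u : E N → ℝ} (hu : ContDiffOn ℝ 1 u (Ac N R))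
    (hbc : ∀ x, (‖x‖ = R ∨ ‖x‖ = R + 1) → u x = 0) (hrad : ∀ x ∈ Ao N R, ∀ y ∈ Ao N R, ‖x‖ = ‖y‖ → u x = u y)
    (hne : ∃ x ∈ Ao N R, u x ≠ 0)
    (hH : ∫ x in Ao N R, (‖fderivWithin ℝ u (Ac N R) x‖ ^ 2 + u x ^ 2) = ∫ x in Ao N R, |u x| ^ p) :
    sg N * R ^ (N - 1) ≤ ∫ x in Ao N R, |u x| ^ p := by
  have hcd : ContinuousOn (fderivWithin ℝ u (Ac N R)) (Ac N R) := hu.continuousOn_fderivWithin (Ac_unique hR) le_rfl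
  have cu := hu.continuousOn
  have hp0 : 0 < p := by linarith
  have i1 : IntegrableOn (fun x => ‖fderivWithin ℝ u (Ac N R) x‖ ^ 2) (Ao N R) := intOn_Ao (hcd.norm.pow 2)
  have i2 : IntegrableOn (fun x => u x ^ 2) (Ao N R) := intOn_Ao (cu.pow 2)
  have i3 : IntegrableOn (fun x => |u x| ^ p) (Ao N R) := intOn_Ao (pow_cont hp0.le cu.abs)
  have i12 : IntegrableOn (fun x => ‖fderivWithin ℝ u (Ac N R) x‖ ^ 2 + u x ^ 2) (Ao N R) := i1.add i2
  have hex : ∃ x ∈ Ao N R, 1 ≤ |u x| := by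
    by_contra hcon
    push Not at hcon
    have hle : ∀ t : ℝ, 0 ≤ t → t < 1 → t ^ p ≤ t ^ 2 := by
      intro t h0 h1
      rw [← Real.rpow_natCast t 2]
      exact Real.rpow_le_rpow_of_exponent_ge_of_imp h0 h1.le (by norm_num; linarith) (fun _ h => by linarith)
    have h0 : ∫ x in Ao N R, (u x ^ 2 - |u x| ^ p) = 0 := by
      apply le_antisymm
      · have h1 : ∫ x in Ao N R, (u x ^ 2 - |u x| ^ p) ≤
            ∫ x in Ao N R, ((‖fderivWithin ℝ u (Ac N R) x‖ ^ 2 + u x ^ 2) - |u x| ^ p) := by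
          apply integral_mono (i2.sub i3) (i12.sub i3)
          intro x
          have := sq_nonneg ‖fderivWithin ℝ u (Ac N R) x‖
          dsimp only
          simp only [Pi.sub_apply]
          linarith
        rw [integral_sub i12 i3, hH, sub_self] at h1
        exact h1
      · apply setIntegral_nonneg (Ao_meas R)
        intro x hx
        have := hle |u x| (abs_nonneg _) (hcon x hx)
        rw [sq_abs] at this; linarith
    rw [integral_eq_zero_iff_of_nonneg_ae] at h0
    · have h1 : (fun x => u x ^ 2 - |u x| ^ p) =ᵐ[volume.restrict (Ao N R)] fun _ => 0 := h0
      have h2 := Measure.eqOn_open_of_ae_eq h1 (Ao_open R)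
        (((cu.pow 2).sub (pow_cont hp0.le cu.abs)).mono (Ao_sub R)) continuousOn_const
      obtain ⟨x, hx, hx0⟩ := hne
      have h3 := h2 hx
      dsimp only at h3
      have h4 : 0 < |u x| := abs_pos.2 hx0
      have h5 : |u x| ^ p < |u x| ^ (2:ℝ) := Real.rpow_lt_rpow_of_exponent_gt h4 (hcon x hx) hp
      rw [Real.rpow_two, sq_abs] at h5
      linarith
    · apply ae_Ao
      intro x hx
      have := hle |u x| (abs_nonneg _) (hcon x hx)
      rw [sq_abs] at this
      show 0 ≤ u x ^ 2 - |u x| ^ p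
      linarith
    · exact i2.sub i3
  obtain ⟨x0, hx0, h1⟩ := hex
  have key := polar_lower hN hR (g := fun x => ‖fderivWithin ℝ u (Ac N R) x‖ ^ 2) (hcd.norm.pow 2)
    (fun x _ => by positivity) ?_
  · refine key.trans ?_
    rw [← hH]
    apply integral_mono i1 i12
    intro x
    have := sq_nonneg (u x)
    dsimp only
    linarith
  · intro ω hω
    have hn : ∀ r, 0 < r → ‖r • ω‖ = r := fun r hr => by
      rw [norm_smul, hω, mul_one, Real.norm_eq_abs, abs_of_pos hr]
    have hx0p : 0 < ‖x0‖ := hR.trans hx0.1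
    have e := hn _ hx0p
    apply ray_deriv hR hu hω (hbc _ (Or.inl (hn R hR))) (r0 := ‖x0‖) ⟨hx0.1, hx0.2⟩
    rw [hrad (‖x0‖ • ω) ⟨by rw [e]; exact hx0.1, by rw [e]; exact hx0.2⟩ x0 hx0 e]
    exact h1

end Ann
end
end

section
open MeasureTheory Real Set
open scoped ENNReal NNReal Topology
noncomputable section
namespace Ann

def chi (t : ℝ) : ℝ := Real.smoothTransition (2 - t ^ 2)

lemma chi_contDiff : ContDiff ℝ 1 chi := by
  unfold chi
  exact Real.smoothTransition.contDiff.comp (contDiff_const.sub (contDiff_id.pow 2))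

lemma chi_zero {t : ℝ} (h : 2 ≤ t ^ 2) : chi t = 0 := Real.smoothTransition.zero_of_nonpos (by linarith)
lemma chi_one {t : ℝ} (h : t ^ 2 ≤ 1) : chi t = 1 := Real.smoothTransition.one_of_one_le (by linarith)
lemma chi_nonneg (t : ℝ) : 0 ≤ chi t := Real.smoothTransition.nonneg _
lemma chi_le (t : ℝ) : chi t ≤ 1 := Real.smoothTransition.le_one _
lemma chi_mono {s t : ℝ} (h : |s| ≤ |t|) : chi t ≤ chi s := by
  apply Real.smoothTransition.monotone
  have := sq_le_sq.2 h
  linarith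

lemma chi_deriv_zero {t : ℝ} (h : 2 < |t|) : deriv chi t = 0 := by
  have : chi =ᶠ[𝓝 t] fun _ => 0 := by
    filter_upwards [(isOpen_lt continuous_const continuous_abs).mem_nhds h] with s hs
    apply chi_zero
    have hs' : 2 < |s| := hs
    rw [← sq_abs]; nlinarith
  rw [this.deriv_eq]; simp

lemma chi_deriv_bd : ∃ M, 0 ≤ M ∧ ∀ t, |deriv chi t| ≤ M := by
  have hc : Continuous (deriv chi) := chi_contDiff.continuous_deriv le_rfl
  obtain ⟨M, hM⟩ := (isCompact_Icc (a := (-2:ℝ)) (b := 2)).exists_bound_of_continuousOn hc.continuousOn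
  refine ⟨max M 0, le_max_right _ _, fun t => ?_⟩
  by_cases h : 2 < |t|
  · rw [chi_deriv_zero h, abs_zero]; exact le_max_right _ _
  · push Not at h
    exact (hM t (abs_le.1 h)).trans (le_max_left _ _)

def tw {N : ℕ} (R : ℝ) (x : E N) : ℝ := (‖x‖ - R) * (R + 1 - ‖x‖) * chi (lastCoord x)

lemma tw_c1 {N : ℕ} (R : ℝ) : ContDiffOn ℝ 1 (tw R : E N → ℝ) {x | x ≠ 0} := by
  have h1 : ContDiffOn ℝ 1 (fun x : E N => ‖x‖) {x | x ≠ 0} := fun x hx => (contDiffAt_norm ℝ hx).contDiffWithinAt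
  have h2 : ContDiff ℝ 1 (fun x : E N => chi (lastCoord x)) := by
    have e : (fun x : E N => chi (lastCoord x)) = fun x => chi (inner ℝ (eN N) x) := by ext x; rw [lastCoord_eq]
    rw [e]
    exact chi_contDiff.comp (contDiff_const.inner ℝ contDiff_id)
  exact ((h1.sub contDiffOn_const).mul (contDiffOn_const.sub h1)).mul h2.contDiffOn

lemma tw_bc {N : ℕ} (R : ℝ) (x : E N) (h : ‖x‖ = R ∨ ‖x‖ = R + 1) : tw R x = 0 := by
  unfold tw
  rcases h with h | h <;> rw [h] <;> ring

lemma tw_cone {N : ℕ} {R : ℝ} (hR : 0 < R) : Cone R (tw R : E N → ℝ) := by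
  refine ⟨(contOn_ne_Ac hR (tw_c1 R)).1, ?_, ?_⟩
  · intro x hx
    exact mul_nonneg (mul_nonneg (by linarith [hx.1]) (by linarith [hx.2])) (chi_nonneg _)
  · intro x hx y hy h1 h2
    unfold tw
    rw [h1]
    exact mul_le_mul_of_nonneg_left (chi_mono h2) (mul_nonneg (by linarith [hy.1]) (by linarith [hy.2]))

lemma tw_grad {N : ℕ} (hN : 3 ≤ N) {M R : ℝ} (hR : 0 < R) (hM : ∀ t, |deriv chi t| ≤ M) {x : E N} (hx : x ∈ Ao N R) :
    ‖gradient (tw R) x‖ ^ 2 + tw R x ^ 2 ≤ ({x : E N | |lastCoord x| ≤ 2}).indicator (fun _ => (M + 1) ^ 2 + 1) x := by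
  have hx0 : x ≠ 0 := Ac_ne hR (Ao_sub R hx)
  have hM0 : 0 ≤ M := (abs_nonneg _).trans (hM 0)
  have hn : HasFDerivAt (fun x : E N => ‖x‖) (fderiv ℝ (fun x : E N => ‖x‖) x) x :=
    ((contDiffAt_norm ℝ (n := 1) hx0).differentiableAt one_ne_zero).hasFDerivAt
  set n' := fderiv ℝ (fun x : E N => ‖x‖) x with hn'
  have hn1 : ‖n'‖ ≤ 1 := by
    have := norm_fderiv_le_of_lipschitz ℝ (x₀ := x) (lipschitzWith_one_norm (E := E N))
    simpa using this
  have hL : HasFDerivAt (fun x : E N => lastCoord x) (innerSL ℝ (eN N)) x := by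
    have e : (fun x : E N => lastCoord x) = fun x => innerSL ℝ (eN N) x := by ext x; rw [lastCoord_eq]; rfl
    rw [e]; exact (innerSL ℝ (eN N)).hasFDerivAt
  have hL1 : ‖innerSL ℝ (eN N)‖ = 1 := by rw [innerSL_apply_norm, eN_norm hN]
  have hb : HasFDerivAt (fun x : E N => chi (lastCoord x)) (deriv chi (lastCoord x) • innerSL ℝ (eN N)) x :=
    ((chi_contDiff.differentiable one_ne_zero).differentiableAt.hasDerivAt).comp_hasFDerivAt x hL
  have ha := (hn.sub_const R).mul (hn.const_sub (R + 1))
  have hw := ha.mul hb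
  have hwf : fderiv ℝ (tw R) x = _ := HasFDerivAt.fderiv hw
  have s0 : 0 ≤ ‖x‖ - R := by linarith [hx.1]
  have s1 : 0 ≤ R + 1 - ‖x‖ := by linarith [hx.2]
  have hprod : (‖x‖ - R) * (R + 1 - ‖x‖) ≤ 1 := by nlinarith
  have hprod0 : 0 ≤ (‖x‖ - R) * (R + 1 - ‖x‖) := mul_nonneg s0 s1
  rw [norm_fderiv_grad, hwf]
  by_cases hl : |lastCoord x| ≤ 2
  · rw [indicator_of_mem (show x ∈ {x : E N | |lastCoord x| ≤ 2} from hl)]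
    have e1 : tw R x ^ 2 ≤ 1 := by
      have h1 : tw R x ≤ 1 := mul_le_one₀ hprod (chi_nonneg _) (chi_le _)
      have h2 : 0 ≤ tw R x := mul_nonneg hprod0 (chi_nonneg _)
      nlinarith
    have e3 : ‖(‖x‖ - R) • (-n') + (R + 1 - ‖x‖) • n'‖ ≤ 1 := by
      refine (norm_add_le _ _).trans ?_
      rw [norm_smul, norm_smul, norm_neg, Real.norm_eq_abs, Real.norm_eq_abs, abs_of_nonneg s0, abs_of_nonneg s1]
      nlinarith
    have e2 : ‖((‖x‖ - R) * (R + 1 - ‖x‖)) • (deriv chi (lastCoord x) • innerSL ℝ (eN N)) +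
        chi (lastCoord x) • ((‖x‖ - R) • (-n') + (R + 1 - ‖x‖) • n')‖ ≤ M + 1 := by
      refine (norm_add_le _ _).trans ?_
      rw [norm_smul, norm_smul, norm_smul, hL1, mul_one, Real.norm_eq_abs, Real.norm_eq_abs, Real.norm_eq_abs,
        abs_of_nonneg hprod0, abs_of_nonneg (chi_nonneg _)]
      refine add_le_add ?_ (mul_le_one₀ (chi_le _) (norm_nonneg _) e3)
      calc _ ≤ 1 * M := mul_le_mul hprod (hM _) (abs_nonneg _) zero_le_one
        _ = M := one_mul M
    exact add_le_add (pow_le_pow_left₀ (norm_nonneg _) e2 2) e1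
  · rw [indicator_of_notMem (show x ∉ {x : E N | |lastCoord x| ≤ 2} from hl)]
    push Not at hl
    have hz : chi (lastCoord x) = 0 := chi_zero (by rw [← sq_abs]; nlinarith)
    rw [chi_deriv_zero hl, hz, tw, hz]
    simp

lemma vol_upper {N : ℕ} (hN : 3 ≤ N) : ∃ C, 0 < C ∧ ∀ R : ℝ, 1 ≤ R →
    volume (Ao N R ∩ {x : E N | |lastCoord x| ≤ 2}) ≤ ENNReal.ofReal (C * R ^ (N - 2)) := by
  obtain ⟨c, hc, hb⟩ := band_upper hN
  refine ⟨2 ^ (N - 1) * (c * 2), by positivity, ?_⟩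
  intro R hR
  have hR0 : 0 < R := by linarith
  have hms : MeasurableSet (Ao N R ∩ {x : E N | |lastCoord x| ≤ 2}) :=
    (Ao_meas R).inter (isClosed_le lastCoord_cont.abs continuous_const).measurableSet
  rw [← lintegral_indicator_one hms, polar_lintegral _ (measurable_one.indicator hms) hN]
  have hin : ∀ ω : S N, (∫⁻ r in Ioi (0:ℝ), ENNReal.ofReal (r ^ (N - 1)) *
      (Ao N R ∩ {x : E N | |lastCoord x| ≤ 2}).indicator 1 (r • (ω : E N))) ≤
      (band (2 / R)).indicator (fun _ => ENNReal.ofReal ((R + 1) ^ (N - 1))) ω := by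
    intro ω
    have hω : ‖(ω : E N)‖ = 1 := by simp
    have hn : ∀ r, 0 < r → ‖r • (ω : E N)‖ = r := fun r hr => by
      rw [norm_smul, hω, mul_one, Real.norm_eq_abs, abs_of_pos hr]
    calc _ ≤ ∫⁻ r in Ioi (0:ℝ), (Ioo R (R + 1)).indicator (fun _ =>
            (band (2 / R)).indicator (fun _ => ENNReal.ofReal ((R + 1) ^ (N - 1))) ω) r := by
          apply setLIntegral_mono' measurableSet_Ioi
          intro r hr
          have hr0 : 0 < r := hr
          by_cases hm : r • (ω : E N) ∈ Ao N R ∩ {x : E N | |lastCoord x| ≤ 2}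
          · have h1 : R < ‖r • (ω : E N)‖ ∧ ‖r • (ω : E N)‖ < R + 1 := hm.1
            rw [hn r hr0] at h1
            have h2 : |lastCoord (r • (ω : E N))| ≤ 2 := hm.2
            rw [lastCoord_smul, abs_mul, abs_of_pos hr0] at h2
            have h3 : ω ∈ band (2 / R) := by
              show |lastCoord (ω : E N)| ≤ 2 / R
              rw [le_div_iff₀ hR0]
              nlinarith [abs_nonneg (lastCoord (ω : E N))]
            rw [indicator_of_mem hm, indicator_of_mem (show r ∈ Ioo R (R + 1) from h1), indicator_of_mem h3, Pi.one_apply, mul_one]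
            apply ENNReal.ofReal_le_ofReal
            have := h1.2.le
            gcongr
          · rw [indicator_of_notMem hm, mul_zero]; exact bot_le
      _ ≤ ∫⁻ r, (Ioo R (R + 1)).indicator (fun _ =>
            (band (2 / R)).indicator (fun _ => ENNReal.ofReal ((R + 1) ^ (N - 1))) ω) r := setLIntegral_le_lintegral _ _
      _ = _ := by
          rw [lintegral_indicator measurableSet_Ioo, setLIntegral_const, Real.volume_Ioo]
          simp
  refine (lintegral_mono hin).trans ?_
  rw [lintegral_indicator (band_meas _), setLIntegral_const]
  calc _ ≤ ENNReal.ofReal ((R + 1) ^ (N - 1)) * ENNReal.ofReal (c * (2 / R)) :=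
        mul_le_mul' le_rfl (hb _ (by positivity))
    _ = ENNReal.ofReal ((R + 1) ^ (N - 1) * (c * (2 / R))) := (ENNReal.ofReal_mul (by positivity)).symm
    _ ≤ _ := by
      apply ENNReal.ofReal_le_ofReal
      have e : (2:ℝ) ^ (N - 1) * (c * 2) * R ^ (N - 2) = (2 * R) ^ (N - 1) * (c * (2 / R)) := by
        rw [mul_pow, show N - 1 = (N - 2) + 1 by omega, pow_succ R]
        field_simp
      rw [e]
      have : R + 1 ≤ 2 * R := by linarith
      gcongr

def core (N : ℕ) (R : ℝ) : Set (E N) := {x | (R + 1 / 4 ≤ ‖x‖ ∧ ‖x‖ ≤ R + 3 / 4) ∧ |lastCoord x| ≤ 1}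

lemma core_meas {N : ℕ} (R : ℝ) : MeasurableSet (core N R) :=
  (((isClosed_le continuous_const continuous_norm).inter (isClosed_le continuous_norm continuous_const)).inter
    (isClosed_le lastCoord_cont.abs continuous_const)).measurableSet

lemma vol_lower {N : ℕ} (hN : 3 ≤ N) : ∃ C, 0 < C ∧ ∀ R : ℝ, 1 ≤ R →
    ENNReal.ofReal (C * R ^ (N - 2)) ≤ volume (core N R) := by
  obtain ⟨c, hc, hb⟩ := band_lower hN
  refine ⟨c / 4, by positivity, ?_⟩
  intro R hR
  have hR0 : 0 < R := by linarith
  rw [← lintegral_indicator_one (core_meas R), polar_lintegral _ (measurable_one.indicator (core_meas R)) hN]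
  have hin : ∀ ω : S N, (band (1 / (R + 1))).indicator (fun _ => ENNReal.ofReal (R ^ (N - 1) * (1 / 2))) ω ≤
      (∫⁻ r in Ioi (0:ℝ), ENNReal.ofReal (r ^ (N - 1)) * (core N R).indicator 1 (r • (ω : E N))) := by
    intro ω
    by_cases hω1 : ω ∈ band (1 / (R + 1))
    swap
    · rw [indicator_of_notMem hω1]; exact bot_le
    rw [indicator_of_mem hω1]
    have hω : ‖(ω : E N)‖ = 1 := by simp
    have hn : ∀ r, 0 < r → ‖r • (ω : E N)‖ = r := fun r hr => by
      rw [norm_smul, hω, mul_one, Real.norm_eq_abs, abs_of_pos hr]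
    have hω2 : |lastCoord (ω : E N)| ≤ 1 / (R + 1) := hω1
    calc _ = ∫⁻ r in Icc (R + 1 / 4) (R + 3 / 4), ENNReal.ofReal (R ^ (N - 1)) := by
          rw [setLIntegral_const, Real.volume_Icc, ENNReal.ofReal_mul (by positivity)]
          congr 2; ring
      _ ≤ ∫⁻ r in Icc (R + 1 / 4) (R + 3 / 4), ENNReal.ofReal (r ^ (N - 1)) * (core N R).indicator 1 (r • (ω : E N)) := by
          apply setLIntegral_mono' measurableSet_Icc
          intro r hr
          have hr0 : 0 < r := by linarith [hr.1]
          have hm : r • (ω : E N) ∈ core N R := by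
            refine ⟨by rw [hn r hr0]; exact hr, ?_⟩
            rw [lastCoord_smul, abs_mul, abs_of_pos hr0]
            rw [le_div_iff₀ (by linarith)] at hω2
            have := abs_nonneg (lastCoord (ω : E N))
            nlinarith [hr.2]
          rw [indicator_of_mem hm, Pi.one_apply, mul_one]
          apply ENNReal.ofReal_le_ofReal
          have : R ≤ r := by linarith [hr.1]
          gcongr
      _ ≤ _ := lintegral_mono_set fun r hr => show 0 < r by linarith [hr.1]
  refine le_trans ?_ (lintegral_mono hin)
  rw [lintegral_indicator (band_meas _), setLIntegral_const]
  calc _ ≤ ENNReal.ofReal (R ^ (N - 1) * (1 / 2) * (c * (1 / (R + 1)))) := by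
        apply ENNReal.ofReal_le_ofReal
        rw [show N - 1 = (N - 2) + 1 by omega, pow_succ]
        have h1 : 1 / 2 ≤ R * (1 / (R + 1)) := by rw [mul_one_div, div_le_div_iff₀ (by norm_num) (by linarith)]; linarith
        have h2 : 0 < R ^ (N - 2) := by positivity
        have h3 : c / 4 * R ^ (N - 2) = R ^ (N - 2) * (1 / 2) * c * (1 / 2) := by ring
        have h4 : R ^ (N - 2) * R * (1 / 2) * (c * (1 / (R + 1))) = R ^ (N - 2) * (1 / 2) * c * (R * (1 / (R + 1))) := by ring
        rw [h3, h4]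
        gcongr
    _ = ENNReal.ofReal (R ^ (N - 1) * (1 / 2)) * ENNReal.ofReal (c * (1 / (R + 1))) := ENNReal.ofReal_mul (by positivity)
    _ ≤ _ := mul_le_mul' le_rfl (hb _ (by positivity) (by rw [div_le_one (by linarith)]; linarith))

lemma tw_Hn {N : ℕ} (hN : 3 ≤ N) : ∃ C, 0 < C ∧ ∀ R : ℝ, 1 ≤ R → Hn R (tw R : E N → ℝ) ≤ C * R ^ (N - 2) := by
  obtain ⟨M, hM0, hM⟩ := chi_deriv_bd
  obtain ⟨C, hC, hv⟩ := vol_upper hN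
  refine ⟨((M + 1) ^ 2 + 1) * C, by positivity, ?_⟩
  intro R hR
  have hR0 : 0 < R := by linarith
  obtain ⟨c1, c2⟩ := contOn_ne_Ac hR0 (tw_c1 (N := N) R)
  have hms : MeasurableSet {x : E N | |lastCoord x| ≤ 2} := (isClosed_le lastCoord_cont.abs continuous_const).measurableSet
  calc Hn R (tw R : E N → ℝ) ≤ ∫ x in Ao N R, ({x : E N | |lastCoord x| ≤ 2}).indicator (fun _ => (M + 1) ^ 2 + 1) x := by
        apply setIntegral_mono_on (intOn_Ao ((c2.norm.pow 2).add (c1.pow 2))) _ (Ao_meas R)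
        · intro x hx; exact tw_grad hN hR0 hM hx
        · exact (intOn_Ao continuousOn_const).indicator hms
    _ = ((M + 1) ^ 2 + 1) * volume.real (Ao N R ∩ {x : E N | |lastCoord x| ≤ 2}) := by
        rw [setIntegral_indicator hms, setIntegral_const, smul_eq_mul, mul_comm]
    _ ≤ ((M + 1) ^ 2 + 1) * (C * R ^ (N - 2)) := by
        apply mul_le_mul_of_nonneg_left _ (by positivity)
        exact ENNReal.toReal_le_of_le_ofReal (by positivity) (hv R hR)
    _ = _ := by ring

lemma tw_IP {N : ℕ} (hN : 3 ≤ N) {p : ℝ} (hp : 2 < p) : ∃ C, 0 < C ∧ ∀ R : ℝ, 1 ≤ R → C * R ^ (N - 2) ≤ IP R p (tw R : E N → ℝ) := by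
  obtain ⟨C, hC, hv⟩ := vol_lower hN
  refine ⟨(3 / 16) ^ p * C, by positivity, ?_⟩
  intro R hR
  have hR0 : 0 < R := by linarith
  have hp0 : 0 < p := by linarith
  have hcone := tw_cone (N := N) hR0
  have hcs : core N R ⊆ Ao N R := fun x hx => ⟨by linarith [hx.1.1], by linarith [hx.1.2]⟩
  have hfin : volume (core N R) ≠ ⊤ := ((Ao_bounded R).subset hcs).measure_lt_top.ne
  calc (3 / 16) ^ p * C * R ^ (N - 2) = (3 / 16) ^ p * (C * R ^ (N - 2)) := by ring
    _ ≤ (3 / 16) ^ p * volume.real (core N R) := by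
        apply mul_le_mul_of_nonneg_left _ (by positivity)
        exact (ENNReal.ofReal_le_iff_le_toReal hfin).1 (hv R hR)
    _ = ∫ x in core N R, (3 / 16 : ℝ) ^ p := by rw [setIntegral_const, smul_eq_mul, mul_comm]
    _ ≤ ∫ x in core N R, tw R x ^ p := by
        apply setIntegral_mono_on (integrableOn_const hfin) ((intOn_Ao (pow_cont hp0.le hcone.cont)).mono_set hcs) (core_meas R)
        intro x hx
        apply Real.rpow_le_rpow (by norm_num) _ hp0.le
        unfold tw
        rw [chi_one (by rw [← sq_abs]; nlinarith [hx.2, abs_nonneg (lastCoord x)]), mul_one]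
        nlinarith [hx.1.1, hx.1.2]
    _ ≤ _ := by
        apply setIntegral_mono_set (intOn_Ao (pow_cont hp0.le hcone.cont))
        · exact ae_Ao fun x hx => Real.rpow_nonneg (hcone.nn x (Ao_sub R hx)) p
        · exact hcs.eventuallyLE

end Ann
end
end

section
open MeasureTheory Real Set
open scoped ENNReal NNReal Topology
noncomputable section
namespace Ann

lemma Hn_scale {N : ℕ} {R : ℝ} (hR : 0 < R) {u : E N → ℝ} (hu : ContDiffOn ℝ 1 u {x | x ≠ 0}) (t : ℝ) :
    Hn R (fun x => t * u x) = t ^ 2 * Hn R u := by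
  unfold Hn
  rw [← integral_const_mul]
  apply setIntegral_congr_fun (Ao_meas R)
  intro x hx
  have hd : DifferentiableAt ℝ u x :=
    (hu.contDiffAt (isOpen_ne.mem_nhds (Ao_sub_ne hR hx))).differentiableAt one_ne_zero
  have e : fderiv ℝ (fun x => t * u x) x = t • fderiv ℝ u x := fderiv_const_mul hd t
  dsimp only
  rw [norm_fderiv_grad, norm_fderiv_grad, e, norm_smul, mul_pow, Real.norm_eq_abs, sq_abs]
  ring

lemma IP_scale {N : ℕ} {R p : ℝ} {u : E N → ℝ} (hu : Cone R u) {t : ℝ} (ht : 0 ≤ t) :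
    IP R p (fun x => t * u x) = t ^ p * IP R p u := by
  unfold IP
  rw [← integral_const_mul]
  apply setIntegral_congr_fun (Ao_meas R)
  intro x hx
  exact Real.mul_rpow ht (hu.nn x (Ao_sub R hx))

lemma Cone.scale {N : ℕ} {R : ℝ} {u : E N → ℝ} (hu : Cone R u) {t : ℝ} (ht : 0 ≤ t) : Cone R (fun x => t * u x) :=
  ⟨continuousOn_const.mul hu.cont, fun x hx => mul_nonneg ht (hu.nn x hx),
    fun x hx y hy h1 h2 => mul_le_mul_of_nonneg_left (hu.mono x hx y hy h1 h2) ht⟩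

lemma competitor {N : ℕ} (hN : 3 ≤ N) {p : ℝ} (hp : 2 < p) : ∃ C, 0 < C ∧ ∀ R : ℝ, 2 * N ≤ R → ∃ w : E N → ℝ,
    Cone R w ∧ ContDiffOn ℝ 1 w {x | x ≠ 0} ∧ (∀ x, (‖x‖ = R ∨ ‖x‖ = R + 1) → w x = 0) ∧ 0 < IP R p w ∧
    Hn R w = IP R p w ∧ Hn R w ≤ C * R ^ (N - 2) := by
  have h3 := cast3 hN
  obtain ⟨C1, hC1, hH⟩ := tw_Hn hN
  obtain ⟨C2, hC2, hI⟩ := tw_IP hN hp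
  refine ⟨((C1 / C2) ^ (1 / (p - 2))) ^ 2 * C1, by positivity, ?_⟩
  intro R hR
  have hR1 : 1 ≤ R := by linarith
  have hR0 : 0 < R := by linarith
  have H := hH R hR1
  have I := hI R hR1
  have hpow : 0 < R ^ (N - 2) := by positivity
  have hIpos : 0 < IP R p (tw R : E N → ℝ) := lt_of_lt_of_le (by positivity) I
  have hcone := tw_cone (N := N) hR0
  have hHpos : 0 < Hn R (tw R : E N → ℝ) := by
    have h0 : 0 ≤ Hn R (tw R : E N → ℝ) := integral_nonneg fun x => by positivity
    rcases h0.lt_or_eq with h | h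
    · exact h
    · have := dual_lower hN hR hp hcone (tw_c1 R) (tw_bc R) hIpos
      rw [← h, mul_zero] at this
      have h2 : 0 < (IP R p (tw R : E N → ℝ) ^ (1 / p)) ^ 2 := by positivity
      linarith
  set t := (Hn R (tw R : E N → ℝ) / IP R p (tw R : E N → ℝ)) ^ (1 / (p - 2)) with ht
  have ht0 : 0 < t := by positivity
  have htp : t ^ p * IP R p (tw R : E N → ℝ) = t ^ 2 * Hn R (tw R : E N → ℝ) := by
    have e1 : t ^ p = t ^ (p - 2) * t ^ 2 := by
      rw [← Real.rpow_natCast t 2, ← Real.rpow_add ht0]; congr 1; norm_num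
    have e2 : t ^ (p - 2) = Hn R (tw R : E N → ℝ) / IP R p (tw R : E N → ℝ) := by
      rw [ht, ← Real.rpow_mul (by positivity), one_div, inv_mul_cancel₀ (by linarith), Real.rpow_one]
    rw [e1, e2]; field_simp
  have htle : t ≤ (C1 / C2) ^ (1 / (p - 2)) := by
    apply Real.rpow_le_rpow (by positivity) _ (one_div_nonneg.2 (by linarith))
    rw [div_le_div_iff₀ hIpos hC2]
    calc _ ≤ C1 * R ^ (N - 2) * C2 := by gcongr
      _ = C1 * (C2 * R ^ (N - 2)) := by ring
      _ ≤ _ := by gcongr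
  refine ⟨fun x => t * tw R x, hcone.scale ht0.le, contDiffOn_const.mul (tw_c1 R), ?_, ?_, ?_, ?_⟩
  · intro x hx; dsimp only; rw [tw_bc R x hx, mul_zero]
  · rw [IP_scale hcone ht0.le]; positivity
  · rw [IP_scale hcone ht0.le, Hn_scale hR0 (tw_c1 R), htp]
  · rw [Hn_scale hR0 (tw_c1 R), mul_assoc]
    gcongr

lemma ground {N : ℕ} (hN : 3 ≤ N) {R p : ℝ} (hR : 2 * N ≤ R) (hp : 2 < p) {w : E N → ℝ} (hwC : Cone R w)
    (hw : ContDiffOn ℝ 1 w {x | x ≠ 0}) (hw0 : ∀ x, (‖x‖ = R ∨ ‖x‖ = R + 1) → w x = 0)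
    (hI : 0 < IP R p w) (hHI : Hn R w = IP R p w) :
    ∃ U : E N → ℝ, Cone R U ∧ Sol 1 R (fun x => U x ^ (p - 1)) U ∧ 0 < IP R p U ∧ IP R p U ≤ IP R p w ∧ Hn R U = IP R p U := by
  have h3 := cast3 hN
  have hR0 : 0 < R := by linarith
  have hp0 : 0 < p := by linarith
  have hp2 : p - 2 ≠ 0 := by linarith
  obtain ⟨S, u, hS, hC, hu, hIu, hq⟩ := dual hN hR hp hwC hw hw0 hI
  rw [hHI] at hq
  set X := IP R p w with hX
  set c := S ^ (-((p - 1) / (p - 2))) with hc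
  have hc0 : 0 < c := by positivity
  have hCU := hC.scale hc0.le
  have hIu' : IP R p u = S ^ p := by
    rw [← hIu, ← Real.rpow_mul (IP_nonneg hC.nn), one_div, inv_mul_cancel₀ hp0.ne', Real.rpow_one]
  have hIU : IP R p (fun x => c * u x) = S ^ (-(p / (p - 2))) := by
    rw [IP_scale hC hc0.le, hIu', hc, ← Real.rpow_mul hS.le, ← Real.rpow_add hS]
    congr 1; field_simp; ring
  have hcont : ContinuousOn (fun x => u x ^ (p - 1) * S ^ (-(p - 1))) (Ac N R) :=
    (pow_cont (by linarith) hC.cont).mul continuousOn_const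
  have hSol : Sol 1 R (fun x => (c * u x) ^ (p - 1)) (fun x => c * u x) := by
    have h1 := hu.lin hR0 hu hcont hcont c 0
    have e : (fun x => c * u x + 0 * u x) = fun x => c * u x := by ext x; ring
    rw [e] at h1
    apply h1.congr_rhs
    intro x hx
    rw [Real.mul_rpow hc0.le (hC.nn x (Ao_sub R hx))]
    have e2 : c ^ (p - 1) = c * S ^ (-(p - 1)) := by
      rw [hc, ← Real.rpow_mul hS.le, ← Real.rpow_add hS]
      congr 1; field_simp; ring
    rw [e2]; ring
  have hSX : X ^ (2 / p - 1) ≤ S := by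
    have e1 : (X ^ (1 / p)) ^ 2 = X ^ (2 / p - 1) * X := by
      rw [← Real.rpow_natCast, ← Real.rpow_mul hI.le, ← Real.rpow_add_one hI.ne']
      congr 1; push_cast; ring
    rw [e1] at hq
    exact le_of_mul_le_mul_right hq hI
  refine ⟨fun x => c * u x, hCU, hSol, ?_, ?_, ?_⟩
  · rw [hIU]; positivity
  · rw [hIU]
    calc S ^ (-(p / (p - 2))) ≤ (X ^ (2 / p - 1)) ^ (-(p / (p - 2))) := by
          apply Real.rpow_le_rpow_of_nonpos (by positivity) hSX
          have : 0 < p / (p - 2) := div_pos hp0 (by linarith)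
          linarith
      _ = X := by
          rw [← Real.rpow_mul hI.le]
          have : (2 / p - 1) * -(p / (p - 2)) = 1 := by field_simp; ring
          rw [this, Real.rpow_one]
  · have hRC : Cone R (fun x => (c * u x) ^ (p - 1)) :=
      ⟨pow_cont (by linarith) hCU.cont, fun x hx => Real.rpow_nonneg (hCU.nn x hx) _,
        fun x hx y hy h1 h2 => Real.rpow_le_rpow (hCU.nn y hy) (hCU.mono x hx y hy h1 h2) (by linarith)⟩
    rw [energy hN hR0 hSol hRC]
    apply setIntegral_congr_fun (Ao_meas R)
    intro x hx
    have h0 := hCU.nn x (Ao_sub R hx)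
    have := Real.rpow_add_one' h0 (y := p - 1) (by linarith)
    rw [sub_add_cancel] at this
    exact this.symm

/-- the meridian point with polar coordinates `(r, θ)` -/
def mer {N : ℕ} (hN : 3 ≤ N) (r θ : ℝ) : E N := r • (Real.cos θ • EuclideanSpace.single (zz hN) (1:ℝ) + Real.sin θ • eN N)

lemma lastCoord_mer {N : ℕ} (hN : 3 ≤ N) (r θ : ℝ) : lastCoord (mer hN r θ) = r * Real.sin θ := by
  have h1 : lastCoord (EuclideanSpace.single (zz hN) (1:ℝ) : E N) = 0 := by
    rw [lastCoord_ll hN]; simp [(zz_ne hN).symm]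
  have h2 : lastCoord (eN N) = 1 := by
    rw [lastCoord_eq, real_inner_self_eq_norm_sq, eN_norm hN]; norm_num
  rw [mer, lastCoord_smul, lastCoord_eq, inner_add_right, real_inner_smul_right, real_inner_smul_right, ← lastCoord_eq,
    ← lastCoord_eq, h1, h2]
  ring

lemma norm_mer {N : ℕ} (hN : 3 ≤ N) {r : ℝ} (hr : 0 ≤ r) (θ : ℝ) : ‖mer hN r θ‖ = r := by
  have h1 : inner ℝ (EuclideanSpace.single (zz hN) (1:ℝ) : E N) (eN N) = 0 := by
    rw [real_inner_comm, ← lastCoord_eq, lastCoord_ll hN]; simp [(zz_ne hN).symm]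
  have h2 : ‖Real.cos θ • (EuclideanSpace.single (zz hN) (1:ℝ) : E N) + Real.sin θ • eN N‖ ^ 2 = 1 := by
    rw [norm_add_sq_real, real_inner_smul_left, real_inner_smul_right, h1, norm_smul, norm_smul, eN_norm hN,
      EuclideanSpace.norm_single]
    simp
  have h3 : ‖Real.cos θ • (EuclideanSpace.single (zz hN) (1:ℝ) : E N) + Real.sin θ • eN N‖ = 1 := by
    rwa [pow_eq_one_iff_of_nonneg (norm_nonneg _) two_ne_zero] at h2
  rw [mer, norm_smul, h3, mul_one, Real.norm_eq_abs, abs_of_nonneg hr]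

lemma Cone.eq_mer {N : ℕ} (hN : 3 ≤ N) {R : ℝ} (hR : 0 < R) {u : E N → ℝ} (hu : Cone R u) {x : E N} (hx : x ∈ Ac N R) :
    u x = u (mer hN ‖x‖ (angleOf x)) := by
  have hx0 : 0 < ‖x‖ := hR.trans_le hx.1
  have hn := norm_mer hN hx0.le (angleOf x)
  have hl : lastCoord (mer hN ‖x‖ (angleOf x)) = lastCoord x := by
    have h1 := abs_le.1 (lastCoord_le hN x)
    rw [lastCoord_mer, angleOf, Real.sin_arcsin]
    · field_simp
    · rw [le_div_iff₀ hx0]; linarith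
    · rw [div_le_one hx0]; linarith
  have hm : mer hN ‖x‖ (angleOf x) ∈ Ac N R := ⟨by rw [hn]; exact hx.1, by rw [hn]; exact hx.2⟩
  exact le_antisymm (hu.mono _ hm x hx hn (by rw [hl])) (hu.mono x hx _ hm hn.symm (by rw [hl]))

lemma Cone.memKhat {N : ℕ} (hN : 3 ≤ N) {R : ℝ} (hR : 0 < R) {u : E N → ℝ} (hu : Cone R u)
    (hc : ContDiffOn ℝ 1 u {x | x ≠ 0}) : memKhat N R (R + 1) u := by
  have hcl : closure (annulus N R (R + 1)) = Ac N R := closure_Ao hR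
  unfold _root_.memKhat IsAxiallySymmRep
  rw [hcl]
  have hmem : ∀ r ∈ Icc R (R + 1), ∀ θ, mer hN r θ ∈ Ac N R := by
    intro r hr θ
    have := norm_mer hN (hR.le.trans hr.1) θ
    exact ⟨by rw [this]; exact hr.1, by rw [this]; exact hr.2⟩
  have hmono : ∀ r ∈ Icc R (R + 1), ∀ a b, |Real.sin a| ≤ |Real.sin b| → u (mer hN r b) ≤ u (mer hN r a) := by
    intro r hr a b hab
    have h0 := hR.le.trans hr.1
    apply hu.mono _ (hmem r hr a) _ (hmem r hr b)
    · rw [norm_mer hN h0, norm_mer hN h0]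
    · rw [lastCoord_mer, lastCoord_mer, abs_mul, abs_mul]
      gcongr
  refine ⟨hc.mono fun x hx => Ac_ne hR hx, hu.nn, fun r θ => u (mer hN r θ), fun x hx => hu.eq_mer hN hR hx, ?_, ?_⟩
  · intro r hr θ _
    apply le_antisymm <;> apply hmono r hr <;> rw [Real.sin_neg, abs_neg]
  · intro r hr a ha b hb hab
    apply hmono r hr
    rw [abs_of_nonneg (Real.sin_nonneg_of_nonneg_of_le_pi ha.1 (by linarith [ha.2, Real.pi_pos])),
      abs_of_nonneg (Real.sin_nonneg_of_nonneg_of_le_pi hb.1 (by linarith [hb.2, Real.pi_pos]))]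
    exact Real.sin_le_sin_of_le_of_le_pi_div_two (by linarith [ha.1, Real.pi_pos]) hb.2 hab

lemma H1sq_eq {N : ℕ} {R : ℝ} (hR : 0 < R) (u : E N → ℝ) :
    H1sq N R (R + 1) u = ∫ x in Ao N R, (‖fderivWithin ℝ u (Ac N R) x‖ ^ 2 + u x ^ 2) := by
  unfold H1sq
  rw [show closure (annulus N R (R + 1)) = Ac N R from closure_Ao hR]

lemma Hn_eq {N : ℕ} {R : ℝ} (u : E N → ℝ) :
    Hn R u = ∫ x in Ao N R, (‖fderivWithin ℝ u (Ac N R) x‖ ^ 2 + u x ^ 2) := by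
  apply setIntegral_congr_fun (Ao_meas R)
  intro x hx
  dsimp only
  rw [fdw_eq hx, norm_fderiv_grad]

lemma IP_eq_abs {N : ℕ} {R p : ℝ} {u : E N → ℝ} (hu : Cone R u) : IP R p u = ∫ x in Ao N R, |u x| ^ p := by
  apply setIntegral_congr_fun (Ao_meas R)
  intro x hx
  dsimp only
  rw [abs_of_nonneg (hu.nn x (Ao_sub R hx))]

lemma IP_ne {N : ℕ} {R p : ℝ} (hp : 2 < p) {u : E N → ℝ} (h : 0 < IP R p u) : ∃ x ∈ Ao N R, u x ≠ 0 := by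
  by_contra hcon
  push Not at hcon
  have : IP R p u = ∫ x in Ao N R, (0:ℝ) := by
    apply setIntegral_congr_fun (Ao_meas R)
    intro x hx
    dsimp only
    rw [hcon x hx, Real.zero_rpow (by linarith)]
  rw [this] at h
  simp at h

lemma Sol.isWeak {N : ℕ} {R p : ℝ} (hR : 0 < R) {U : E N → ℝ} (hU : Sol 1 R (fun x => U x ^ (p - 1)) U)
    (hpos : ∀ x ∈ Ao N R, 0 < U x) : IsWeakSolution N R (R + 1) (fun _ => 1) p U := by
  have hcl : closure (annulus N R (R + 1)) = Ac N R := closure_Ao hR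
  refine ⟨⟨?_, hU.bc⟩, ?_⟩
  · rw [hcl]; exact hU.c1.mono fun x hx => Ac_ne hR hx
  · rw [hcl]
    intro φ hφ
    have hT : Test (Ao N R) φ := ⟨hφ.1.of_le (by exact_mod_cast le_top), hφ.2.1, hφ.2.2⟩
    have hz : ∀ x, x ∉ Ao N R → φ x = 0 := fun x hx =>
      image_eq_zero_of_notMem_tsupport fun hh => hx (hφ.2.2 hh)
    have hw := hU.weak φ hT
    have e1 : (∫ x in Ao N R, (inner ℝ (gradient U x) (gradient φ x) + 1 * (U x * φ x))) =
        ∫ x, (inner ℝ (gradient U x) (gradient φ x) + 1 * (U x * φ x)) := by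
      apply setIntegral_eq_integral_of_forall_compl_eq_zero
      intro x hx
      rw [hz x hx, grad_zero_of_not_mem (fun hh => hx (hφ.2.2 hh)), inner_zero_right]
      ring
    have e2 : (∫ x in Ao N R, U x ^ (p - 1) * φ x) = ∫ x, U x ^ (p - 1) * φ x := by
      apply setIntegral_eq_integral_of_forall_compl_eq_zero
      intro x hx
      rw [hz x hx, mul_zero]
    rw [← e1, ← e2] at hw
    have e3 : (∫ x in annulus N R (R + 1), (fderivWithin ℝ U (Ac N R) x (gradient φ x) + U x * φ x)) =
        ∫ x in Ao N R, (inner ℝ (gradient U x) (gradient φ x) + 1 * (U x * φ x)) := by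
      apply setIntegral_congr_fun (Ao_meas R)
      intro x hx
      dsimp only
      rw [fdw_eq hx, fderiv_eq_inner, one_mul]
    rw [e3, hw]
    apply setIntegral_congr_fun (Ao_meas R)
    intro x hx
    have h0 := hpos x hx
    dsimp only
    rw [abs_of_pos h0, one_mul, ← Real.rpow_add_one h0.ne']
    congr 2; ring

theorem final (N : ℕ) (hN : 3 ≤ N) (p : ℝ) (hp : 2 < p) :
    ∃ Rstar : ℝ, 0 < Rstar ∧ ∀ R : ℝ, Rstar < R →
      (∀ u, memNehari N R (R + 1) (fun _ => 1) p u →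
          funcI N R (R + 1) (fun _ => 1) p u = cI N R (R + 1) (fun _ => 1) p →
          ∃ x ∈ annulus N R (R + 1), ∃ y ∈ annulus N R (R + 1), ‖x‖ = ‖y‖ ∧ u x ≠ u y) ∧
      (∃ u : EuclideanSpace ℝ (Fin N) → ℝ,
          IsWeakSolution N R (R + 1) (fun _ => 1) p u ∧
          (∀ x ∈ annulus N R (R + 1), 0 < u x) ∧
          (∃ 𝔲 : ℝ → ℝ → ℝ, IsAxiallySymmRep N R (R + 1) u 𝔲) ∧
          ∃ x ∈ annulus N R (R + 1), ∃ y ∈ annulus N R (R + 1), ‖x‖ = ‖y‖ ∧ u x ≠ u y) := by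
  have h3 := cast3 hN
  obtain ⟨C, hC, hcomp⟩ := competitor hN hp
  have hsg := sg_pos hN
  refine ⟨max (2 * N) (C / sg N), lt_max_of_lt_left (by linarith), ?_⟩
  intro R hR
  have hR1 : 2 * (N:ℝ) ≤ R := (le_max_left _ _).trans hR.le
  have hR2 : C / sg N < R := (le_max_right _ _).trans_lt hR
  have hR0 : 0 < R := by linarith
  have hcl : closure (annulus N R (R + 1)) = Ac N R := closure_Ao hR0
  obtain ⟨w, hwC, hw, hw0, hI, hHI, hle⟩ := hcomp R hR1
  have hlt : Hn R w < sg N * R ^ (N - 1) := by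
    refine hle.trans_lt ?_
    rw [show N - 1 = (N - 2) + 1 by omega, pow_succ]
    rw [div_lt_iff₀ hsg] at hR2
    have : 0 < R ^ (N - 2) := by positivity
    nlinarith
  have hp1 : 0 < 1 / 2 - 1 / p := by
    have : 1 / p < 1 / 2 := one_div_lt_one_div_of_lt (by norm_num) hp
    linarith
  have hfun : ∀ u, memNehari N R (R + 1) (fun _ => 1) p u →
      funcI N R (R + 1) (fun _ => 1) p u = (1 / 2 - 1 / p) * H1sq N R (R + 1) u := by
    intro u hu
    unfold funcI
    rw [← hu.2.2]; ring
  constructor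
  · intro u hu hmin
    by_contra hcon
    push Not at hcon
    have hone : (∫ x in annulus N R (R + 1), (1:ℝ) * |u x| ^ p) = ∫ x in Ao N R, |u x| ^ p := by
      simp only [one_mul]
    have hu3 := hu.2.2
    rw [hone] at hu3
    have hbig := radial_big hN hR0 hp (u := u) (by rw [← hcl]; exact hu.1.1.1) hu.1.2 hcon hu.2.1
      (by rw [← H1sq_eq hR0]; exact hu3)
    rw [← hu3] at hbig
    have hwN : memNehari N R (R + 1) (fun _ => 1) p w := by
      refine ⟨⟨hwC.memKhat hN hR0 hw, hw0⟩, IP_ne hp hI, ?_⟩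
      rw [H1sq_eq hR0, ← Hn_eq, hHI, IP_eq_abs hwC]
      simp only [one_mul]
    have hcI : cI N R (R + 1) (fun _ => 1) p ≤ funcI N R (R + 1) (fun _ => 1) p w := by
      apply csInf_le
      · refine ⟨0, ?_⟩
        rintro c ⟨v, hv, rfl⟩
        rw [hfun v hv]
        apply mul_nonneg hp1.le
        exact integral_nonneg fun x => by positivity
      · exact ⟨w, hwN, rfl⟩
    rw [← hmin, hfun u hu, hfun w hwN, H1sq_eq hR0 w, ← Hn_eq] at hcI
    have := le_of_mul_le_mul_left hcI hp1
    linarith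
  · obtain ⟨U, hUC, hUS, hUI, hUle, hUH⟩ := ground hN hR1 hp hwC hw hw0 hI hHI
    obtain ⟨x0, hx0, hne⟩ := IP_ne hp hUI
    have hpos : ∀ x ∈ Ao N R, 0 < U x := by
      apply hUS.pos hN hR0 (fun x hx => Real.rpow_nonneg (hUC.nn x (Ao_sub R hx)) _) hx0
      exact lt_of_le_of_ne (hUC.nn x0 (Ao_sub R hx0)) hne.symm
    refine ⟨U, hUS.isWeak hR0 hpos, hpos, ?_, ?_⟩
    · obtain ⟨-, -, 𝔲, h, -⟩ := hUC.memKhat hN hR0 hUS.c1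
      exact ⟨𝔲, h⟩
    · by_contra hcon
      push Not at hcon
      have hbig := radial_big hN hR0 hp (u := U) (hUS.c1.mono fun x hx => Ac_ne hR0 hx) hUS.bc hcon ⟨x0, hx0, hne⟩
        (by rw [← Hn_eq, hUH, IP_eq_abs hUC])
      rw [← IP_eq_abs hUC] at hbig
      linarith

end Ann
end
end

/-- nonradial ground states in large annuli `A_R = {R < |x| < R+1}` (case `a ≡ 1`). -/
theorem statement2 (N : ℕ) (hN : 3 ≤ N) (p : ℝ) (hp : 2 < p) :
    ∃ Rstar : ℝ, 0 < Rstar ∧ ∀ R : ℝ, Rstar < R →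
      (∀ u, memNehari N R (R + 1) (fun _ => 1) p u →
          funcI N R (R + 1) (fun _ => 1) p u = cI N R (R + 1) (fun _ => 1) p →
          ∃ x ∈ annulus N R (R + 1), ∃ y ∈ annulus N R (R + 1), ‖x‖ = ‖y‖ ∧ u x ≠ u y) ∧
      (∃ u : EuclideanSpace ℝ (Fin N) → ℝ,
          IsWeakSolution N R (R + 1) (fun _ => 1) p u ∧
          (∀ x ∈ annulus N R (R + 1), 0 < u x) ∧
          (∃ 𝔲 : ℝ → ℝ → ℝ, IsAxiallySymmRep N R (R + 1) u 𝔲) ∧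
          ∃ x ∈ annulus N R (R + 1), ∃ y ∈ annulus N R (R + 1), ‖x‖ = ‖y‖ ∧ u x ≠ u y) := by
  exact Ann.final N hN p hp
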